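/- arXiv:2602.15719 — 3 statements merged into one kernel-verified Lean document; each statement's English description precedes it below -/
import Mathlib

section
/- (Keane's condition, one-sided variant.) Let N > 1, let T : [0,1) → [0,1) be a right-continuous interval exchange transformation, and let a_1 < ⋯ < a_{N−1} be the list of all discontinuities of T (so 0 < a_1 and a_{N−1} < 1). Suppose that the forward orbit sets Ω_j = {T^n a_j : n ≥ 1}, j ∈ {1, …, N−1}, are pairwise disjoint, and that each Ω_j is infinite. Then T is minimal: for every x ∈ [0,1), the forward orbit {T^n x : n ≥ 1} is dense in [0,1). -/
/-- A right-continuous interval exchange transformation of `[c, d)`. -/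
def IsIETOn (T : ℝ → ℝ) (c d : ℝ) : Prop :=
  ∃ (N : ℕ) (p : ℕ → ℝ) (σ : ℕ → ℝ),
    1 ≤ N ∧ p 0 = c ∧ p N = d ∧ (∀ i < N, p i < p (i + 1)) ∧
    (∀ i < N, ∀ x ∈ Set.Ico (p i) (p (i + 1)), T x = x + σ i) ∧
    Set.BijOn T (Set.Ico c d) (Set.Ico c d)

/-- A right-continuous IET of `[0, 1)`. -/
def IsIET (T : ℝ → ℝ) : Prop := IsIETOn T 0 1

/-- The set of discontinuities of `T` viewed as a map of `[c, d)`. -/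
def Discont (T : ℝ → ℝ) (c d : ℝ) : Set ℝ :=
  {x | x ∈ Set.Ico c d ∧ ¬ ContinuousWithinAt T (Set.Ico c d) x}

/-- The forward orbit `{T^n x | n ≥ 1}` of a point `x`. -/
def fwdOrbit (T : ℝ → ℝ) (x : ℝ) : Set ℝ :=
  {y | ∃ n : ℕ, 1 ≤ n ∧ T^[n] x = y}

open Set Function

/-- `f` maps `[0, 1)` to itself and is locally a translation to the right of every point,
and to the left of every point of `(0, 1)` outside the finite set `A`. -/
structure IsPiecewiseTranslation (f : ℝ → ℝ) (A : Set ℝ) : Prop where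
  finite : A.Finite
  mapsTo : MapsTo f (Ico 0 1) (Ico 0 1)
  right : ∀ x ∈ Ico (0 : ℝ) 1, ∃ ε > 0, x + ε ≤ 1 ∧ ∀ t, 0 ≤ t → t < ε → f (x + t) = f x + t
  left : ∀ x ∈ Ioo (0 : ℝ) 1, x ∉ A →
    ∃ ε > 0, ε ≤ x ∧ ∀ t, 0 ≤ t → t < ε → f (x - t) = f x - t

/-- The left endpoints in `[0, 1)` of the maximal open intervals contained in `U`. -/
def leftEnds (U : Set ℝ) : Set ℝ :=
  {l | l ∈ Ico (0 : ℝ) 1 ∧ l ∉ U ∧ ∃ ρ > 0, Ioo l (l + ρ) ⊆ U}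

lemma exists_ball_avoiding {A : Set ℝ} (hA : A.Finite) (x : ℝ) :
    ∃ δ > 0, ∀ a ∈ A, a ≠ x → δ ≤ |a - x| := by
  have hopen : IsOpen (A \ {x})ᶜ := hA.sdiff.isClosed.isOpen_compl
  obtain ⟨δ, hδ, hsub⟩ := Metric.isOpen_iff.1 hopen x (by simp)
  refine ⟨δ, hδ, fun a ha hne => ?_⟩
  by_contra hlt
  exact hsub (show a ∈ Metric.ball x δ by rw [Metric.mem_ball, Real.dist_eq]; linarith) ⟨ha, hne⟩

lemma injective_iterate_of_ne_self {f : ℝ → ℝ} {s : Set ℝ} (hf : MapsTo f s s)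
    (hper : ∀ p ∈ s, ∀ n, 1 ≤ n → f^[n] p ≠ p) {x : ℝ} (hx : x ∈ s) :
    Injective fun n => f^[n] x := by
  refine Function.Injective.of_lt_imp_ne fun m n hmn heq => ?_
  refine hper _ (hf.iterate m hx) (n - m) (by omega) ?_
  rw [← iterate_add_apply, Nat.sub_add_cancel hmn.le]
  exact heq.symm

namespace IsPiecewiseTranslation

variable {f g : ℝ → ℝ} {A U : Set ℝ}

lemma translate (hf : IsPiecewiseTranslation f A) {x u : ℝ} (hx : x ∈ Ico (0 : ℝ) 1)
    (hu : 0 ≤ u) (hxu : x + u < 1) (hA : ∀ a ∈ A, x < a → x + u < a) :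
    f (x + u) = f x + u := by
  have hright : ∀ t ∈ Icc 0 u, ∃ ε > 0, ∀ s, t ≤ s → s < t + ε →
      f (x + s) - s = f (x + t) - t := by
    intro t ht
    obtain ⟨ε, hε, -, h⟩ := hf.right (x + t) ⟨by linarith [hx.1, ht.1], by linarith [ht.2]⟩
    refine ⟨ε, hε, fun s hs hs' => ?_⟩
    have := h (s - t) (by linarith) (by linarith)
    rw [show x + t + (s - t) = x + s by ring] at this
    linarith
  have hleft : ∀ t ∈ Ioc 0 u, ∃ ε > 0, ∀ s, s ≤ t → t - ε < s →
      f (x + s) - s = f (x + t) - t := by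
    intro t ht
    obtain ⟨ε, hε, -, h⟩ := hf.left (x + t) ⟨by linarith [hx.1, ht.1], by linarith [ht.2]⟩
      (fun hmem => by linarith [hA _ hmem (by linarith [ht.1]), ht.2])
    refine ⟨ε, hε, fun s hs hs' => ?_⟩
    have := h (t - s) (by linarith) (by linarith)
    rw [show x + t - (t - s) = x + s by ring] at this
    linarith
  have key := constant_of_has_deriv_right_zero (f := fun t => f (x + t) - t) (a := 0) (b := u)
    (by
      intro t ht
      rw [Metric.continuousWithinAt_iff]
      intro η hη
      obtain ⟨ε, hε, h⟩ := hright t ht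
      rcases ht.1.eq_or_lt with h0 | h0
      · refine ⟨ε, hε, fun {s} hs hd => ?_⟩
        rw [Real.dist_eq, abs_lt] at hd
        have := h s (by linarith [hs.1]) (by linarith)
        simp only [this, dist_self, hη]
      · obtain ⟨δ, hδ, h'⟩ := hleft t ⟨h0, ht.2⟩
        refine ⟨min ε δ, lt_min hε hδ, fun {s} hs hd => ?_⟩
        rw [Real.dist_eq, abs_lt] at hd
        have : f (x + s) - s = f (x + t) - t := by
          rcases le_total t s with hts | hts
          · exact h s hts (by linarith [min_le_left ε δ])
          · exact h' s hts (by linarith [min_le_right ε δ])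
        simp only [this, dist_self, hη])
    (by
      intro t ht
      obtain ⟨ε, hε, h⟩ := hright t ⟨ht.1, ht.2.le⟩
      refine (hasDerivWithinAt_const t (Ici t) (f (x + t) - t)).congr_of_eventuallyEq ?_ rfl
      filter_upwards [Ico_mem_nhdsGE (show t < t + ε by linarith)] with s hs
      exact h s hs.1 hs.2)
    u ⟨hu, le_rfl⟩
  simp only [add_zero, sub_zero] at key
  linarith

lemma pos (hf : IsPiecewiseTranslation f A) {x : ℝ} (hx : x ∈ Ioo (0 : ℝ) 1) (hxA : x ∉ A) :
    0 < f x := by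
  obtain ⟨ε, hε, hεx, h⟩ := hf.left x hx hxA
  have h1 := h (ε / 2) (by linarith) (by linarith)
  have h2 := (hf.mapsTo (x := x - ε / 2) ⟨by linarith, by linarith [hx.2]⟩).1
  linarith

lemma iterate_mem (hf : IsPiecewiseTranslation f A) {x : ℝ} (hx : x ∈ Ico (0 : ℝ) 1) (n : ℕ) :
    f^[n] x ∈ Ico (0 : ℝ) 1 := hf.mapsTo.iterate n hx

/-- A piecewise translation with a periodic point has a periodic point in `A ∪ {0}`. -/
lemma exists_periodic_break (hf : IsPiecewiseTranslation f A) {p : ℝ} (hp : p ∈ Ico (0 : ℝ) 1)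
    {n : ℕ} (hn : 1 ≤ n) (hper : f^[n] p = p) : ∃ c ∈ insert 0 A, f^[n] c = c := by
  have hq : ∀ k, f^[n] (f^[k] p) = f^[k] p := by
    intro k
    rw [← iterate_add_apply, add_comm, iterate_add_apply, hper]
  have hPfin : (range fun k => f^[k] p).Finite := by
    refine ((Finset.range n).finite_toSet.image fun k => f^[k] p).subset ?_
    rintro _ ⟨k, rfl⟩
    refine ⟨k % n, by simpa using Nat.mod_lt _ (by omega), ?_⟩
    exact IsPeriodicPt.iterate_mod_apply hper k
  let M : Set ℝ :=
    (fun z : ℝ × ℝ => z.1 - z.2) '' ((range fun k => f^[k] p) ×ˢ (insert 0 A)) ∩ Ici 0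
  have hMfin : M.Finite := ((hPfin.prod (hf.finite.insert 0)).image _).inter_of_left _
  have hMne : M.Nonempty :=
    ⟨p, ⟨(p, 0), ⟨⟨0, rfl⟩, mem_insert _ _⟩, by simp⟩, hp.1⟩
  obtain ⟨t, ⟨⟨⟨q, c⟩, ⟨⟨k, hk⟩, hc⟩, hqc⟩, ht0⟩, hmin⟩ := hMfin.exists_minimal hMne
  have hmin' : ∀ m, ∀ a ∈ insert 0 A, a ≤ f^[m] p → t ≤ f^[m] p - a := by
    intro m a ha hle
    by_contra hlt
    have := hmin (y := f^[m] p - a) ⟨⟨(f^[m] p, a), ⟨⟨m, rfl⟩, ha⟩, rfl⟩, by simpa using hle⟩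
      (by linarith)
    linarith
  simp only at hk hqc
  have ht0' : 0 ≤ t := ht0
  have hstep : ∀ m, f (f^[m] p - t) = f^[m + 1] p - t := by
    intro m
    have hm := hf.iterate_mem hp m
    have h0 := hmin' m 0 (mem_insert _ _) hm.1
    have := hf.translate (x := f^[m] p - t) (u := t) ⟨by linarith, by linarith [hm.2]⟩ ht0'
      (by linarith [hm.2]) (fun a ha hlt => by
        by_contra hcon
        have := hmin' m a (mem_insert_of_mem _ ha) (by linarith)
        linarith)
    rw [sub_add_cancel] at this
    rw [iterate_succ_apply', this]
    ring
  have hall : ∀ j, f^[j] (f^[k] p - t) = f^[j + k] p - t := by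
    intro j
    induction j with
    | zero => simp
    | succ j ih => rw [iterate_succ_apply', ih, hstep, show j + 1 + k = j + k + 1 by ring]
  refine ⟨c, hc, ?_⟩
  have hck : c = f^[k] p - t := by linarith
  rw [hck, hall, iterate_add_apply, hq]

/-- An infinite orbit cannot consist of left endpoints of components of an open set that
is invariant away from the breaks. -/
lemma no_infinite_chain (hf : IsPiecewiseTranslation f A) (hUs : U ⊆ Ioo 0 1)
    (hU : ∀ z ∈ U, z ∉ A → f z ∈ U) {l : ℕ → ℝ} (hl : ∀ n, l n ∈ leftEnds U)
    (hstep : ∀ n, l (n + 1) = f (l n)) (hinj : Injective l) : False := by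
  have hfin : {n | ∃ a ∈ A, l n < a ∧ Ioo (l n) a ⊆ U}.Finite := by
    have : {n | ∃ a ∈ A, l n < a ∧ Ioo (l n) a ⊆ U} =
        ⋃ a ∈ A, {n | l n < a ∧ Ioo (l n) a ⊆ U} := by
      ext n; simp only [mem_ofPred_eq, mem_iUnion, exists_prop]
    rw [this]
    refine hf.finite.biUnion fun a _ => Set.Subsingleton.finite ?_
    rintro n ⟨hn, hn'⟩ m ⟨hm, hm'⟩
    apply hinj
    rcases lt_trichotomy (l n) (l m) with h | h | h
    · exact absurd (hn' ⟨h, hm⟩) (hl m).2.1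
    · exact h
    · exact absurd (hm' ⟨h, hn⟩) (hl n).2.1
  obtain ⟨n₀, hn₀⟩ := hfin.bddAbove
  obtain ⟨-, -, ρ, hρ, hsub⟩ := hl (n₀ + 1)
  have hall : ∀ k, Ioo (l (n₀ + 1 + k)) (l (n₀ + 1 + k) + ρ) ⊆ U := by
    intro k
    induction k with
    | zero => exact hsub
    | succ k ih =>
      rintro y ⟨hy, hy'⟩
      rw [← add_assoc, hstep] at hy hy'
      set x := l (n₀ + 1 + k) with hx
      have hno : ∀ a ∈ A, x < a → x + ρ ≤ a := by
        intro a ha hlt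
        by_contra hcon
        have : n₀ + 1 + k ≤ n₀ :=
          hn₀ ⟨a, ha, hlt, fun z hz => ih ⟨hz.1, by linarith [hz.2]⟩⟩
        omega
      have hmem : x + (y - f x) ∈ U := ih ⟨by linarith, by linarith⟩
      have ht := hf.translate (x := x) (u := y - f x) (hl _).1 (by linarith) (hUs hmem).2
        (fun a ha hlt => by linarith [hno a ha hlt])
      have := hU _ hmem (fun hmA => by linarith [hno _ hmA (by linarith)])
      rwa [ht, add_sub_cancel] at this
  have hgap : ∀ j k, l (n₀ + 1 + j) < l (n₀ + 1 + k) → l (n₀ + 1 + j) + ρ ≤ l (n₀ + 1 + k) := by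
    intro j k h
    by_contra hcon
    exact (hl _).2.1 (hall j ⟨h, by linarith⟩)
  obtain ⟨j, k, hjk, heq⟩ := Finite.exists_ne_map_eq_of_infinite
    (fun j : ℕ => (⟨⌊l (n₀ + 1 + j) / ρ⌋₊, Nat.lt_succ_of_le (Nat.floor_le_floor
      (div_le_div_of_nonneg_right (hl _).1.2.le hρ.le))⟩ : Fin (⌊1 / ρ⌋₊ + 1)))
  have heq' : ⌊l (n₀ + 1 + j) / ρ⌋₊ = ⌊l (n₀ + 1 + k) / ρ⌋₊ := congrArg Fin.val heq
  have hfl : ∀ i, (⌊l (n₀ + 1 + i) / ρ⌋₊ : ℝ) * ρ ≤ l (n₀ + 1 + i) ∧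
      l (n₀ + 1 + i) < (⌊l (n₀ + 1 + i) / ρ⌋₊ + 1 : ℝ) * ρ := fun i =>
    ⟨(le_div_iff₀ hρ).1 (Nat.floor_le (div_nonneg (hl _).1.1 hρ.le)),
      (div_lt_iff₀ hρ).1 (Nat.lt_floor_add_one _)⟩
  have h1 := hfl j
  have h2 := hfl k
  rw [heq'] at h1
  rcases lt_trichotomy (l (n₀ + 1 + j)) (l (n₀ + 1 + k)) with h | h | h
  · linarith [hgap j k h]
  · exact hjk (by have := hinj h; omega)
  · linarith [hgap k j h]

/-- If the left endpoint `l` is mapped outside `U`, its image is again a left endpoint. -/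
lemma leftEnds_image (hf : IsPiecewiseTranslation f A) (hU : ∀ z ∈ U, z ∉ A → f z ∈ U)
    {l : ℝ} (hl : l ∈ leftEnds U) (hfl : f l ∉ U) : f l ∈ leftEnds U := by
  obtain ⟨hl1, -, ρ, hρ, hsub⟩ := hl
  obtain ⟨ε, hε, -, h⟩ := hf.right l hl1
  obtain ⟨δ, hδ, hδA⟩ := exists_ball_avoiding hf.finite l
  refine ⟨hf.mapsTo hl1, hfl, min ρ (min ε δ), by positivity, fun y hy => ?_⟩
  obtain ⟨hy1, hy2⟩ := hy
  have m1 := min_le_left ρ (min ε δ)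
  have m2 := (min_le_right ρ (min ε δ)).trans (min_le_left ε δ)
  have m3 := (min_le_right ρ (min ε δ)).trans (min_le_right ε δ)
  have hmem : l + (y - f l) ∈ U := hsub ⟨by linarith, by linarith⟩
  have := hU _ hmem (fun hA => by
    have := hδA _ hA (by linarith)
    rw [add_sub_cancel_left, abs_of_pos (by linarith)] at this
    linarith)
  rwa [h _ (by linarith) (by linarith), add_sub_cancel] at this

/-- The right endpoint `r` of an invariant segment `(0, r)` is mapped into it unless it is fixed
or a break. -/
lemma image_mem_of_initial (hf : IsPiecewiseTranslation f A) (hU : ∀ z ∈ U, z ∉ A → f z ∈ U)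
    {r : ℝ} (hr : r ∈ Ioo (0 : ℝ) 1) (hUr : U = Ioo 0 r) (hrA : r ∉ A) (hfr : f r ≠ r) :
    f r ∈ U := by
  subst hUr
  have hpos := hf.pos hr hrA
  by_contra hcon
  have hge : r < f r := lt_of_le_of_ne (not_lt.1 fun h => hcon ⟨hpos, h⟩) hfr.symm
  obtain ⟨ε, hε, hεr, h⟩ := hf.left r hr hrA
  obtain ⟨δ, hδ, hδA⟩ := exists_ball_avoiding hf.finite r
  obtain ⟨t, ht0, ht⟩ := exists_between (show (0 : ℝ) < min ε (min δ (f r - r)) from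
    lt_min hε (lt_min hδ (by linarith)))
  obtain ⟨ht1, ht'⟩ := lt_min_iff.1 ht
  obtain ⟨ht2, ht3⟩ := lt_min_iff.1 ht'
  have := hU (r - t) ⟨by linarith, by linarith⟩ (fun hA => by
    have := hδA _ hA (by linarith)
    rw [sub_sub_cancel_left, abs_neg, abs_of_pos ht0] at this
    linarith)
  rw [h t ht0.le ht1] at this
  linarith [this.2]

lemma inverse (hf : IsPiecewiseTranslation f A) (hg : MapsTo g (Ico 0 1) (Ico 0 1))
    (hinv : InvOn g f (Ico 0 1) (Ico 0 1)) :
    IsPiecewiseTranslation g (f '' insert 0 A) where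
  finite := (hf.finite.insert 0).image _
  mapsTo := hg
  right y hy := by
    obtain ⟨ε, hε, hε1, h⟩ := hf.right (g y) (hg hy)
    rw [hinv.2 hy] at h
    have hmem : ∀ t, 0 ≤ t → t < ε → g y + t ∈ Ico (0 : ℝ) 1 := fun t h0 h1 =>
      ⟨by linarith [(hg hy).1], by linarith⟩
    refine ⟨ε, hε, ?_, fun t h0 h1 => ?_⟩
    · by_contra hcon
      have h1 := hf.mapsTo (hmem (1 - y) (by linarith [hy.2]) (by linarith))
      rw [h _ (by linarith [hy.2]) (by linarith)] at h1
      linarith [h1.2]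
    · rw [← h t h0 h1, hinv.1 (hmem t h0 h1)]
  left y hy hyA := by
    have hy' : y ∈ Ico (0 : ℝ) 1 := Ioo_subset_Ico_self hy
    have hx0 : g y ∉ insert 0 A := fun h => hyA ⟨g y, h, hinv.2 hy'⟩
    rw [mem_insert_iff, not_or] at hx0
    have hx := hg hy'
    obtain ⟨ε, hε, hεx, h⟩ := hf.left (g y) ⟨lt_of_le_of_ne hx.1 (Ne.symm hx0.1), hx.2⟩ hx0.2
    rw [hinv.2 hy'] at h
    have hmem : ∀ t, 0 ≤ t → t < ε → g y - t ∈ Ico (0 : ℝ) 1 := fun t h0 h1 =>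
      ⟨by linarith, by linarith [hx.2]⟩
    refine ⟨ε, hε, ?_, fun t h0 h1 => ?_⟩
    · by_contra hcon
      obtain ⟨t, ht, ht'⟩ := exists_between (not_le.1 hcon)
      have h1 := hf.mapsTo (hmem t (by linarith [hy.1]) ht')
      rw [h _ (by linarith [hy.1]) ht'] at h1
      linarith [h1.1]
    · rw [← h t h0 h1, hinv.1 (hmem t h0 h1)]

end IsPiecewiseTranslation

/-- `S` is the inverse of the piecewise translation `T`, whose breaks `D` are not joined by
forward orbits. -/
structure IsKeanePair (T S : ℝ → ℝ) (D : Set ℝ) : Prop where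
  fwd : IsPiecewiseTranslation T D
  bwd : IsPiecewiseTranslation S (T '' insert 0 D)
  inv : InvOn S T (Ico 0 1) (Ico 0 1)
  subset : D ⊆ Ioo 0 1
  nonempty : D.Nonempty
  no_connection : ∀ d ∈ D, ∀ n, 1 ≤ n → T^[n] d ∉ D

namespace IsKeanePair

variable {T S : ℝ → ℝ} {D U : Set ℝ}

lemma mem_Ico (h : IsKeanePair T S D) {d : ℝ} (hd : d ∈ D) : d ∈ Ico (0 : ℝ) 1 :=
  Ioo_subset_Ico_self (h.subset hd)

lemma zero_not_fixed (h : IsKeanePair T S D) : T 0 ≠ 0 := by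
  intro h0
  obtain ⟨m, hm, hmin⟩ := h.fwd.finite.exists_minimal h.nonempty
  have hmI := h.mem_Ico hm
  have hid : ∀ u, 0 ≤ u → u < m → T u = u := by
    intro u hu hum
    have := h.fwd.translate (x := 0) (u := u) (by simp) hu (by linarith [hmI.2])
      (fun a ha _ => by
        by_contra hcon
        linarith [hmin ha (by linarith)])
    simpa [h0] using this
  have hTy : T (S m) = m := h.inv.2 hmI
  have hy := h.bwd.mapsTo hmI
  have hyD : S m ∉ D := fun hyD => h.no_connection _ hyD 1 le_rfl (by simpa [hTy] using hm)
  have hy0 : S m ≠ 0 := fun hy0 => by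
    rw [hy0, h0] at hTy
    linarith [(h.subset hm).1]
  obtain ⟨ε, hε, hεy, hl⟩ := h.fwd.left (S m) ⟨lt_of_le_of_ne hy.1 hy0.symm, hy.2⟩ hyD
  rw [hTy] at hl
  obtain ⟨t, ht0, ht⟩ := exists_between (show 0 < min ε m from lt_min hε (h.subset hm).1)
  obtain ⟨ht1, ht2⟩ := lt_min_iff.1 ht
  have heq : T (S m - t) = T (m - t) := by
    rw [hl t ht0.le ht1, hid (m - t) (by linarith) (by linarith)]
  have := h.inv.1.injOn ⟨by linarith, by linarith [hy.2]⟩ ⟨by linarith, by linarith [hmI.2]⟩ heq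
  exact hyD (by rwa [show S m = m by linarith])

lemma inverse_zero_mem (h : IsKeanePair T S D) : S 0 ∈ D := by
  have h0 : (0 : ℝ) ∈ Ico (0 : ℝ) 1 := by simp
  have hT : T (S 0) = 0 := h.inv.2 h0
  have hS := h.bwd.mapsTo h0
  have hne : S 0 ≠ 0 := fun hz => h.zero_not_fixed (by rwa [hz] at hT)
  by_contra hD
  have := h.fwd.pos ⟨lt_of_le_of_ne hS.1 hne.symm, hS.2⟩ hD
  linarith

lemma iterate_ne_self (h : IsKeanePair T S D) {p : ℝ} (hp : p ∈ Ico (0 : ℝ) 1) {n : ℕ}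
    (hn : 1 ≤ n) : T^[n] p ≠ p := by
  intro hper
  obtain ⟨c, hc, hcper⟩ := h.fwd.exists_periodic_break hp hn hper
  have h0 : (0 : ℝ) ∈ Ico (0 : ℝ) 1 := by simp
  rcases hc with rfl | hc
  · have hd := h.inverse_zero_mem
    refine h.no_connection _ hd n hn ?_
    have : T^[n] (S 0) = S 0 := by
      apply h.inv.1.injOn (h.fwd.iterate_mem (h.mem_Ico hd) n) (h.mem_Ico hd)
      rw [← iterate_succ_apply' T, iterate_succ_apply, h.inv.2 h0, hcper]
    rwa [this]
  · exact h.no_connection c hc n hn (by rwa [hcper])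

lemma iterate_left_inverse (h : IsKeanePair T S D) {x : ℝ} (hx : x ∈ Ico (0 : ℝ) 1) (n : ℕ) :
    T^[n] (S^[n] x) = x := by
  induction n with
  | zero => rfl
  | succ n ih => rw [iterate_succ_apply, iterate_succ_apply', h.inv.2 (h.bwd.iterate_mem hx n), ih]

lemma iterate_inverse_ne_self (h : IsKeanePair T S D) {p : ℝ} (hp : p ∈ Ico (0 : ℝ) 1) {n : ℕ}
    (hn : 1 ≤ n) : S^[n] p ≠ p := fun hper =>
  h.iterate_ne_self hp hn (by have := h.iterate_left_inverse hp n; rwa [hper] at this)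

lemma eq_zero_of_mem_leftEnds (h : IsKeanePair T S D) (hUs : U ⊆ Ioo 0 1)
    (hT : ∀ z ∈ U, z ∉ D → T z ∈ U) (hS : ∀ z ∈ U, z ∉ T '' insert 0 D → S z ∈ U)
    {l : ℝ} (hl : l ∈ leftEnds U) : l = 0 := by
  have h0 : (0 : ℝ) ∈ Ico (0 : ℝ) 1 := by simp
  have hfwd : ∀ x ∈ leftEnds U, x ∉ insert 0 D → T x ∈ leftEnds U := by
    intro x hx hxD
    refine h.fwd.leftEnds_image hT hx fun hTx => hx.2.1 ?_
    have := hS _ hTx (by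
      rintro ⟨y, hy, hyx⟩
      have hyI : y ∈ Ico (0 : ℝ) 1 := by
        rcases hy with rfl | hy
        exacts [h0, h.mem_Ico hy]
      exact hxD (h.inv.1.injOn hyI hx.1 hyx ▸ hy))
    rwa [h.inv.1 hx.1] at this
  have hbwd : ∀ x ∈ leftEnds U, S x ∉ D → S x ∈ leftEnds U := by
    intro x hx hxD
    refine h.bwd.leftEnds_image hS hx fun hSx => hx.2.1 ?_
    have := hT _ hSx hxD
    rwa [h.inv.2 hx.1] at this
  obtain ⟨n, hn⟩ : ∃ n, T^[n] l ∈ insert 0 D := by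
    by_contra! hcon
    have hall : ∀ n, T^[n] l ∈ leftEnds U := by
      intro n
      induction n with
      | zero => exact hl
      | succ n ih => rw [iterate_succ_apply']; exact hfwd _ ih (hcon n)
    exact h.fwd.no_infinite_chain hUs hT hall (fun n => iterate_succ_apply' T n l)
      (injective_iterate_of_ne_self h.fwd.mapsTo
        (fun p hp n hn => h.iterate_ne_self hp hn) hl.1)
  obtain ⟨m, hm⟩ : ∃ m, S (S^[m] l) ∈ D := by
    by_contra! hcon
    have hall : ∀ n, S^[n] l ∈ leftEnds U := by
      intro n
      induction n with
      | zero => exact hl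
      | succ n ih => rw [iterate_succ_apply']; exact hbwd _ ih (hcon n)
    exact h.bwd.no_infinite_chain hUs hS hall (fun n => iterate_succ_apply' S n l)
      (injective_iterate_of_ne_self h.bwd.mapsTo
        (fun p hp n hn => h.iterate_inverse_ne_self hp hn) hl.1)
  rw [← iterate_succ_apply' S] at hm
  have hmn : T^[n + m + 1] (S^[m + 1] l) = T^[n] l := by
    rw [add_assoc, iterate_add_apply, h.iterate_left_inverse hl.1]
  rcases hn with hn | hn
  · have hSI := h.inverse_zero_mem
    have heq : T^[n + m] (S^[m + 1] l) = S 0 := by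
      apply h.inv.1.injOn (h.fwd.iterate_mem (h.mem_Ico hm) _) (h.mem_Ico hSI)
      rw [← iterate_succ_apply' T, h.inv.2 h0]
      exact hmn.trans hn
    rcases Nat.eq_zero_or_pos (n + m) with hz | hpos
    · obtain rfl : n = 0 := by omega
      exact hn
    · exact absurd (heq ▸ hSI) (h.no_connection _ hm _ hpos)
  · exact absurd (hmn ▸ hn) (h.no_connection _ hm _ (by omega))

/-- An open subset of `(0, 1)` invariant away from the breaks is trivial. -/
lemma eq_empty_or_eq_Ioo (h : IsKeanePair T S D) (hUo : IsOpen U) (hUs : U ⊆ Ioo 0 1)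
    (hT : ∀ z ∈ U, z ∉ D → T z ∈ U) (hS : ∀ z ∈ U, z ∉ T '' insert 0 D → S z ∈ U) :
    U = ∅ ∨ U = Ioo 0 1 := by
  have h0 : (0 : ℝ) ∈ Ico (0 : ℝ) 1 := by simp
  by_contra! hcon
  obtain ⟨⟨z, hz⟩, hne⟩ := hcon
  have hdown : ∀ z ∈ U, Ioo 0 z ⊆ U := by
    intro z hz
    have hz' := hUs hz
    have hcomp : IsCompact (Icc 0 z \ U) := isCompact_Icc.diff hUo
    have hmem := hcomp.sSup_mem ⟨0, ⟨le_rfl, hz'.1.le⟩, fun hh => lt_irrefl _ (hUs hh).1⟩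
    set l := sSup (Icc 0 z \ U) with hl
    have hlz : l < z := lt_of_le_of_ne hmem.1.2 fun he => hmem.2 (he ▸ hz)
    have hsub : Ioo l z ⊆ U := by
      intro y hy
      by_contra hyU
      exact absurd (le_csSup hcomp.bddAbove ⟨⟨hmem.1.1.trans hy.1.le, hy.2.le⟩, hyU⟩)
        (not_le.2 hy.1)
    have : l = 0 := h.eq_zero_of_mem_leftEnds hUs hT hS
      ⟨⟨hmem.1.1, hlz.trans hz'.2⟩, hmem.2, z - l, by linarith, by rwa [add_sub_cancel]⟩
    rwa [this] at hsub
  obtain ⟨w, hw, hwU⟩ : ∃ w ∈ Ioo (0 : ℝ) 1, w ∉ U := by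
    by_contra! hall
    exact hne (hUs.antisymm hall)
  have hzw : z < w := by
    by_contra hle
    rcases (not_lt.1 hle).eq_or_lt with he | hlt
    · exact hwU (he ▸ hz)
    · exact hwU (hdown z hz ⟨hw.1, hlt⟩)
  have hcomp : IsCompact (Icc z w \ U) := isCompact_Icc.diff hUo
  have hmem := hcomp.sInf_mem ⟨w, ⟨hzw.le, le_rfl⟩, hwU⟩
  set r := sInf (Icc z w \ U) with hr
  have hrI : r ∈ Ioo (0 : ℝ) 1 :=
    ⟨(hUs hz).1.trans_le hmem.1.1, hmem.1.2.trans_lt hw.2⟩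
  have hUr : U = Ioo 0 r := by
    ext y
    constructor
    · refine fun hy => ⟨(hUs hy).1, ?_⟩
      by_contra hle
      rcases (not_lt.1 hle).eq_or_lt with he | hlt
      · exact hmem.2 (he ▸ hy)
      · exact hmem.2 (hdown y hy ⟨hrI.1, hlt⟩)
    · rintro ⟨hy0, hyr⟩
      rcases lt_or_ge y z with hyz | hyz
      · exact hdown z hz ⟨hy0, hyz⟩
      · by_contra hyU
        exact absurd (csInf_le hcomp.bddBelow ⟨⟨hyz, hyr.le.trans hmem.1.2⟩, hyU⟩)
          (not_le.2 hyr)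
  have hrI' := Ioo_subset_Ico_self hrI
  have hTr : T r ≠ r := h.iterate_ne_self hrI' le_rfl
  have hSr : S r ≠ r := h.iterate_inverse_ne_self hrI' le_rfl
  by_cases hrE : r ∈ T '' insert 0 D
  · have hrD : r ∉ D := by
      obtain ⟨y, hy, hyr⟩ := hrE
      rcases hy with rfl | hy
      · intro hrD
        refine h.no_connection _ h.inverse_zero_mem 2 (by norm_num) ?_
        change T (T (S 0)) ∈ D
        rwa [h.inv.2 h0, hyr]
      · intro hrD
        exact h.no_connection y hy 1 le_rfl (by simpa [hyr] using hrD)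
    have hTU := h.fwd.image_mem_of_initial hT hrI hUr hrD hTr
    refine hmem.2 ?_
    have := hS _ hTU (by
      rintro ⟨y, hy, hyx⟩
      rcases hy with rfl | hy
      · exact hrI.1.ne (h.inv.1.injOn h0 hrI' hyx)
      · exact hrD (h.inv.1.injOn (h.mem_Ico hy) hrI' hyx ▸ hy))
    rwa [h.inv.1 hrI'] at this
  · have hSU := h.bwd.image_mem_of_initial hS hrI hUr hrE hSr
    refine hmem.2 ?_
    have := hT _ hSU fun hD => hrE ⟨S r, mem_insert_of_mem _ hD, h.inv.2 hrI'⟩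
    rwa [h.inv.2 hrI'] at this

end IsKeanePair

/-- The points of `(0, 1)` that are not accumulated by the forward orbit of `x`. -/
def nonLimitSet (T : ℝ → ℝ) (x : ℝ) : Set ℝ :=
  {y | y ∈ Ioo (0 : ℝ) 1 ∧ ∃ ε > 0, ∃ M : ℕ, ∀ n ≥ M, ε ≤ |T^[n] x - y|}

lemma isOpen_nonLimitSet (T : ℝ → ℝ) (x : ℝ) : IsOpen (nonLimitSet T x) := by
  rw [Metric.isOpen_iff]
  rintro y ⟨hy, ε, hε, M, hM⟩
  obtain ⟨δ, hδ, hsub⟩ := Metric.isOpen_iff.1 isOpen_Ioo y hy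
  refine ⟨min δ (ε / 2), by positivity, fun z hz => ?_⟩
  rw [Metric.mem_ball, lt_min_iff] at hz
  refine ⟨hsub hz.1, ε / 2, by positivity, M, fun n hn => ?_⟩
  have h1 := hM n hn
  have h2 := abs_sub_le (T^[n] x) z y
  rw [← Real.dist_eq z y] at h2
  linarith [hz.2]

lemma IsPiecewiseTranslation.translate_near {f : ℝ → ℝ} {A : Set ℝ}
    (hf : IsPiecewiseTranslation f A) {z : ℝ} (hz : z ∈ Ioo (0 : ℝ) 1) (hzA : z ∉ A) :
    ∃ ε > 0, ∀ w, |w - z| < ε → w ∈ Ico (0 : ℝ) 1 ∧ f w = f z + (w - z) := by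
  obtain ⟨ε, hε, hε1, h⟩ := hf.right z (Ioo_subset_Ico_self hz)
  obtain ⟨δ, hδ, hδz, h'⟩ := hf.left z hz hzA
  refine ⟨min ε δ, lt_min hε hδ, fun w hw => ?_⟩
  obtain ⟨hw1, hw2⟩ := lt_min_iff.1 hw
  rw [abs_lt] at hw1 hw2
  refine ⟨⟨by linarith, by linarith⟩, ?_⟩
  rcases le_total z w with hzw | hzw
  · have := h (w - z) (by linarith) (by linarith)
    rwa [add_sub_cancel] at this
  · have := h' (z - w) (by linarith) (by linarith)
    rw [sub_sub_cancel] at this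
    linarith

namespace IsKeanePair

variable {T S : ℝ → ℝ} {D : Set ℝ} {x : ℝ}

lemma image_mem_nonLimitSet (h : IsKeanePair T S D) (hx : x ∈ Ico (0 : ℝ) 1) {z : ℝ}
    (hz : z ∈ nonLimitSet T x) (hzD : z ∉ D) : T z ∈ nonLimitSet T x := by
  obtain ⟨hz, ε, hε, M, hM⟩ := hz
  obtain ⟨δ, hδ, hloc⟩ := h.fwd.translate_near hz hzD
  refine ⟨⟨h.fwd.pos hz hzD, (h.fwd.mapsTo (Ioo_subset_Ico_self hz)).2⟩, min ε δ,
    lt_min hε hδ, M + 1, fun n hn => ?_⟩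
  by_contra hlt
  obtain ⟨hlt1, hlt2⟩ := lt_min_iff.1 (not_le.1 hlt)
  obtain ⟨k, rfl⟩ : ∃ k, n = k + 1 := ⟨n - 1, by omega⟩
  have hw := hloc (z + (T^[k + 1] x - T z)) (by rwa [add_sub_cancel_left])
  rw [add_sub_cancel_left, add_sub_cancel, iterate_succ_apply'] at hw
  have heq := h.inv.1.injOn hw.1 (h.fwd.iterate_mem hx k) hw.2
  have := hM k (by omega)
  rw [← heq, add_sub_cancel_left, ← iterate_succ_apply' T] at this
  linarith

lemma inverse_mem_nonLimitSet (h : IsKeanePair T S D) {z : ℝ}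
    (hz : z ∈ nonLimitSet T x) (hzE : z ∉ T '' insert 0 D) : S z ∈ nonLimitSet T x := by
  obtain ⟨hz, ε, hε, M, hM⟩ := hz
  have hz' := Ioo_subset_Ico_self hz
  have hSz : S z ∈ Ioo (0 : ℝ) 1 := ⟨h.bwd.pos hz hzE, (h.bwd.mapsTo hz').2⟩
  obtain ⟨δ, hδ, hloc⟩ := h.fwd.translate_near hSz
    fun hD => hzE ⟨S z, mem_insert_of_mem _ hD, h.inv.2 hz'⟩
  rw [h.inv.2 hz'] at hloc
  refine ⟨hSz, min ε δ, lt_min hε hδ, M, fun n hn => ?_⟩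
  by_contra hlt
  obtain ⟨hlt1, hlt2⟩ := lt_min_iff.1 (not_le.1 hlt)
  have := hM (n + 1) (by omega)
  rw [iterate_succ_apply', (hloc _ hlt2).2, add_sub_cancel_left] at this
  linarith

lemma nonLimitSet_ne_Ioo (h : IsKeanePair T S D) (hx : x ∈ Ico (0 : ℝ) 1) :
    nonLimitSet T x ≠ Ioo 0 1 := by
  intro hU
  have h0 : (0 : ℝ) ∈ Ico (0 : ℝ) 1 := by simp
  have hfar : ∀ y ∈ Ioo (0 : ℝ) 1, ∃ ε > 0, ∃ M : ℕ, ∀ n ≥ M, ε ≤ |T^[n] x - y| :=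
    fun y hy => (hU.symm ▸ hy : y ∈ nonLimitSet T x).2
  obtain ⟨c, hc, φ, hφ, hlim⟩ := isCompact_Icc.tendsto_subseq
    (fun n => Ico_subset_Icc_self (h.fwd.iterate_mem hx n))
  have hnear : ∀ ε > 0, ∀ M : ℕ, ∃ n ≥ M, |T^[n] x - c| < ε := by
    intro ε hε M
    obtain ⟨K, hK⟩ := Metric.tendsto_atTop.1 hlim ε hε
    exact ⟨φ (max K M), (le_max_right K M).trans (hφ.id_le _), hK _ (le_max_left K M)⟩
  rcases hc.1.eq_or_lt with rfl | hc0
  · have hT0 := h.fwd.mapsTo h0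
    obtain ⟨ε, hε, M, hM⟩ := hfar (T 0) ⟨lt_of_le_of_ne hT0.1 h.zero_not_fixed.symm, hT0.2⟩
    obtain ⟨δ, hδ, -, hloc⟩ := h.fwd.right 0 h0
    obtain ⟨n, hn, hlt⟩ := hnear (min ε δ) (lt_min hε hδ) M
    obtain ⟨hlt1, hlt2⟩ := lt_min_iff.1 hlt
    rw [sub_zero] at hlt1 hlt2
    have hT := hloc _ (h.fwd.iterate_mem hx n).1 (abs_lt.1 hlt2).2
    have := hM (n + 1) (by omega)
    rw [zero_add] at hT
    rw [iterate_succ_apply', hT, add_sub_cancel_left] at this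
    linarith
  rcases hc.2.lt_or_eq with hc1 | rfl
  · obtain ⟨ε, hε, M, hM⟩ := hfar c ⟨hc0, hc1⟩
    obtain ⟨n, hn, hlt⟩ := hnear ε hε M
    linarith [hM n hn]
  obtain ⟨δ, hδ, hδD⟩ := exists_ball_avoiding h.fwd.finite 1
  obtain ⟨b, hb, hb1⟩ := exists_between (show max 0 (1 - δ) < 1 from
    max_lt one_pos (by linarith))
  obtain ⟨hb0, hbδ⟩ := max_lt_iff.1 hb
  have hbI : b ∈ Ico (0 : ℝ) 1 := ⟨hb0.le, hb1⟩
  have hT : ∀ y, b ≤ y → y < 1 → T y = T b + (y - b) := by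
    intro y hby hy
    have := h.fwd.translate hbI (u := y - b) (by linarith) (by linarith) (fun a ha hlt => by
      have h1 := (h.subset ha).2
      have := hδD a ha h1.ne
      rw [abs_of_neg (by linarith)] at this
      linarith)
    rwa [add_sub_cancel] at this
  have hTb := h.fwd.mapsTo hbI
  have hne : T b ≠ b := h.iterate_ne_self hbI le_rfl
  have hlt : T b < b := by
    refine lt_of_le_of_ne (not_lt.1 fun hgt => ?_) hne
    have h1 := hT (b + 1 - T b) (by linarith [hTb.2]) (by linarith)
    have h2 := h.fwd.mapsTo (x := b + 1 - T b) ⟨by linarith [hTb.2], by linarith⟩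
    linarith [h2.2]
  obtain ⟨ε, hε, M, hM⟩ := hfar (T b + (1 - b)) ⟨by linarith [hTb.1], by linarith⟩
  obtain ⟨n, hn, hclose⟩ := hnear (min ε (1 - b)) (lt_min hε (by linarith)) M
  obtain ⟨hc1, hc2⟩ := lt_min_iff.1 hclose
  have h1 := hT _ (by linarith [(abs_lt.1 hc2).1]) (h.fwd.iterate_mem hx n).2
  have := hM (n + 1) (by omega)
  rw [iterate_succ_apply', h1,
    show T b + (T^[n] x - b) - (T b + (1 - b)) = T^[n] x - 1 by ring] at this
  linarith

lemma dense_fwdOrbit (h : IsKeanePair T S D) (hx : x ∈ Ico (0 : ℝ) 1) :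
    Ico (0 : ℝ) 1 ⊆ closure (fwdOrbit T x) := by
  have hempty : nonLimitSet T x = ∅ :=
    (h.eq_empty_or_eq_Ioo (isOpen_nonLimitSet T x) (fun _ hy => hy.1)
      (fun _ => h.image_mem_nonLimitSet hx) (fun _ => h.inverse_mem_nonLimitSet)).resolve_right
      (h.nonLimitSet_ne_Ioo hx)
  intro y hy
  rw [Metric.mem_closure_iff]
  intro ε hε
  by_contra! hcon
  obtain ⟨z, hyz, hz⟩ := exists_between (show y < min 1 (y + ε / 2) from
    lt_min hy.2 (by linarith))
  obtain ⟨hz1, hz2⟩ := lt_min_iff.1 hz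
  have : z ∈ nonLimitSet T x := by
    refine ⟨⟨hy.1.trans_lt hyz, hz1⟩, ε / 2, by positivity, 1, fun n hn => ?_⟩
    have h1 := hcon _ ⟨n, hn, rfl⟩
    rw [dist_comm, Real.dist_eq] at h1
    have h2 := abs_sub_le (T^[n] x) z y
    rw [abs_of_pos (show 0 < z - y by linarith)] at h2
    linarith
  rwa [hempty] at this

end IsKeanePair

lemma exists_partition_right {N : ℕ} {p : ℕ → ℝ} {x : ℝ} (h0 : p 0 ≤ x) (hN : x < p N) :
    ∃ i < N, x ∈ Ico (p i) (p (i + 1)) := by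
  induction N with
  | zero => linarith
  | succ n ih =>
    rcases lt_or_ge x (p n) with h | h
    · obtain ⟨i, hi, hx⟩ := ih h
      exact ⟨i, by omega, hx⟩
    · exact ⟨n, by omega, h, hN⟩

lemma exists_partition_left {N : ℕ} {p : ℕ → ℝ} {x : ℝ} (h0 : p 0 < x) (hN : x ≤ p N) :
    ∃ i < N, x ∈ Ioc (p i) (p (i + 1)) := by
  induction N with
  | zero => linarith
  | succ n ih =>
    rcases le_or_gt x (p n) with h | h
    · obtain ⟨i, hi, hx⟩ := ih h
      exact ⟨i, by omega, hx⟩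
    · exact ⟨n, by omega, h, hN⟩

lemma IsIET.bijOn {T : ℝ → ℝ} (hT : IsIET T) : BijOn T (Ico 0 1) (Ico 0 1) := by
  obtain ⟨-, -, -, -, -, -, -, -, h⟩ := hT
  exact h

lemma IsIET.isPiecewiseTranslation {T : ℝ → ℝ} (hT : IsIET T) (hfin : (Discont T 0 1).Finite) :
    IsPiecewiseTranslation T (Discont T 0 1) := by
  obtain ⟨N, p, σ, -, hp0, hpN, hp, hσ, hbij⟩ := hT
  have hmono : ∀ i ≤ N, 0 ≤ p i := by
    intro i
    induction i with
    | zero => intro; rw [hp0]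
    | succ i ih => intro hi; linarith [ih (by omega), hp i (by omega)]
  have hmono' : ∀ k i, i + k = N → p i ≤ 1 := by
    intro k
    induction k with
    | zero => rintro i rfl; exact hpN.le
    | succ k ih => intro i hi; linarith [ih (i + 1) (by omega), hp i (by omega)]
  refine ⟨hfin, hbij.mapsTo, fun x hx => ?_, fun x hx hxD => ?_⟩
  · obtain ⟨i, hi, hxi⟩ := exists_partition_right (p := p) (N := N) (x := x)
      (by rw [hp0]; exact hx.1) (by rw [hpN]; exact hx.2)
    refine ⟨p (i + 1) - x, by linarith [hxi.2],
      by linarith [hmono' (N - (i + 1)) (i + 1) (by omega)], fun t h0 h1 => ?_⟩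
    rw [hσ i hi _ ⟨by linarith [hxi.1], by linarith⟩, hσ i hi x hxi]
    ring
  · obtain ⟨i, hi, hxi⟩ := exists_partition_left (p := p) (N := N) (x := x)
      (by rw [hp0]; exact hx.1) (by rw [hpN]; exact hx.2.le)
    have hcont : ContinuousWithinAt T (Ico 0 1) x := by
      by_contra hc
      exact hxD ⟨Ioo_subset_Ico_self hx, hc⟩
    have hpi := hmono i hi.le
    have hsub : Ioo (p i) x ⊆ Ico 0 1 := fun y hy =>
      ⟨by linarith [hy.1], by linarith [hy.2, hx.2]⟩
    have heq : EqOn T (fun y => y + σ i) (Ioo (p i) x) := fun y hy =>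
      hσ i hi y ⟨hy.1.le, hy.2.trans_le hxi.2⟩
    have : (nhdsWithin x (Ioo (p i) x)).NeBot := right_nhdsWithin_Ioo_neBot hxi.1
    have hTx : T x = x + σ i := tendsto_nhds_unique (hcont.mono hsub)
      (Filter.Tendsto.congr' (heq.eventuallyEq_nhdsWithin).symm
        ((continuous_add_const (σ i)).continuousWithinAt))
    refine ⟨x - p i, by linarith [hxi.1], by linarith, fun t h0 h1 => ?_⟩
    rcases h0.eq_or_lt with rfl | h0
    · simp
    · rw [hTx]
      have := heq (x := x - t) ⟨by linarith, by linarith⟩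
      simp only at this
      linarith

lemma IsPiecewiseTranslation.zero_notMem_discont {T : ℝ → ℝ} {A : Set ℝ}
    (hT : IsPiecewiseTranslation T A) : (0 : ℝ) ∉ Discont T 0 1 := by
  rintro ⟨h0, hc⟩
  apply hc
  obtain ⟨ε, hε, -, h⟩ := hT.right 0 h0
  refine ((continuous_const_add (T 0)).continuousWithinAt (s := Ico 0 1)
    (x := 0)).congr_of_eventuallyEq ?_ (by simp)
  filter_upwards [self_mem_nhdsWithin, mem_nhdsWithin_of_mem_nhds (Iio_mem_nhds hε)] with y hy hyε
  simpa using h y hy.1 hyε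

lemma finite_fwdOrbit {T : ℝ → ℝ} {x : ℝ} {n : ℕ} (hn : 1 ≤ n) (h : T^[n] x = x) :
    (fwdOrbit T x).Finite := by
  refine ((Finset.range n).finite_toSet.image fun k => T^[k] x).subset ?_
  rintro _ ⟨k, -, rfl⟩
  exact ⟨k % n, by simpa using Nat.mod_lt _ (by omega), IsPeriodicPt.iterate_mod_apply h k⟩

/-- Keane's condition, one-sided variant: if the discontinuities `d 0 < ⋯ < d (N-2)` of a
right-continuous IET `T` of `[0,1)` have pairwise disjoint, infinite forward orbits
`Ω_j = {T^n (d j) | n ≥ 1}`, then `T` is minimal: every forward orbit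
`{T^n x | n ≥ 1}` is dense in `[0,1)`. -/
theorem keane_condition_minimality (N : ℕ) (hN : 1 < N) (T : ℝ → ℝ) (hT : IsIET T)
    (d : Fin (N - 1) → ℝ) (hmono : StrictMono d)
    (hrange : Set.range d = Discont T 0 1)
    (hdisj : ∀ i j : Fin (N - 1), i ≠ j → Disjoint (fwdOrbit T (d i)) (fwdOrbit T (d j)))
    (hinf : ∀ j : Fin (N - 1), (fwdOrbit T (d j)).Infinite) :
    ∀ x ∈ Set.Ico (0 : ℝ) 1, Set.Ico (0 : ℝ) 1 ⊆ closure (fwdOrbit T x) := by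
  have hf := hT.isPiecewiseTranslation (hrange ▸ finite_range d)
  refine fun x hx => IsKeanePair.dense_fwdOrbit
    (S := invFunOn T (Ico 0 1)) (D := Discont T 0 1) ⟨hf, ?_, ?_, ?_, ?_, ?_⟩ hx
  · exact hf.inverse hT.bijOn.surjOn.mapsTo_invFunOn hT.bijOn.invOn_invFunOn
  · exact hT.bijOn.invOn_invFunOn
  · intro y hy
    exact ⟨lt_of_le_of_ne hy.1.1 fun h0 => hf.zero_notMem_discont (h0 ▸ hy), hy.1.2⟩
  · exact ⟨d ⟨0, by omega⟩, hrange ▸ mem_range_self _⟩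
  · rw [← hrange]
    rintro _ ⟨i, rfl⟩ n hn ⟨j, hj⟩
    have hij : i = j := by
      by_contra hne
      refine (hdisj i j hne).notMem_of_mem_left (a := T (d j)) ⟨n + 1, by omega, ?_⟩
        ⟨1, le_rfl, rfl⟩
      rw [iterate_succ_apply', hj]
    subst hij
    exact hinf i (finite_fwdOrbit hn hj.symm)
end

section
/- Let f(x,y) be a real-analytic function on a neighborhood of the origin in ℝ², let X(y) and Y(x) be real-analytic functions that are positive in a neighborhood of zero, and let n, m ≥ 0 be integers with n > 0. Let V ⊂ ℝ² be the domain given by 0 < x < X(y) and 0 < y < Y(x). Then there exist h₀ > 0, a positive integer q, an integer k₀, and real sequences (a_k)_{k≥k₀}, (b_k)_{k≥k₀} such that for every h ∈ (0, h₀) the series ∑_{k=k₀}^∞ (a_k + b_k ln h) h^{k/q} converges and equals I(h) = ∫∫_{V ∩ {x^n y^m < h}} f(x,y) dx dy. -/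
open Set Filter Topology MeasureTheory

/-- `I h` agrees, for all small `h > 0`, with `P t + Q t * log h`, where `t = h ^ (1 / q)` and
`P`, `Q` are analytic at the origin. -/
def IsLogPuiseux (I : ℝ → ℝ) : Prop :=
  ∃ q : ℕ, 0 < q ∧ ∃ P Q : ℝ → ℝ, AnalyticAt ℝ P 0 ∧ AnalyticAt ℝ Q 0 ∧
    ∀ᶠ h in 𝓝[>] (0 : ℝ), I h = P (h ^ (q : ℝ)⁻¹) + Q (h ^ (q : ℝ)⁻¹) * Real.log h

theorem tendsto_rpow_inv_nhdsGT_zero {q : ℕ} (hq : 0 < q) :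
    Tendsto (fun h : ℝ => h ^ (q : ℝ)⁻¹) (𝓝[>] 0) (𝓝 0) := by
  have hq' : (0 : ℝ) < (q : ℝ)⁻¹ := by positivity
  have := (Real.continuousAt_rpow_const 0 (q : ℝ)⁻¹ (Or.inr hq'.le)).tendsto
  rw [Real.zero_rpow hq'.ne'] at this
  exact this.mono_left nhdsWithin_le_nhds

namespace IsLogPuiseux

theorem congr {I J : ℝ → ℝ} (hI : IsLogPuiseux I) (hIJ : ∀ᶠ h in 𝓝[>] (0 : ℝ), J h = I h) :
    IsLogPuiseux J := by
  obtain ⟨q, hq, P, Q, hP, hQ, h⟩ := hI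
  refine ⟨q, hq, P, Q, hP, hQ, ?_⟩
  filter_upwards [h, hIJ] with x hx hx'
  rw [hx', hx]

theorem zero : IsLogPuiseux fun _ => 0 :=
  ⟨1, one_pos, 0, 0, analyticAt_const, analyticAt_const, by simp⟩

theorem neg {I : ℝ → ℝ} (hI : IsLogPuiseux I) : IsLogPuiseux fun h => -I h := by
  obtain ⟨q, hq, P, Q, hP, hQ, h⟩ := hI
  refine ⟨q, hq, -P, -Q, hP.neg, hQ.neg, ?_⟩
  filter_upwards [h] with x hx
  rw [hx, Pi.neg_apply, Pi.neg_apply]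
  ring

theorem rpow_inv_eq_pow {h : ℝ} (hh : 0 < h) {q r : ℕ} (hr : 0 < r) :
    h ^ (q : ℝ)⁻¹ = (h ^ ((q * r : ℕ) : ℝ)⁻¹) ^ r := by
  rw [← Real.rpow_mul_natCast hh.le]
  congr 1
  have : (r : ℝ) ≠ 0 := by positivity
  rcases eq_or_ne (q : ℝ) 0 with hq | hq
  · simp [hq]
  · push_cast
    field_simp

theorem add {I J : ℝ → ℝ} (hI : IsLogPuiseux I) (hJ : IsLogPuiseux J) :
    IsLogPuiseux fun h => I h + J h := by
  obtain ⟨q, hq, P, Q, hP, hQ, h⟩ := hI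
  obtain ⟨r, hr, P', Q', hP', hQ', h'⟩ := hJ
  have key : ∀ {F : ℝ → ℝ} {k : ℕ}, 0 < k → AnalyticAt ℝ F 0 →
      AnalyticAt ℝ (fun t => F (t ^ k)) 0 := by
    intro F k hk hF
    refine AnalyticAt.fun_comp (g := F) (f := fun t : ℝ => t ^ k) ?_ (by fun_prop)
    simpa [hk.ne'] using hF
  refine ⟨q * r, by positivity, fun t => P (t ^ r) + P' (t ^ q), fun t => Q (t ^ r) + Q' (t ^ q),
    (key hr hP).add (key hq hP'), (key hr hQ).add (key hq hQ'), ?_⟩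
  filter_upwards [h, h', self_mem_nhdsWithin] with x hx hx' (hx0 : 0 < x)
  rw [hx, hx', rpow_inv_eq_pow hx0 hr (q := q), rpow_inv_eq_pow hx0 hq (q := r), mul_comm r q]
  ring

theorem sub {I J : ℝ → ℝ} (hI : IsLogPuiseux I) (hJ : IsLogPuiseux J) :
    IsLogPuiseux fun h => I h - J h := by
  simpa only [sub_eq_add_neg] using hI.add hJ.neg

/-- Power series expansion of a function with a log-Puiseux expansion. -/
theorem exists_hasSum {I : ℝ → ℝ} (hI : IsLogPuiseux I) :
    ∃ h₀ > (0 : ℝ), ∃ q : ℕ, 0 < q ∧ ∃ (k₀ : ℤ) (A B : ℤ → ℝ),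
      ∀ h ∈ Set.Ioo (0 : ℝ) h₀,
        HasSum
          (fun k : ℕ =>
            (A (k₀ + k) + B (k₀ + k) * Real.log h) * h ^ (((k₀ + k : ℤ) : ℝ) / (q : ℝ)))
          (I h) := by
  obtain ⟨q, hq, P, Q, ⟨p, hp⟩, ⟨p', hp'⟩, h⟩ := hI
  have htend := tendsto_rpow_inv_nhdsGT_zero hq
  have hP := htend.eventually (hasFPowerSeriesAt_iff.1 hp)
  have hQ := htend.eventually (hasFPowerSeriesAt_iff.1 hp')
  obtain ⟨h₀, hh₀, H⟩ := mem_nhdsGT_iff_exists_Ioo_subset.1 (h.and (hP.and hQ))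
  refine ⟨h₀, hh₀, q, hq, 0, fun k => p.coeff k.toNat, fun k => p'.coeff k.toNat, ?_⟩
  intro x hx
  obtain ⟨h1, h2, h3⟩ := H hx
  rw [h1]
  convert! h2.add (h3.mul_right (Real.log x)) using 1
  · ext k
    have : x ^ (((0 + k : ℤ) : ℝ) / (q : ℝ)) = (x ^ (q : ℝ)⁻¹) ^ k := by
      rw [← Real.rpow_mul_natCast hx.1.le]
      congr 1
      push_cast
      ring
    rw [this]
    simp only [zero_add, Int.toNat_natCast, smul_eq_mul]
    ring
  · simp

end IsLogPuiseux

/-- A family of monomials that is absolutely summable at `r > 0` has an analytic sum. -/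
theorem analyticAt_tsum_monomials {ι : Type*} (α : ι → ℝ) (e : ι → ℕ) {r : ℝ} (hr : 0 < r)
    (hs : Summable fun i => |α i| * r ^ e i) :
    AnalyticAt ℝ (fun t => ∑' i, α i * t ^ e i) 0 := by
  let c : ℕ → ℝ := fun k => ∑' i : e ⁻¹' {k}, α i
  refine ⟨FormalMultilinearSeries.ofScalars ℝ c, hasFPowerSeriesAt_iff.2 ?_⟩
  filter_upwards [Metric.ball_mem_nhds (0 : ℝ) hr] with t ht
  have ht' : |t| < r := by simpa using ht
  have hst : Summable fun i => α i * t ^ e i := by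
    refine Summable.of_norm_bounded hs fun i => ?_
    rw [Real.norm_eq_abs, abs_mul, abs_pow]
    gcongr
  have := hst.hasSum.tsum_fiberwise e
  simp only [FormalMultilinearSeries.coeff_ofScalars, zero_add, smul_eq_mul]
  convert! this using 2 with k
  rw [mul_comm, ← tsum_mul_right]
  refine tsum_congr fun i => ?_
  rw [i.2]

/-- Absolutely convergent expansion in two variables of a function analytic at `(e, 0)`. -/
theorem AnalyticAt.exists_double_series {G : ℝ × ℝ → ℝ} {e : ℝ} (hG : AnalyticAt ℝ G (e, 0)) :
    ∃ (ι : Type) (_ : Countable ι) (d : ι → ℝ) (i j : ι → ℕ) (r : ℝ), 0 < r ∧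
      (Summable fun k => |d k| * r ^ i k * r ^ j k) ∧
      ∀ x y : ℝ, |x - e| ≤ r → |y| ≤ r →
        HasSum (fun k => d k * (x - e) ^ i k * y ^ j k) (G (x, y)) := by
  classical
  obtain ⟨p, R, hp⟩ := hG
  obtain ⟨ρ, hρ0, hρ⟩ := ENNReal.lt_iff_exists_nnreal_btwn.1 hp.r_pos
  have hρ0' : (0 : ℝ) < ρ := by exact_mod_cast hρ0
  let u : ℝ × ℝ := (1, 0)
  let v : ℝ × ℝ := (0, 1)
  let d : (Σ n : ℕ, Finset (Fin n)) → ℝ := fun k => p k.1 (k.2.piecewise (fun _ => u) fun _ => v)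
  have hd : ∀ k, |d k| ≤ ‖p k.1‖ := by
    intro k
    refine ((p k.1).le_opNorm _).trans ?_
    refine mul_le_of_le_one_right (norm_nonneg _) (Finset.prod_le_one (fun _ _ => norm_nonneg _) ?_)
    intro l _
    by_cases hl : l ∈ k.2 <;> simp [hl, u, v, Prod.norm_def]
  have hcard : ∀ k : Σ n : ℕ, Finset (Fin n), k.2.card + (k.1 - k.2.card) = k.1 := by
    intro k
    have := Finset.card_le_univ k.2
    rw [Fintype.card_fin] at this
    omega
  have hsum : Summable fun k : Σ n : ℕ, Finset (Fin n) =>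
      |d k| * (ρ / 2 : ℝ) ^ k.2.card * (ρ / 2 : ℝ) ^ (k.1 - k.2.card) := by
    have h0 : Summable fun k : Σ n : ℕ, Finset (Fin n) => ‖p k.1‖ * (ρ / 2 : ℝ) ^ k.1 := by
      rw [summable_sigma_of_nonneg (fun _ => by positivity)]
      refine ⟨fun n => (hasSum_fintype _).summable, ?_⟩
      have := p.summable_norm_mul_pow (lt_of_lt_of_le hρ hp.r_le)
      refine this.congr fun n => ?_
      have hn : ∑ _s : Finset (Fin n), ‖p n‖ * (ρ / 2 : ℝ) ^ n = ‖p n‖ * ρ ^ n := by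
        simp only [Finset.sum_const, Finset.card_univ, Fintype.card_finset, Fintype.card_fin,
          nsmul_eq_mul, div_pow]
        push_cast
        field_simp
      rw [tsum_fintype, ← hn]
    refine Summable.of_nonneg_of_le (fun _ => by positivity) (fun k => ?_) h0
    rw [mul_assoc, ← pow_add, hcard]
    gcongr
    exact hd k
  refine ⟨_, inferInstance, d, fun k => k.2.card, fun k => k.1 - k.2.card, ρ / 2, by positivity,
    hsum, ?_⟩
  intro x y hx hy
  have habs : Summable fun k : Σ n : ℕ, Finset (Fin n) =>
      d k * (x - e) ^ k.2.card * y ^ (k.1 - k.2.card) := by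
    refine Summable.of_norm_bounded hsum fun i => ?_
    rw [Real.norm_eq_abs, abs_mul, abs_mul, abs_pow, abs_pow]
    gcongr
  have hz : ((x, y) : ℝ × ℝ) ∈ Metric.eball ((e, 0) : ℝ × ℝ) R := by
    refine Metric.eball_subset_eball hρ.le ?_
    rw [Metric.mem_eball, edist_dist, ENNReal.ofReal_lt_coe_iff (by positivity)]
    · simp only [Prod.dist_eq, Real.dist_eq, sub_zero]
      exact max_lt (by linarith) (by linarith)
  have h1 := hp.hasSum_sub hz
  have h2 : ∀ n, HasSum (fun s : Finset (Fin n) => d ⟨n, s⟩ * (x - e) ^ s.card *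
      y ^ (n - s.card)) (p n fun _ => (x, y) - (e, 0)) := by
    intro n
    have hxy : (fun _ : Fin n => ((x, y) : ℝ × ℝ) - (e, 0)) =
        (fun _ => (x - e) • u) + fun _ => y • v := by
      ext <;> simp [u, v]
    rw [hxy, ContinuousMultilinearMap.map_add_univ]
    convert! hasSum_fintype _ using 2 with s
    have : (s.piecewise (fun _ : Fin n => (x - e) • u) fun _ => y • v) =
        fun l => (s.piecewise (fun _ => x - e) (fun _ => y) l) •
          (s.piecewise (fun _ => u) (fun _ => v) l) := by
      ext l <;> by_cases hl : l ∈ s <;> simp [hl]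
    rw [this, ContinuousMultilinearMap.map_smul_univ, Finset.prod_piecewise]
    simp only [Finset.univ_inter, Finset.prod_const, smul_eq_mul, ← Finset.compl_eq_univ_sdiff,
      Finset.card_compl, Fintype.card_fin, d]
    ring
  have h3 := habs.hasSum.sigma h2
  rw [h1.unique h3]
  exact habs.hasSum

/-- The open sublevel set of the monomial `x ^ n * y ^ m` at height `h`. -/
def monomialSublevel (n m : ℕ) (h : ℝ) : Set (ℝ × ℝ) := {p | p.1 ^ n * p.2 ^ m < h}

theorem measurableSet_monomialSublevel (n m : ℕ) (h : ℝ) :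
    MeasurableSet (monomialSublevel n m h) :=
  (isOpen_lt (by fun_prop) continuous_const).measurableSet

/-- The integral of an absolutely convergent double series over a subset of its domain of
convergence may be computed termwise. -/
theorem hasSum_setIntegral_double_series {ι : Type} [Countable ι] {d : ι → ℝ} {i j : ι → ℕ}
    {r e : ℝ} (hr : 0 < r) {G : ℝ × ℝ → ℝ} (hd : Summable fun k => |d k| * r ^ i k * r ^ j k)
    (hG : ∀ x y : ℝ, |x - e| ≤ r → |y| ≤ r →
        HasSum (fun k => d k * (x - e) ^ i k * y ^ j k) (G (x, y)))
    {R : Set (ℝ × ℝ)} (hR : MeasurableSet R) (hRsub : R ⊆ Icc (e - r) (e + r) ×ˢ Icc 0 r) :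
    IntegrableOn G R ∧
      HasSum (fun k => d k * ∫ p in R, (p.1 - e) ^ i k * p.2 ^ j k) (∫ p in R, G p) := by
  have hK : IsCompact (Icc (e - r) (e + r) ×ˢ Icc (0 : ℝ) r) := isCompact_Icc.prod isCompact_Icc
  have hbox : ∀ p ∈ Icc (e - r) (e + r) ×ˢ Icc (0 : ℝ) r, |p.1 - e| ≤ r ∧ |p.2| ≤ r := by
    rintro p ⟨h1, h2⟩
    exact ⟨abs_le.2 ⟨by linarith [h1.1], by linarith [h1.2]⟩,
      abs_le.2 ⟨by linarith [h2.1], h2.2⟩⟩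
  have hbd : ∀ k, ∀ p ∈ Icc (e - r) (e + r) ×ˢ Icc (0 : ℝ) r,
      ‖d k * (p.1 - e) ^ i k * p.2 ^ j k‖ ≤ |d k| * r ^ i k * r ^ j k := by
    intro k p hp
    obtain ⟨h1, h2⟩ := hbox p hp
    rw [Real.norm_eq_abs, abs_mul, abs_mul, abs_pow, abs_pow]
    gcongr
  have hcont : ContinuousOn G (Icc (e - r) (e + r) ×ˢ Icc (0 : ℝ) r) := by
    refine (continuousOn_tsum (fun k => ?_) hd hbd).congr fun p hp =>
      (hG p.1 p.2 (hbox p hp).1 (hbox p hp).2).tsum_eq.symm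
    fun_prop
  have hint : IntegrableOn G R := (hcont.integrableOn_compact hK).mono_set hRsub
  refine ⟨hint, ?_⟩
  have hfin : volume R ≠ ⊤ := ((measure_mono hRsub).trans_lt hK.measure_lt_top).ne
  have hterm : ∀ k, IntegrableOn (fun p : ℝ × ℝ => d k * (p.1 - e) ^ i k * p.2 ^ j k) R := by
    intro k
    refine (ContinuousOn.integrableOn_compact hK ?_).mono_set hRsub
    fun_prop
  have := hasSum_integral_of_dominated_convergence (μ := volume.restrict R)
    (F := fun k p => d k * (p.1 - e) ^ i k * p.2 ^ j k) (f := G)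
    (fun k _ => |d k| * r ^ i k * r ^ j k) (fun k => (hterm k).aestronglyMeasurable)
    (fun k => (ae_restrict_mem hR).mono fun p hp => hbd k p (hRsub hp))
    (Eventually.of_forall fun _ => hd) (integrableOn_const hfin)
    ((ae_restrict_mem hR).mono fun p hp =>
      hG p.1 p.2 (hbox p (hRsub hp)).1 (hbox p (hRsub hp)).2)
  simpa only [mul_assoc, integral_const_mul] using this

/-- Fubini's theorem on the region below the graph of `u`. -/
theorem setIntegral_subgraph {T : Set ℝ} (hT : MeasurableSet T) {u : ℝ → ℝ} {R : Set (ℝ × ℝ)}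
    (hR : MeasurableSet R) (hRu : ∀ p, p ∈ R ↔ p.1 ∈ T ∧ p.2 ∈ Ioo 0 (u p.1)) {F : ℝ × ℝ → ℝ}
    (hF : IntegrableOn F R) :
    ∫ p in R, F p = ∫ x in T, ∫ y in Ioo 0 (u x), F (x, y) := by
  rw [← integral_indicator hR, Measure.volume_eq_prod, integral_prod, ← integral_indicator hT]
  · congr 1
    ext x
    by_cases hx : x ∈ T
    · rw [indicator_of_mem hx, ← integral_indicator measurableSet_Ioo]
      congr 1
      ext y
      by_cases hy : y ∈ Ioo 0 (u x)
      · rw [indicator_of_mem hy, indicator_of_mem ((hRu (x, y)).2 ⟨hx, hy⟩)]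
      · rw [indicator_of_notMem hy, indicator_of_notMem fun h => hy ((hRu (x, y)).1 h).2]
    · rw [indicator_of_notMem hx]
      have : ∀ y, R.indicator F (x, y) = 0 := fun y =>
        indicator_of_notMem (fun h => hx ((hRu (x, y)).1 h).1) _
      simp [this]
  · rw [← Measure.volume_eq_prod]
    exact hF.integrable_indicator hR

theorem pow_mul_rpow_neg_div_pow {n m : ℕ} (hm : 0 < m) {x : ℝ} (hx : 0 < x ∨ n = 0) :
    0 < x ^ (-(n : ℝ) / m) ∧ x ^ n * (x ^ (-(n : ℝ) / m)) ^ m = 1 := by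
  have hm' : (m : ℝ) ≠ 0 := by positivity
  rcases hx with hx | rfl
  · refine ⟨by positivity, ?_⟩
    rw [← Real.rpow_mul_natCast hx.le, div_mul_cancel₀ _ hm', Real.rpow_neg hx.le,
      Real.rpow_natCast]
    exact mul_inv_cancel₀ (by positivity)
  · simp

theorem pow_mul_pow_lt_iff {n m : ℕ} (hm : 0 < m) {x y h : ℝ} (hx : 0 < x ∨ n = 0) (hy : 0 < y)
    (hh : 0 < h) :
    x ^ n * y ^ m < h ↔ y < h ^ (m : ℝ)⁻¹ * x ^ (-(n : ℝ) / m) := by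
  obtain ⟨h1, h2⟩ := pow_mul_rpow_neg_div_pow hm hx
  have hxn : 0 < x ^ n := by
    rcases hx with hx | rfl
    · positivity
    · simp
  have hh' : (h ^ (m : ℝ)⁻¹) ^ m = h := Real.rpow_inv_natCast_pow hh.le hm.ne'
  have hmul : x ^ n * (h * (x ^ (-(n : ℝ) / m)) ^ m) = h := by
    rw [mul_left_comm, h2, mul_one]
  have key := mul_lt_mul_iff_right₀ hxn (b := y ^ m) (c := h * (x ^ (-(n : ℝ) / m)) ^ m)
  rw [hmul] at key
  rw [key, ← pow_lt_pow_iff_left₀ hy.le (by positivity) hm.ne', mul_pow, hh']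

/-- Integral of `F x * y ^ j` over the part of a strip where `x ^ n * y ^ m < h`. -/
theorem setIntegral_monomialSublevel {n m : ℕ} (hm : 0 < m) {T : Set ℝ} (hT : MeasurableSet T)
    {c d b h : ℝ} (hTsub : T ⊆ Icc c d) (hTpos : ∀ x ∈ T, 0 < x ∨ n = 0) (hb : 0 < b)
    (hh : 0 < h) {F : ℝ → ℝ} (hF : Continuous F) (j : ℕ) :
    ∫ p in T ×ˢ Ioo 0 b ∩ monomialSublevel n m h, F p.1 * p.2 ^ j =
      ∫ x in T, F x * (min b (h ^ (m : ℝ)⁻¹ * x ^ (-(n : ℝ) / m)) ^ (j + 1) / (j + 1)) := by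
  have hR : MeasurableSet (T ×ˢ Ioo 0 b ∩ monomialSublevel n m h) :=
    (hT.prod measurableSet_Ioo).inter (measurableSet_monomialSublevel n m h)
  have hRsub : T ×ˢ Ioo 0 b ∩ monomialSublevel n m h ⊆ Icc c d ×ˢ Icc 0 b :=
    inter_subset_left.trans (prod_mono hTsub Ioo_subset_Icc_self)
  rw [setIntegral_subgraph hT (u := fun x => min b (h ^ (m : ℝ)⁻¹ * x ^ (-(n : ℝ) / m))) hR]
  · refine setIntegral_congr_fun hT fun x hx => ?_
    have hpos : 0 ≤ min b (h ^ (m : ℝ)⁻¹ * x ^ (-(n : ℝ) / m)) := by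
      have := (pow_mul_rpow_neg_div_pow hm (hTpos x hx)).1
      positivity
    simp only
    rw [integral_const_mul, ← integral_Ioc_eq_integral_Ioo,
      ← intervalIntegral.integral_of_le hpos, integral_pow]
    simp
  · intro p
    simp only [monomialSublevel, mem_inter_iff, mem_prod, mem_Ioo, mem_ofPred_eq, lt_min_iff]
    constructor
    · rintro ⟨⟨h1, h2, h3⟩, h4⟩
      exact ⟨h1, h2, h3, (pow_mul_pow_lt_iff hm (hTpos _ h1) h2 hh).1 h4⟩
    · rintro ⟨h1, h2, h3, h4⟩
      exact ⟨⟨h1, h2, h3⟩, (pow_mul_pow_lt_iff hm (hTpos _ h1) h2 hh).2 h4⟩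
  · refine (ContinuousOn.integrableOn_compact (isCompact_Icc.prod isCompact_Icc)
      ?_).mono_set hRsub
    fun_prop

theorem summable_and_hasSum_monomials {ι : Type*} {α : ι → ℝ} {e : ι → ℕ} {s : ℝ} {u : ι → ℝ}
    (hs : 0 ≤ s) (hu : Summable u) {C : ℝ} (h : ∀ k, |α k| * s ^ e k ≤ C * u k) :
    (Summable fun k => |α k| * s ^ e k) ∧ ∀ t, 0 ≤ t → t ≤ s →
      HasSum (fun k => α k * t ^ e k) (∑' k, α k * t ^ e k) := by
  have h1 : Summable fun k => |α k| * s ^ e k :=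
    Summable.of_nonneg_of_le (fun _ => by positivity) h (hu.mul_left C)
  refine ⟨h1, fun t ht hts => (Summable.of_norm_bounded h1 fun k => ?_).hasSum⟩
  rw [Real.norm_eq_abs, abs_mul, abs_pow, abs_of_nonneg ht]
  gcongr

theorem isLogPuiseux_strip_local {n m : ℕ} (hm : 0 < m) {G : ℝ × ℝ → ℝ} {e : ℝ}
    (he : 0 < e ∨ n = 0) (hG : AnalyticAt ℝ G (e, 0)) :
    ∃ r > 0, ∀ T : Set ℝ, MeasurableSet T → T ⊆ Icc (e - r) (e + r) → ∀ b ∈ Ioc 0 r,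
      IntegrableOn G (T ×ˢ Ioo 0 b) ∧
      IsLogPuiseux fun h => ∫ p in T ×ˢ Ioo 0 b ∩ monomialSublevel n m h, G p := by
  obtain ⟨ι, _, d, i, j, r₀, hr₀, hd, hsum⟩ := hG.exists_double_series
  obtain ⟨r, hr, hrr, K, hK, hσ⟩ : ∃ r > 0, r ≤ r₀ ∧ ∃ K > 0, ∀ x ∈ Icc (e - r) (e + r),
      (0 < x ∨ n = 0) ∧ x ^ (-(n : ℝ) / m) ≤ K := by
    rcases he with he | rfl
    · refine ⟨min r₀ (e / 2), by positivity, min_le_left _ _, (e / 2) ^ (-(n : ℝ) / m),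
        by positivity, fun x hx => ?_⟩
      have h1 : e / 2 ≤ x := by linarith [hx.1, min_le_right r₀ (e / 2)]
      refine ⟨Or.inl (by linarith), ?_⟩
      apply Real.rpow_le_rpow_of_nonpos (by positivity) h1
      rw [neg_div]
      exact neg_nonpos.2 (by positivity)
    · exact ⟨r₀, hr₀, le_rfl, 1, one_pos, by simp⟩
  refine ⟨r, hr, fun T hT hTsub b hb => ?_⟩
  have hbox : Icc (e - r) (e + r) ×ˢ Icc 0 r ⊆ Icc (e - r₀) (e + r₀) ×ˢ Icc 0 r₀ :=
    prod_mono (Icc_subset_Icc (by linarith) (by linarith)) (Icc_subset_Icc le_rfl hrr)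
  have hstrip : T ×ˢ Ioo 0 b ⊆ Icc (e - r) (e + r) ×ˢ Icc 0 r :=
    prod_mono hTsub (Ioo_subset_Icc_self.trans (Icc_subset_Icc le_rfl hb.2))
  refine ⟨(hasSum_setIntegral_double_series hr₀ hd hsum (hT.prod measurableSet_Ioo)
    (hstrip.trans hbox)).1, ?_⟩
  let M : ι → ℝ := fun k =>
    ∫ x in T, (x - e) ^ i k * ((x ^ (-(n : ℝ) / m)) ^ (j k + 1) / ((j k : ℝ) + 1))
  have hvol : volume T < ⊤ := (measure_mono hTsub).trans_lt measure_Icc_lt_top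
  have hM : ∀ k, |M k| ≤ r₀ ^ i k * K ^ (j k + 1) * volume.real T := by
    intro k
    rw [← Real.norm_eq_abs]
    refine norm_setIntegral_le_of_norm_le_const hvol fun x hx => ?_
    obtain ⟨h1, h2⟩ := hσ x (hTsub hx)
    have h3 := (pow_mul_rpow_neg_div_pow hm h1).1
    rw [Real.norm_eq_abs, abs_mul, abs_pow, abs_div, abs_pow, abs_of_pos h3,
      abs_of_pos (by positivity : (0 : ℝ) < (j k : ℝ) + 1)]
    have h4 : |x - e| ≤ r₀ := by
      have := hTsub hx
      exact abs_le.2 ⟨by linarith [this.1], by linarith [this.2]⟩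
    have h5 : (x ^ (-(n : ℝ) / m)) ^ (j k + 1) / ((j k : ℝ) + 1) ≤ K ^ (j k + 1) := by
      refine (div_le_self (by positivity) (by linarith [Nat.cast_nonneg (α := ℝ) (j k)])).trans ?_
      gcongr
    gcongr
  obtain ⟨hα, hP⟩ := summable_and_hasSum_monomials (α := fun k => d k * M k)
    (e := fun k => j k + 1) (s := r₀ / K) (C := volume.real T * r₀) (by positivity) hd (by
      intro k
      calc |d k * M k| * (r₀ / K) ^ (j k + 1)
          ≤ |d k| * (r₀ ^ i k * K ^ (j k + 1) * volume.real T) * (r₀ / K) ^ (j k + 1) := by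
            rw [abs_mul]
            gcongr
            exact hM k
        _ = volume.real T * r₀ * (|d k| * r₀ ^ i k * r₀ ^ j k) := by
            rw [div_pow, pow_succ r₀]
            field_simp)
  refine ⟨m, hm, _, fun _ => 0, analyticAt_tsum_monomials _ _ (by positivity) hα,
    analyticAt_const, ?_⟩
  have hb0 : 0 < b := hb.1
  have ht0 := tendsto_rpow_inv_nhdsGT_zero hm
  filter_upwards [self_mem_nhdsWithin, ht0.eventually (Iio_mem_nhds (by positivity : 0 < b / K)),
    ht0.eventually (Iio_mem_nhds (by positivity : 0 < r₀ / K))] with h hh ht1 ht2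
  replace hh : 0 < h := hh
  have ht : 0 < h ^ (m : ℝ)⁻¹ := by positivity
  rw [zero_mul, add_zero]
  refine HasSum.unique ?_ (hP _ ht.le (le_of_lt ht2))
  convert! (hasSum_setIntegral_double_series hr₀ hd hsum ((hT.prod measurableSet_Ioo).inter
    (measurableSet_monomialSublevel n m h)) (inter_subset_left.trans (hstrip.trans hbox))).2
    using 2 with k
  rw [mul_assoc]
  congr 1
  rw [setIntegral_monomialSublevel hm hT hTsub (fun x hx => (hσ x (hTsub hx)).1) hb.1 hh
    (F := fun x => (x - e) ^ i k) (by fun_prop), ← integral_mul_const]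
  refine setIntegral_congr_fun hT fun x hx => ?_
  obtain ⟨h1, h2⟩ := hσ x (hTsub hx)
  have h3 : h ^ (m : ℝ)⁻¹ * x ^ (-(n : ℝ) / m) ≤ b :=
    calc _ ≤ b / K * K := mul_le_mul ht1.le h2 (pow_mul_rpow_neg_div_pow hm h1).1.le (by positivity)
      _ = b := div_mul_cancel₀ _ hK.ne'
  rw [min_eq_right h3, mul_pow]
  ring

/-- The part of a box away from the corner: `G` is analytic along a segment of the `x`-axis
avoiding `x = 0` (or `n = 0`). -/
theorem isLogPuiseux_strip {n m : ℕ} (hm : 0 < m) {G : ℝ × ℝ → ℝ} {c d : ℝ}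
    (hc : 0 < c ∨ n = 0) (hG : ∀ x ∈ Icc c d, AnalyticAt ℝ G (x, 0)) :
    ∃ r > 0, ∀ T : Set ℝ, MeasurableSet T → T ⊆ Icc c d → ∀ b ∈ Ioc 0 r,
      IntegrableOn G (T ×ˢ Ioo 0 b) ∧
      IsLogPuiseux fun h => ∫ p in T ×ˢ Ioo 0 b ∩ monomialSublevel n m h, G p := by
  let p : Set ℝ → Prop := fun s => ∃ s', s ⊆ s' ∧ MeasurableSet s' ∧ ∃ r > 0,
    ∀ T : Set ℝ, MeasurableSet T → T ⊆ s' → ∀ b ∈ Ioc 0 r, IntegrableOn G (T ×ˢ Ioo 0 b) ∧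
      IsLogPuiseux fun h => ∫ p in T ×ˢ Ioo 0 b ∩ monomialSublevel n m h, G p
  have hp : p (Icc c d) := by
    refine isCompact_Icc.induction_on ?_ ?_ ?_ ?_
    · refine ⟨∅, subset_rfl, MeasurableSet.empty, 1, one_pos, fun T _ hTs b _ => ?_⟩
      rw [subset_empty_iff.1 hTs]
      simpa using IsLogPuiseux.zero
    · rintro s t hst ⟨s', hs', h⟩
      exact ⟨s', hst.trans hs', h⟩
    · rintro s t ⟨s', hs', hms, r, hr, H⟩ ⟨t', ht', hmt, r', hr', H'⟩
      refine ⟨s' ∪ t', union_subset_union hs' ht', hms.union hmt, min r r', lt_min hr hr', ?_⟩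
      intro T hT hTs b hb
      obtain ⟨h1, h2⟩ := H (T ∩ s') (hT.inter hms) inter_subset_right b
        ⟨hb.1, hb.2.trans (min_le_left _ _)⟩
      obtain ⟨h3, h4⟩ := H' (T \ s') (hT.diff hms)
        (fun x hx => (hTs hx.1).resolve_left hx.2) b ⟨hb.1, hb.2.trans (min_le_right _ _)⟩
      have hint : IntegrableOn G (T ×ˢ Ioo 0 b) := by
        rw [← inter_union_sdiff T s', union_prod]
        exact h1.union h3
      refine ⟨hint, (h2.add h4).congr (Eventually.of_forall fun h => ?_)⟩
      rw [← integral_inter_add_sdiff (hms.prod MeasurableSet.univ)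
        (hint.mono_set inter_subset_left)]
      congr 3
      · ext x
        simp only [mem_inter_iff, mem_prod, mem_univ]
        tauto
      · ext x
        simp only [mem_inter_iff, mem_prod, mem_univ, Set.mem_sdiff]
        tauto
    · intro x hx
      obtain ⟨r, hr, H⟩ := isLogPuiseux_strip_local hm
        (hc.imp_left fun h => h.trans_le hx.1) (hG x hx)
      exact ⟨Icc (x - r) (x + r), mem_nhdsWithin_of_mem_nhds (Icc_mem_nhds (by linarith)
        (by linarith)), Icc (x - r) (x + r), subset_rfl, measurableSet_Icc, r, hr, H⟩
  obtain ⟨s', hs', -, r, hr, H⟩ := hp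
  exact ⟨r, hr, fun T hT hTs => H T hT (hTs.trans hs')⟩

theorem integral_rpow_sub_one {c a : ℝ} (hc : 0 < c) (ha : 0 < a) (E : ℝ) :
    ∫ x in c..a, x ^ (E - 1) =
      E⁻¹ * (a ^ E - c ^ E) + (if E = 0 then 1 else 0) * (Real.log a - Real.log c) := by
  split_ifs with hE
  · subst hE
    have : ∀ x : ℝ, x ^ ((0 : ℝ) - 1) = x⁻¹ := fun x => by rw [zero_sub, Real.rpow_neg_one]
    simp only [this, integral_inv_of_pos hc ha, Real.log_div ha.ne' hc.ne']
    simp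
  · rw [integral_rpow (Or.inr ⟨by simpa using hE, notMem_uIcc_of_lt hc ha⟩)]
    rw [sub_add_cancel]
    ring

theorem rpow_eq_pow_mul_pow {x : ℝ} (hx : 0 < x) (n m i j : ℕ) :
    x ^ ((i : ℝ) - n / m * j) = x ^ i * (x ^ (-(n : ℝ) / m)) ^ j := by
  rw [← Real.rpow_mul_natCast hx.le, ← Real.rpow_natCast, ← Real.rpow_add hx]
  congr 1
  ring

/-- The exponent produced by integrating `x ^ i * (x ^ (-n / m)) ^ (j + 1)`. -/
noncomputable def cornerExponent (n m i j : ℕ) : ℝ := ((i + 1 : ℕ) : ℝ) - n / m * ((j + 1 : ℕ) : ℝ)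

theorem abs_inv_cornerExponent_le {n m : ℕ} (hm : 0 < m) (i j : ℕ) :
    |(cornerExponent n m i j)⁻¹| ≤ m := by
  have hm' : (0 : ℝ) < m := by positivity
  have h1 : cornerExponent n m i j = (((m * (i + 1) - n * (j + 1) : ℤ)) : ℝ) / m := by
    rw [cornerExponent]
    push_cast
    field_simp
  rw [h1, inv_div, abs_div, abs_of_pos hm']
  rcases eq_or_ne (m * (i + 1) - n * (j + 1) : ℤ) 0 with h | h
  · rw [h]
    simp
  · refine div_le_self hm'.le ?_
    rw [← Int.cast_abs]
    exact_mod_cast Int.one_le_abs h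

theorem pow_mul_cutoff {n m : ℕ} (hn : 0 < n) (hm : 0 < m) {b s : ℝ} (hb : 0 < b) (hs : 0 < s) :
    s ^ n * (b ^ (-(m : ℝ) / n) * s ^ m) ^ (-(n : ℝ) / m) = b := by
  obtain ⟨h1, h2⟩ := pow_mul_rpow_neg_div_pow (n := m) hn (Or.inl hb)
  obtain ⟨h3, h4⟩ := pow_mul_rpow_neg_div_pow (n := n) hm (x := b ^ (-(m : ℝ) / n) * s ^ m)
    (Or.inl (by positivity))
  refine (pow_left_inj₀ (by positivity) hb.le hm.ne').1 ?_
  set σ := (b ^ (-(m : ℝ) / n) * s ^ m) ^ (-(n : ℝ) / m)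
  set ρ := b ^ (-(m : ℝ) / n)
  calc (s ^ n * σ) ^ m = (b ^ m * ρ ^ n) * (s ^ n * σ) ^ m := by rw [h2, one_mul]
    _ = b ^ m * ((ρ * s ^ m) ^ n * σ ^ m) := by ring
    _ = b ^ m := by rw [h4, mul_one]

theorem integral_corner_monomial {n m : ℕ} (hn : 0 < n) (hm : 0 < m) {a b s c : ℝ}
    (hb : 0 < b) (hs : 0 < s) (hcdef : c = b ^ (-(m : ℝ) / n) * s ^ m) (hca : c ≤ a) (i j : ℕ) :
    ∫ x in Ioo 0 a, x ^ i * (min b (s ^ n * x ^ (-(n : ℝ) / m)) ^ (j + 1) / (j + 1)) =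
      (j + 1 : ℝ)⁻¹ * (b ^ (j + 1) * c ^ (i + 1) * ((i + 1 : ℝ)⁻¹ - (cornerExponent n m i j)⁻¹) +
        (s ^ n) ^ (j + 1) * ((cornerExponent n m i j)⁻¹ *
            (a ^ (i + 1) * (a ^ (-(n : ℝ) / m)) ^ (j + 1)) +
          (if cornerExponent n m i j = 0 then 1 else 0) * (Real.log a - Real.log c))) := by
  have hc : 0 < c := by rw [hcdef]; positivity
  have ha : 0 < a := hc.trans_le hca
  have hsc : s ^ n * c ^ (-(n : ℝ) / m) = b := by rw [hcdef]; exact pow_mul_cutoff hn hm hb hs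
  have hexp : -(n : ℝ) / m ≤ 0 := by
    rw [neg_div]
    exact neg_nonpos.2 (by positivity)
  set f : ℝ → ℝ := fun x => x ^ i * (min b (s ^ n * x ^ (-(n : ℝ) / m)) ^ (j + 1) / (j + 1))
    with hf
  set E := cornerExponent n m i j with hE
  have hE1 : E - 1 = (i : ℝ) - n / m * ((j + 1 : ℕ) : ℝ) := by
    rw [hE, cornerExponent]
    push_cast
    ring
  have h1 : EqOn f (fun x => b ^ (j + 1) / (j + 1) * x ^ i) (Ioc 0 c) := by
    intro x hx
    have : b ≤ s ^ n * x ^ (-(n : ℝ) / m) := by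
      rw [← hsc]
      gcongr ?_ * ?_
      exact Real.rpow_le_rpow_of_nonpos hx.1 hx.2 hexp
    simp only [hf, min_eq_left this]
    ring
  have h2 : EqOn f (fun x => (s ^ n) ^ (j + 1) / (j + 1) * x ^ (E - 1)) (Ioc c a) := by
    intro x hx
    have : s ^ n * x ^ (-(n : ℝ) / m) ≤ b := by
      rw [← hsc]
      gcongr ?_ * ?_
      exact Real.rpow_le_rpow_of_nonpos hc hx.1.le hexp
    simp only [hf, min_eq_right this, hE1, rpow_eq_pow_mul_pow (hc.trans hx.1)]
    ring
  have hi1 : IntegrableOn f (Ioc 0 c) := by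
    rw [integrableOn_congr_fun h1 measurableSet_Ioc]
    exact (Continuous.integrableOn_Icc (by fun_prop)).mono_set Ioc_subset_Icc_self
  have hi2 : IntegrableOn f (Ioc c a) := by
    rw [integrableOn_congr_fun h2 measurableSet_Ioc]
    refine (ContinuousOn.integrableOn_Icc ?_).mono_set Ioc_subset_Icc_self
    refine ContinuousOn.mul continuousOn_const (ContinuousOn.rpow_const continuousOn_id ?_)
    exact fun x hx => Or.inl (hc.trans_le hx.1).ne'
  have hcE : (s ^ n) ^ (j + 1) * c ^ E = b ^ (j + 1) * c ^ (i + 1) := by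
    rw [hE, cornerExponent, rpow_eq_pow_mul_pow hc, mul_left_comm, ← mul_pow, hsc, mul_comm]
  rw [← integral_Ioc_eq_integral_Ioo, ← Ioc_union_Ioc_eq_Ioc hc.le hca,
    setIntegral_union (Ioc_disjoint_Ioc_of_le le_rfl) measurableSet_Ioc hi1 hi2,
    setIntegral_congr_fun measurableSet_Ioc h1, setIntegral_congr_fun measurableSet_Ioc h2,
    integral_const_mul, integral_const_mul, ← intervalIntegral.integral_of_le hc.le,
    ← intervalIntegral.integral_of_le hca, integral_pow, integral_rpow_sub_one hc ha,
    ← rpow_eq_pow_mul_pow ha, ← cornerExponent, ← hE]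
  linear_combination (-(j + 1 : ℝ)⁻¹ * E⁻¹) * hcE

theorem isLogPuiseux_corner {n m : ℕ} (hn : 0 < n) (hm : 0 < m) {G : ℝ × ℝ → ℝ}
    (hG : AnalyticAt ℝ G (0, 0)) :
    ∃ r > 0, ∀ a ∈ Ioc 0 r, ∀ b ∈ Ioc 0 r, IntegrableOn G (Ioo 0 a ×ˢ Ioo 0 b) ∧
      IsLogPuiseux fun h => ∫ p in Ioo 0 a ×ˢ Ioo 0 b ∩ monomialSublevel n m h, G p := by
  obtain ⟨ι, _, d, i, j, r, hr, hd, hsum⟩ := hG.exists_double_series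
  refine ⟨r, hr, fun a ha b hb => ?_⟩
  have ha0 : 0 < a := ha.1
  have hb0 : 0 < b := hb.1
  have hsub : Ioo 0 a ×ˢ Ioo 0 b ⊆ Icc (0 - r) (0 + r) ×ˢ Icc 0 r := by
    refine prod_mono (Ioo_subset_Icc_self.trans (Icc_subset_Icc (by linarith) ?_))
      (Ioo_subset_Icc_self.trans (Icc_subset_Icc le_rfl hb.2))
    simpa using ha.2
  refine ⟨(hasSum_setIntegral_double_series hr hd hsum (measurableSet_Ioo.prod measurableSet_Ioo)
    hsub).1, ?_⟩
  set ρ := b ^ (-(m : ℝ) / n) with hρ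
  have hρ0 : 0 < ρ := by positivity
  let s₀ : ℝ := (a / ρ) ^ (m : ℝ)⁻¹
  have hs₀ : 0 < s₀ := by positivity
  have hs₀a : ρ * s₀ ^ m = a := by
    rw [Real.rpow_inv_natCast_pow (by positivity) hm.ne']
    field_simp
  set σ := a ^ (-(n : ℝ) / m) with hσ
  have hσ0 : 0 < σ := by positivity
  have hs₀b : s₀ ^ n * σ = b := by
    rw [hσ, ← hs₀a]
    exact pow_mul_cutoff hn hm hb0 hs₀
  let E : ι → ℝ := fun k => cornerExponent n m (i k) (j k)
  let lam : ι → ℝ := fun k => if E k = 0 then 1 else 0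
  have hlam : ∀ k, lam k = lam k * (a ^ (i k + 1) * σ ^ (j k + 1)) := by
    intro k
    by_cases hk : E k = 0
    · rw [← rpow_eq_pow_mul_pow ha0, ← cornerExponent]
      simp only [E] at hk
      rw [hk, Real.rpow_zero, mul_one]
    · simp [lam, hk]
  have hlam1 : ∀ k, |lam k| ≤ 1 := by
    intro k
    by_cases hk : E k = 0 <;> simp [lam, hk]
  have hinv : ∀ k, |(j k + 1 : ℝ)⁻¹| ≤ 1 := by
    intro k
    rw [abs_of_pos (by positivity)]
    exact inv_le_one_of_one_le₀ (by linarith [Nat.cast_nonneg (α := ℝ) (j k)])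
  have hinv' : ∀ k, |(i k + 1 : ℝ)⁻¹| ≤ 1 := by
    intro k
    rw [abs_of_pos (by positivity)]
    exact inv_le_one_of_one_le₀ (by linarith [Nat.cast_nonneg (α := ℝ) (i k)])
  have hEk : ∀ k, |(E k)⁻¹| ≤ m := fun k => abs_inv_cornerExponent_le hm _ _
  have hmono : ∀ k, a ^ (i k + 1) * b ^ (j k + 1) ≤ r * r * (r ^ i k * r ^ j k) := by
    intro k
    calc _ ≤ r ^ (i k + 1) * r ^ (j k + 1) := by
          gcongr
          · exact ha.2
          · exact hb.2
      _ = _ := by ring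
  have hbound : ∀ k (w C : ℝ), 0 ≤ C → |w| ≤ C →
      |d k| * |(j k + 1 : ℝ)⁻¹| * |w| * (a ^ (i k + 1) * b ^ (j k + 1)) ≤
        C * (r * r) * (|d k| * r ^ i k * r ^ j k) := by
    intro k w C hC hw
    calc |d k| * |(j k + 1 : ℝ)⁻¹| * |w| * (a ^ (i k + 1) * b ^ (j k + 1))
        ≤ |d k| * 1 * C * (r * r * (r ^ i k * r ^ j k)) := by
          refine mul_le_mul ?_ (hmono k) (by positivity) (by positivity)
          gcongr
          exact hinv k
      _ = _ := by ring
  have hρs : ∀ k, ρ ^ (i k + 1) * s₀ ^ (m * (i k + 1)) = a ^ (i k + 1) := by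
    intro k
    rw [pow_mul, ← mul_pow, hs₀a]
  have hσs : ∀ k, σ ^ (j k + 1) * s₀ ^ (n * (j k + 1)) = b ^ (j k + 1) := by
    intro k
    rw [pow_mul, ← mul_pow, mul_comm, hs₀b]
  obtain ⟨hα₁, hP₁⟩ := summable_and_hasSum_monomials (s := s₀) (e := fun k => m * (i k + 1))
    (α := fun k => d k * (j k + 1 : ℝ)⁻¹ * ((i k + 1 : ℝ)⁻¹ - (E k)⁻¹) *
      (b ^ (j k + 1) * ρ ^ (i k + 1))) (C := (1 + m) * (r * r)) hs₀.le hd (by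
      intro k
      refine le_trans (le_of_eq ?_) (hbound k ((i k + 1 : ℝ)⁻¹ - (E k)⁻¹) (1 + m) (by positivity)
        ((abs_sub _ _).trans (add_le_add (hinv' k) (hEk k))))
      rw [abs_mul, abs_mul, abs_mul, abs_of_pos (by positivity : 0 < b ^ (j k + 1) * ρ ^ (i k + 1)),
        ← hρs k]
      ring)
  obtain ⟨hα₂, hP₂⟩ := summable_and_hasSum_monomials (s := s₀) (e := fun k => n * (j k + 1))
    (α := fun k => d k * (j k + 1 : ℝ)⁻¹ *
      ((E k)⁻¹ + lam k * (Real.log a - Real.log ρ)) * (a ^ (i k + 1) * σ ^ (j k + 1)))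
    (C := (m + 1 * |Real.log a - Real.log ρ|) * (r * r)) hs₀.le hd (by
      intro k
      refine le_trans (le_of_eq ?_) (hbound k ((E k)⁻¹ + lam k * (Real.log a - Real.log ρ))
        (m + 1 * |Real.log a - Real.log ρ|) (by positivity) ((abs_add_le _ _).trans ?_))
      · rw [abs_mul, abs_mul, abs_mul,
          abs_of_pos (by positivity : 0 < a ^ (i k + 1) * σ ^ (j k + 1)), ← hσs k]
        ring
      · rw [abs_mul]
        gcongr
        · exact hEk k
        · exact hlam1 k)
  obtain ⟨hα₃, hP₃⟩ := summable_and_hasSum_monomials (s := s₀) (e := fun k => n * (j k + 1))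
    (α := fun k => d k * (j k + 1 : ℝ)⁻¹ * (-lam k / n) * (a ^ (i k + 1) * σ ^ (j k + 1)))
    (C := 1 * (r * r)) hs₀.le hd (by
      intro k
      refine le_trans (le_of_eq ?_) (hbound k (-lam k / n) 1 zero_le_one ?_)
      · rw [abs_mul, abs_mul, abs_mul,
          abs_of_pos (by positivity : 0 < a ^ (i k + 1) * σ ^ (j k + 1)), ← hσs k]
        ring
      · rw [abs_div, abs_neg, Nat.abs_cast]
        exact (div_le_self (abs_nonneg _) (by exact_mod_cast hn)).trans (hlam1 k))
  refine ⟨n * m, by positivity, _, _, (analyticAt_tsum_monomials _ _ hs₀ hα₁).add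
    (analyticAt_tsum_monomials _ _ hs₀ hα₂), analyticAt_tsum_monomials _ _ hs₀ hα₃, ?_⟩
  filter_upwards [self_mem_nhdsWithin, (tendsto_rpow_inv_nhdsGT_zero
    (Nat.mul_pos hn hm)).eventually (Iio_mem_nhds hs₀)] with h hh hs
  replace hh : 0 < h := hh
  set s := h ^ ((n * m : ℕ) : ℝ)⁻¹ with hsdef
  have hs0 : 0 < s := by positivity
  have hss : s ≤ s₀ := le_of_lt hs
  have hsm : h ^ (m : ℝ)⁻¹ = s ^ n := by
    rw [IsLogPuiseux.rpow_inv_eq_pow hh hn, mul_comm m n]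
  have hlog : (m : ℝ) * Real.log s = Real.log h / n := by
    rw [hsdef, Real.log_rpow hh]
    push_cast
    field_simp
  refine HasSum.unique ?_ (((hP₁ s hs0.le hss).add (hP₂ s hs0.le hss)).add
    ((hP₃ s hs0.le hss).mul_right (Real.log h)))
  convert! (hasSum_setIntegral_double_series hr hd hsum
    ((measurableSet_Ioo.prod measurableSet_Ioo).inter (measurableSet_monomialSublevel n m h))
    (inter_subset_left.trans hsub)).2 using 2 with k
  have hca : ρ * s ^ m ≤ a := by
    rw [← hs₀a]
    gcongr
  rw [setIntegral_monomialSublevel hm measurableSet_Ioo Ioo_subset_Icc_self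
    (fun x hx => Or.inl hx.1) hb0 hh (F := fun x => (x - 0) ^ i k) (by fun_prop), hsm]
  simp only [sub_zero]
  rw [integral_corner_monomial hn hm hb0 hs0 rfl hca, Real.log_mul hρ0.ne' (by positivity),
    Real.log_pow, hlog, ← hσ]
  change _ = d k * ((j k + 1 : ℝ)⁻¹ * (b ^ (j k + 1) * (ρ * s ^ m) ^ (i k + 1) *
    ((i k + 1 : ℝ)⁻¹ - (E k)⁻¹) + (s ^ n) ^ (j k + 1) * ((E k)⁻¹ *
      (a ^ (i k + 1) * σ ^ (j k + 1)) + lam k * (Real.log a - (Real.log ρ + Real.log h / n)))))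
  rw [pow_mul, pow_mul, mul_pow]
  linear_combination (-(d k) * (j k + 1 : ℝ)⁻¹ * (s ^ n) ^ (j k + 1) *
    (Real.log a - (Real.log ρ + Real.log h / n))) * hlam k

theorem isLogPuiseux_box {n m : ℕ} (hm : 0 < m) {G : ℝ × ℝ → ℝ}
    (hG : ∀ x ∈ Icc (0 : ℝ) 1, AnalyticAt ℝ G (x, 0)) :
    ∃ r > 0, ∀ b ∈ Ioc 0 r,
      IsLogPuiseux fun h => ∫ p in Ioo 0 1 ×ˢ Ioo 0 b ∩ monomialSublevel n m h, G p := by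
  rcases n.eq_zero_or_pos with rfl | hn
  · obtain ⟨r, hr, H⟩ := isLogPuiseux_strip hm (Or.inr rfl) hG
    exact ⟨r, hr, fun b hb => (H _ measurableSet_Ioo Ioo_subset_Icc_self b hb).2⟩
  obtain ⟨r₁, hr₁, H₁⟩ := isLogPuiseux_corner hn hm (hG 0 (by simp))
  let a := min r₁ (1 / 2)
  have ha : 0 < a := by positivity
  have ha1 : a ≤ 1 / 2 := min_le_right _ _
  obtain ⟨r₂, hr₂, H₂⟩ := isLogPuiseux_strip (n := n) hm (c := a) (d := 1) (Or.inl ha)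
    fun x hx => hG x ⟨ha.le.trans hx.1, hx.2⟩
  refine ⟨min r₁ r₂, by positivity, fun b hb => ?_⟩
  obtain ⟨h1, h2⟩ := H₁ a ⟨ha, min_le_left _ _⟩ b ⟨hb.1, hb.2.trans (min_le_left _ _)⟩
  obtain ⟨h3, h4⟩ := H₂ (Ico a 1) measurableSet_Ico Ico_subset_Icc_self b
    ⟨hb.1, hb.2.trans (min_le_right _ _)⟩
  refine (h2.add h4).congr (Eventually.of_forall fun h => ?_)
  rw [← Ioo_union_Ico_eq_Ioo ha (by linarith : a ≤ 1), union_prod, union_inter_distrib_right,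
    setIntegral_union _ _ (h1.mono_set inter_subset_left) (h3.mono_set inter_subset_left)]
  · rw [Set.disjoint_left]
    rintro p ⟨⟨hp, -⟩, -⟩ ⟨⟨hp', -⟩, -⟩
    exact absurd hp.2 (not_lt.2 hp'.1)
  · exact (measurableSet_Ico.prod measurableSet_Ioo).inter (measurableSet_monomialSublevel n m h)

/-- An analytic reparametrization `ψ` of a half-neighborhood of `0` for which
`ψ v ^ m * X (ψ v) ^ n = v ^ m`. -/
theorem exists_analytic_reparametrization {X : ℝ → ℝ} (hX : AnalyticAt ℝ X 0) (hX0 : 0 < X 0)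
    (n : ℕ) {m : ℕ} (hm : 0 < m) :
    ∃ ψ : ℝ → ℝ, AnalyticAt ℝ ψ 0 ∧ ψ 0 = 0 ∧ 0 < deriv ψ 0 ∧
      ∀ᶠ v in 𝓝 0, ψ v ^ m * X (ψ v) ^ n = v ^ m := by
  let φ : ℝ → ℝ := fun y => y * Real.exp (Real.log (X y) * (n / m))
  have hE : AnalyticAt ℝ (fun y => Real.exp (Real.log (X y) * (n / m))) 0 :=
    ((hX.log hX0).mul analyticAt_const).rexp'
  have hφ : AnalyticAt ℝ φ 0 := analyticAt_id.mul hE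
  have hφ0 : φ 0 = 0 := by simp [φ]
  have hφ' : deriv φ 0 = Real.exp (Real.log (X 0) * (n / m)) := by
    have : HasDerivAt φ _ 0 := (hasDerivAt_id (0 : ℝ)).mul hE.differentiableAt.hasDerivAt
    simpa using this.deriv
  have hφ'' : deriv φ 0 ≠ 0 := by
    rw [hφ']
    positivity
  have hstrict : HasStrictDerivAt φ (deriv φ 0) 0 := hφ.hasStrictDerivAt
  have hψ := hφ.analyticAt_localInverse hφ''
  have hψ' := hstrict.to_localInverse hφ''
  have hright := (hstrict.hasStrictFDerivAt_equiv hφ'').eventually_right_inverse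
  have hψ0 := (hstrict.hasStrictFDerivAt_equiv hφ'').localInverse_apply_image
  set ψ : ℝ → ℝ := hstrict.localInverse φ (deriv φ 0) 0 hφ'' with hψdef
  rw [hφ0] at hψ hψ'
  have hright' : ∀ᶠ v in 𝓝 0, φ (ψ v) = v := by
    rw [hφ0] at hright
    exact hright
  have hψ0' : ψ 0 = 0 := by
    rw [hφ0] at hψ0
    exact hψ0
  refine ⟨ψ, hψ, hψ0', ?_, ?_⟩
  · rw [hψ'.hasDerivAt.deriv, hφ']
    positivity
  · have hpos : ∀ᶠ v in 𝓝 0, 0 < X (ψ v) := by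
      have : ContinuousAt (fun v => X (ψ v)) 0 := by
        refine ContinuousAt.comp' (g := X) ?_ hψ.continuousAt
        rw [hψ0']
        exact hX.continuousAt
      refine this.eventually (lt_mem_nhds ?_)
      simpa only [hψ0'] using hX0
    filter_upwards [hright', hpos] with v hv hXv
    have hXn : Real.exp (Real.log (X (ψ v)) * (n / m)) ^ m = X (ψ v) ^ n := by
      rw [← Real.exp_nat_mul, ← Real.exp_log (pow_pos hXv n), Real.log_pow]
      congr 1
      have : (m : ℝ) ≠ 0 := by positivity
      field_simp
    rw [← hXn, ← mul_pow]
    exact congrArg (· ^ m) hv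

/-- The map `(w, v) ↦ (w * ξ v, ψ v)` as a change of variables. -/
theorem setIntegral_image_shear {ξ ψ ξ' ψ' : ℝ → ℝ} {S : Set (ℝ × ℝ)} (hS : MeasurableSet S)
    (hξ : ∀ p ∈ S, HasDerivAt ξ (ξ' p.2) p.2) (hψ : ∀ p ∈ S, HasDerivAt ψ (ψ' p.2) p.2)
    (hξpos : ∀ p ∈ S, 0 < ξ p.2) (hψpos : ∀ p ∈ S, 0 < ψ' p.2)
    (hinj : InjOn ψ (Prod.snd '' S)) (f : ℝ × ℝ → ℝ) :
    ∫ p in (fun p : ℝ × ℝ => (p.1 * ξ p.2, ψ p.2)) '' S, f p =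
      ∫ p in S, ξ p.2 * ψ' p.2 * f (p.1 * ξ p.2, ψ p.2) := by
  let D : ℝ × ℝ → (ℝ × ℝ →L[ℝ] ℝ × ℝ) := fun p =>
    LinearMap.toContinuousLinearMap (Matrix.toLin (.finTwoProd ℝ) (.finTwoProd ℝ)
      !![ξ p.2, p.1 * ξ' p.2; 0, ψ' p.2])
  have hdet : ∀ p, (D p).det = ξ p.2 * ψ' p.2 := by
    intro p
    simp [D, LinearMap.det_toContinuousLinearMap, LinearMap.det_toLin, Matrix.det_fin_two_of]
  have hD : ∀ p ∈ S,
      HasFDerivWithinAt (fun p : ℝ × ℝ => (p.1 * ξ p.2, ψ p.2)) (D p) S p := by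
    intro p hp
    refine HasFDerivAt.hasFDerivWithinAt ?_
    simp only [D]
    rw [Matrix.toLin_finTwoProd_toContinuousLinearMap]
    convert! HasFDerivAt.prodMk (𝕜 := ℝ)
      (hasFDerivAt_fst.mul ((hξ p hp).comp_hasFDerivAt p hasFDerivAt_snd))
      ((hψ p hp).comp_hasFDerivAt p hasFDerivAt_snd) using 2 <;>
    simp [smul_smul, add_comm]
  have hinj' : InjOn (fun p : ℝ × ℝ => (p.1 * ξ p.2, ψ p.2)) S := by
    rintro p hp p' hp' h
    simp only [Prod.mk.injEq] at h
    have h2 : p.2 = p'.2 := hinj (mem_image_of_mem _ hp) (mem_image_of_mem _ hp') h.2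
    refine Prod.ext (mul_right_cancel₀ (hξpos p hp).ne' ?_) h2
    rw [h.1, h2]
  rw [integral_image_eq_integral_abs_det_fderiv_smul volume hS hD hinj']
  refine setIntegral_congr_fun hS fun p hp => ?_
  simp only [hdet, smul_eq_mul]
  rw [abs_of_pos (mul_pos (hξpos p hp) (hψpos p hp))]

theorem isLogPuiseux_subgraph {X : ℝ → ℝ} (hX : AnalyticAt ℝ X 0) (hX0 : 0 < X 0) (n : ℕ) {m : ℕ}
    (hm : 0 < m) {f : ℝ × ℝ → ℝ} (hf : ∀ x ∈ Icc 0 (X 0), AnalyticAt ℝ f (x, 0)) :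
    ∃ r > 0, ∀ b ∈ Ioc 0 r, IsLogPuiseux fun h =>
      ∫ p in {p : ℝ × ℝ | (0 < p.1 ∧ p.1 < X p.2) ∧ 0 < p.2 ∧ p.2 < b} ∩ monomialSublevel n m h,
        f p := by
  obtain ⟨ψ, hψ, hψ0, hψ', hψX⟩ := exists_analytic_reparametrization hX hX0 n hm
  let ξ : ℝ → ℝ := fun v => X (ψ v)
  have hξ : AnalyticAt ℝ ξ 0 := AnalyticAt.fun_comp (g := X) (by rwa [hψ0]) hψ
  have hξ0 : ξ 0 = X 0 := by simp only [ξ, hψ0]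
  let G : ℝ × ℝ → ℝ := fun p => ξ p.2 * deriv ψ p.2 * f (p.1 * ξ p.2, ψ p.2)
  have hG : ∀ x ∈ Icc (0 : ℝ) 1, AnalyticAt ℝ G (x, 0) := by
    intro x hx
    have h1 : AnalyticAt ℝ (fun p : ℝ × ℝ => ξ p.2) (x, 0) :=
      AnalyticAt.fun_comp (g := ξ) hξ analyticAt_snd
    have h2 : AnalyticAt ℝ (fun p : ℝ × ℝ => ψ p.2) (x, 0) :=
      AnalyticAt.fun_comp (g := ψ) hψ analyticAt_snd
    have h3 : AnalyticAt ℝ (fun p : ℝ × ℝ => deriv ψ p.2) (x, 0) :=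
      AnalyticAt.fun_comp (g := deriv ψ) hψ.deriv analyticAt_snd
    refine (h1.mul h3).mul (AnalyticAt.fun_comp (g := f) ?_ ((analyticAt_fst.mul h1).prod h2))
    simp only [hψ0, hξ0]
    exact hf _ ⟨mul_nonneg hx.1 hX0.le, mul_le_of_le_one_left hX0.le hx.2⟩
  obtain ⟨r, hr, H⟩ := isLogPuiseux_box (n := n) hm hG
  have hev := ((hψ.eventually_analyticAt.and hξ.eventually_analyticAt).and
    ((hξ.continuousAt.eventually (lt_mem_nhds (hξ0 ▸ hX0 : 0 < ξ 0))).and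
      (hψ.deriv.continuousAt.eventually (lt_mem_nhds hψ')))).and hψX
  obtain ⟨ε, hε, hball⟩ := Metric.eventually_nhds_iff.1 hev
  let v₁ := min r (ε / 2)
  have hv₁ : 0 < v₁ := by positivity
  have hgood : ∀ v ∈ Icc 0 v₁, ((AnalyticAt ℝ ψ v ∧ AnalyticAt ℝ ξ v) ∧
      (0 < ξ v ∧ 0 < deriv ψ v)) ∧ ψ v ^ m * X (ψ v) ^ n = v ^ m := by
    intro v hv
    apply hball
    rw [Real.dist_eq, sub_zero, abs_of_nonneg hv.1]
    linarith [hv.2, min_le_right r (ε / 2)]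
  have hcont : ContinuousOn ψ (Icc 0 v₁) := fun v hv =>
    (hgood v hv).1.1.1.continuousAt.continuousWithinAt
  have hmono : StrictMonoOn ψ (Icc 0 v₁) := by
    refine strictMonoOn_of_deriv_pos (convex_Icc _ _) hcont fun v hv => ?_
    exact (hgood v (interior_subset hv)).1.2.2
  have hmem0 : (0 : ℝ) ∈ Icc 0 v₁ := ⟨le_rfl, hv₁.le⟩
  have hmem1 : v₁ ∈ Icc 0 v₁ := ⟨hv₁.le, le_rfl⟩
  have hψv₁ : 0 < ψ v₁ := by
    have := hmono hmem0 hmem1 hv₁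
    rwa [hψ0] at this
  have hIVT : ∀ y ∈ Ioc 0 (ψ v₁), ∃ v ∈ Ioc 0 v₁, ψ v = y := by
    intro y hy
    obtain ⟨v, hv, rfl⟩ := intermediate_value_Icc hv₁.le hcont (by rw [hψ0]; exact ⟨hy.1.le, hy.2⟩)
    refine ⟨v, ⟨lt_of_le_of_ne hv.1 ?_, hv.2⟩, rfl⟩
    rintro rfl
    exact hy.1.ne' hψ0
  refine ⟨ψ v₁, hψv₁, fun b hb => ?_⟩
  obtain ⟨c, hc, rfl⟩ := hIVT b hb
  refine (H c ⟨hc.1, hc.2.trans (min_le_left _ _)⟩).congr (Eventually.of_forall fun h => ?_)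
  have hsub : ∀ p ∈ Ioo (0 : ℝ) 1 ×ˢ Ioo 0 c ∩ monomialSublevel n m h, p.2 ∈ Icc 0 v₁ :=
    fun p hp => ⟨hp.1.2.1.le, hp.1.2.2.le.trans hc.2⟩
  have hpow : ∀ w, ∀ v ∈ Icc 0 v₁, (w * ξ v) ^ n * ψ v ^ m = w ^ n * v ^ m := by
    intro w v hv
    rw [← (hgood v hv).2]
    ring
  rw [← setIntegral_image_shear (ξ := ξ) (ψ := ψ) (ξ' := deriv ξ) (ψ' := deriv ψ)]
  · congr 2
    ext ⟨x, y⟩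
    simp only [mem_inter_iff, mem_ofPred_eq, monomialSublevel, mem_image, mem_prod, mem_Ioo,
      Prod.mk.injEq, Prod.exists]
    constructor
    · rintro ⟨⟨⟨hx0, hxX⟩, hy0, hyb⟩, hh⟩
      obtain ⟨v, hv, rfl⟩ := hIVT y ⟨hy0, hyb.le.trans hb.2⟩
      have hv' : v ∈ Icc 0 v₁ := Ioc_subset_Icc_self hv
      have hξv := (hgood v hv').1.2.1
      have hvc : v < c := (hmono.lt_iff_lt hv' (Ioc_subset_Icc_self hc)).1 hyb
      have hxe : x / ξ v * ξ v = x := div_mul_cancel₀ _ hξv.ne'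
      refine ⟨x / ξ v, v, ⟨⟨⟨by positivity, (div_lt_one hξv).2 hxX⟩, hv.1, hvc⟩, ?_⟩, hxe, rfl⟩
      rwa [← hpow _ v hv', hxe]
    · rintro ⟨w, v, ⟨⟨⟨hw0, hw1⟩, hv0, hvc⟩, hh⟩, rfl, rfl⟩
      have hv' : v ∈ Icc 0 v₁ := ⟨hv0.le, hvc.le.trans hc.2⟩
      have hξv := (hgood v hv').1.2.1
      refine ⟨⟨⟨by positivity, mul_lt_of_lt_one_left hξv hw1⟩, ?_,
        hmono hv' (Ioc_subset_Icc_self hc) hvc⟩, ?_⟩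
      · have := hmono hmem0 hv' hv0
        rwa [hψ0] at this
      · rwa [hpow w v hv']
  · exact (measurableSet_Ioo.prod measurableSet_Ioo).inter (measurableSet_monomialSublevel n m h)
  · exact fun p hp => (hgood _ (hsub p hp)).1.1.2.differentiableAt.hasDerivAt
  · exact fun p hp => (hgood _ (hsub p hp)).1.1.1.differentiableAt.hasDerivAt
  · exact fun p hp => (hgood _ (hsub p hp)).1.2.1
  · exact fun p hp => (hgood _ (hsub p hp)).1.2.2
  · refine hmono.injOn.mono ?_
    rintro _ ⟨p, hp, rfl⟩
    exact hsub p hp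

theorem setIntegral_comp_swap (f : ℝ × ℝ → ℝ) (S : Set (ℝ × ℝ)) :
    ∫ p in Prod.swap ⁻¹' S, f p.swap = ∫ p in S, f p :=
  (Measure.measurePreserving_swap (μ := (volume : Measure ℝ))
    (ν := (volume : Measure ℝ))).setIntegral_preimage_emb
    MeasurableEquiv.prodComm.measurableEmbedding f S

theorem isLogPuiseux_subgraph_swap {Y : ℝ → ℝ} (hY : AnalyticAt ℝ Y 0) (hY0 : 0 < Y 0) {n : ℕ}
    (hn : 0 < n) (m : ℕ) {f : ℝ × ℝ → ℝ} (hf : ∀ y ∈ Icc 0 (Y 0), AnalyticAt ℝ f (0, y)) :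
    ∃ r > 0, ∀ a ∈ Ioc 0 r, IsLogPuiseux fun h =>
      ∫ p in {p : ℝ × ℝ | (0 < p.1 ∧ p.1 < a) ∧ 0 < p.2 ∧ p.2 < Y p.1} ∩ monomialSublevel n m h,
        f p := by
  obtain ⟨r, hr, H⟩ := isLogPuiseux_subgraph hY hY0 m hn (f := fun p => f p.swap) fun y hy =>
    AnalyticAt.fun_comp (g := f) (hf y hy) (analyticAt_snd.prod analyticAt_fst)
  refine ⟨r, hr, fun a ha => (H a ha).congr (Eventually.of_forall fun h => ?_)⟩
  rw [← setIntegral_comp_swap]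
  congr 2
  ext ⟨x, y⟩
  simp only [monomialSublevel, mem_inter_iff, mem_ofPred_eq, mem_preimage, Prod.swap_prod_mk,
    mul_comm]
  tauto

/-- Log-Puiseux expansion of integrals over sublevel sets of monomials:
if `X, Y` are real-analytic and positive near `0`, `V = {0 < x < X y, 0 < y < Y x}`
lies in the neighborhood where they are analytic, `f` is real-analytic in a
neighborhood of the closure of `V`, and `n > 0`, `m ≥ 0`, then there exist `h₀ > 0`,
a positive integer `q`, an integer `k₀`, and real coefficients `A k, B k` such that
for every `h ∈ (0, h₀)` the log-Puiseux series
`∑_{k ≥ k₀} (A k + B k · ln h) · h^{k/q}` converges to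
`I(h) = ∫∫_{V ∩ {xⁿ yᵐ < h}} f`. -/
theorem integral_is_log_puiseux (f : ℝ × ℝ → ℝ) (X Y : ℝ → ℝ) (n m : ℕ) (hn : 0 < n)
    (δ : ℝ) (hδ : 0 < δ)
    (hX : AnalyticOnNhd ℝ X (Set.Icc (-δ) δ))
    (hXpos : ∀ y ∈ Set.Icc (-δ) δ, 0 < X y)
    (hY : AnalyticOnNhd ℝ Y (Set.Icc (-δ) δ))
    (hYpos : ∀ x ∈ Set.Icc (-δ) δ, 0 < Y x)
    (V : Set (ℝ × ℝ))
    (hV : V = {p : ℝ × ℝ | 0 < p.1 ∧ p.1 < X p.2 ∧ 0 < p.2 ∧ p.2 < Y p.1})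
    (hVsub : V ⊆ Set.Ioo 0 δ ×ˢ Set.Ioo 0 δ)
    (hf : AnalyticOnNhd ℝ f (closure V)) :
    ∃ h₀ > (0 : ℝ), ∃ q : ℕ, 0 < q ∧ ∃ (k₀ : ℤ) (A B : ℤ → ℝ),
      ∀ h ∈ Set.Ioo (0 : ℝ) h₀,
        HasSum
          (fun k : ℕ =>
            (A (k₀ + k) + B (k₀ + k) * Real.log h) * h ^ (((k₀ + k : ℤ) : ℝ) / (q : ℝ)))
          (∫ p in V ∩ {p : ℝ × ℝ | p.1 ^ n * p.2 ^ m < h}, f p) := by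
  refine IsLogPuiseux.exists_hasSum (I := fun h => ∫ p in V ∩ monomialSublevel n m h, f p) ?_
  have hmemV : ∀ p : ℝ × ℝ, p ∈ V ↔ 0 < p.1 ∧ p.1 < X p.2 ∧ 0 < p.2 ∧ p.2 < Y p.1 := by
    intro p
    rw [hV, mem_ofPred_eq]
  have hmem0 : (0 : ℝ) ∈ Icc (-δ) δ := ⟨by linarith, hδ.le⟩
  have lower : ∀ {Z : ℝ → ℝ}, AnalyticOnNhd ℝ Z (Icc (-δ) δ) → (∀ y ∈ Icc (-δ) δ, 0 < Z y) →
      ∃ c > 0, c ≤ δ ∧ ∀ y ∈ Icc (-δ) δ, c ≤ Z y := by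
    intro Z hZ hZpos
    obtain ⟨y₀, hy₀, hmin⟩ := isCompact_Icc.exists_isMinOn ⟨0, hmem0⟩ hZ.continuousOn
    exact ⟨min δ (Z y₀), lt_min hδ (hZpos y₀ hy₀), min_le_left _ _,
      fun y hy => (min_le_right _ _).trans (hmin hy)⟩
  obtain ⟨c, hc, hcδ, hcX⟩ := lower hX hXpos
  obtain ⟨c', hc', hcδ', hcY⟩ := lower hY hYpos
  have hnearY : ∀ p : ℝ × ℝ, 0 < p.1 → p.1 < c → 0 < p.2 → p.2 < Y p.1 → p ∈ V := by
    rintro ⟨x, y⟩ hx hxc hy hyY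
    simp only at hx hxc hy hyY
    refine (hmemV _).2 ⟨hx, ?_, hy, hyY⟩
    refine hxc.trans_le (hcX y ⟨by linarith, ?_⟩)
    by_contra! hlt
    have hbad : (x, δ) ∈ V := (hmemV _).2
      ⟨hx, hxc.trans_le (hcX δ ⟨by linarith, le_rfl⟩), hδ, hlt.trans hyY⟩
    exact lt_irrefl _ (hVsub hbad).2.2
  have hnearX : ∀ p : ℝ × ℝ, 0 < p.2 → p.2 < c' → 0 < p.1 → p.1 < X p.2 → p ∈ V := by
    rintro ⟨x, y⟩ hy hyc hx hxX
    simp only at hx hyc hy hxX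
    refine (hmemV _).2 ⟨hx, hxX, hy, ?_⟩
    refine hyc.trans_le (hcY x ⟨by linarith, ?_⟩)
    by_contra! hlt
    have hbad : (δ, y) ∈ V := (hmemV _).2
      ⟨hδ, hlt.trans hxX, hy, hyc.trans_le (hcY δ ⟨by linarith, le_rfl⟩)⟩
    exact lt_irrefl _ (hVsub hbad).1.2
  have hclX : ∀ x ∈ Icc 0 (X 0), (x, (0 : ℝ)) ∈ closure V := by
    have h1 : ∀ x ∈ Ioo 0 (X 0), (x, (0 : ℝ)) ∈ closure V := by
      intro x hx
      have ht : Tendsto (fun y : ℝ => (x, y)) (𝓝[>] 0) (𝓝 (x, 0)) :=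
        (Continuous.tendsto (by fun_prop) 0).mono_left nhdsWithin_le_nhds
      refine mem_closure_of_tendsto ht ?_
      have h2 := ((hX 0 hmem0).continuousAt.eventually (lt_mem_nhds hx.2)).filter_mono
        (nhdsWithin_le_nhds (s := Ioi 0))
      filter_upwards [h2, self_mem_nhdsWithin, nhdsWithin_le_nhds (gt_mem_nhds hc')] with y h3 h4 h5
      exact hnearX (x, y) h4 h5 hx.1 h3
    have hcl : IsClosed {x : ℝ | (x, (0 : ℝ)) ∈ closure V} :=
      isClosed_closure.preimage (by fun_prop : Continuous fun x : ℝ => (x, (0 : ℝ)))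
    rw [← closure_Ioo (hXpos 0 hmem0).ne]
    exact fun x hx => closure_minimal h1 hcl hx
  have hclY : ∀ y ∈ Icc 0 (Y 0), ((0 : ℝ), y) ∈ closure V := by
    have h1 : ∀ y ∈ Ioo 0 (Y 0), ((0 : ℝ), y) ∈ closure V := by
      intro y hy
      have ht : Tendsto (fun x : ℝ => (x, y)) (𝓝[>] 0) (𝓝 (0, y)) :=
        (Continuous.tendsto (by fun_prop) 0).mono_left nhdsWithin_le_nhds
      refine mem_closure_of_tendsto ht ?_
      have h2 := ((hY 0 hmem0).continuousAt.eventually (lt_mem_nhds hy.2)).filter_mono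
        (nhdsWithin_le_nhds (s := Ioi 0))
      filter_upwards [h2, self_mem_nhdsWithin, nhdsWithin_le_nhds (gt_mem_nhds hc)] with x h3 h4 h5
      exact hnearY (x, y) h4 h5 hy.1 h3
    have hcl : IsClosed {y : ℝ | ((0 : ℝ), y) ∈ closure V} :=
      isClosed_closure.preimage (by fun_prop : Continuous fun y : ℝ => ((0 : ℝ), y))
    rw [← closure_Ioo (hYpos 0 hmem0).ne]
    exact fun y hy => closure_minimal h1 hcl hy
  obtain ⟨r₁, hr₁, H₁⟩ := isLogPuiseux_subgraph_swap (hY 0 hmem0) (hYpos 0 hmem0) hn m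
    fun y hy => hf _ (hclY y hy)
  have hleft : ∀ a ≤ c, ∀ h, V ∩ monomialSublevel n m h ∩ {p | p.1 < a} =
      {p : ℝ × ℝ | (0 < p.1 ∧ p.1 < a) ∧ 0 < p.2 ∧ p.2 < Y p.1} ∩ monomialSublevel n m h := by
    intro a ha h
    ext p
    simp only [mem_inter_iff, mem_ofPred_eq]
    constructor
    · rintro ⟨⟨hp, hh⟩, hpa⟩
      obtain ⟨h1, -, h3, h4⟩ := (hmemV p).1 hp
      exact ⟨⟨⟨h1, hpa⟩, h3, h4⟩, hh⟩
    · rintro ⟨⟨⟨h1, h2⟩, h3, h4⟩, hh⟩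
      exact ⟨⟨hnearY p h1 (h2.trans_le ha) h3 h4, hh⟩, h2⟩
  rcases m.eq_zero_or_pos with rfl | hm
  · let a := min r₁ c
    have ha : 0 < a := by positivity
    refine (H₁ a ⟨ha, min_le_left _ _⟩).congr ?_
    filter_upwards [Ioo_mem_nhdsGT (by positivity : 0 < a ^ n)] with h hh
    have hsub : V ∩ monomialSublevel n 0 h ⊆ {p | p.1 < a} := by
      rintro p ⟨-, hp⟩
      simp only [monomialSublevel, mem_ofPred_eq, pow_zero, mul_one] at hp ⊢
      exact lt_of_pow_lt_pow_left₀ n ha.le (hp.trans hh.2)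
    rw [← hleft a (min_le_right _ _), inter_eq_left.2 hsub]
  obtain ⟨r₂, hr₂, H₂⟩ := isLogPuiseux_subgraph (hX 0 hmem0) (hXpos 0 hmem0) n hm
    fun x hx => hf _ (hclX x hx)
  obtain ⟨r₃, hr₃, H₃⟩ := isLogPuiseux_corner hn hm (hf _ (hclX 0 ⟨le_rfl, (hXpos 0 hmem0).le⟩))
  let a := min (min r₁ r₃) c
  let b := min (min r₂ r₃) c'
  have ha : 0 < a := by positivity
  have hb : 0 < b := by positivity
  have hac : a ≤ c := min_le_right _ _
  have hbc : b ≤ c' := min_le_right _ _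
  refine ((H₁ a ⟨ha, (min_le_left _ _).trans (min_le_left _ _)⟩).add
    ((H₂ b ⟨hb, (min_le_left _ _).trans (min_le_left _ _)⟩).sub
      (H₃ a ⟨ha, (min_le_left _ _).trans (min_le_right _ _)⟩
        b ⟨hb, (min_le_left _ _).trans (min_le_right _ _)⟩).2)).congr ?_
  have hint : IntegrableOn f V := by
    have hbdd : Bornology.IsBounded V :=
      ((Metric.isBounded_Ioo 0 δ).prod (Metric.isBounded_Ioo 0 δ)).subset hVsub
    exact (hf.continuousOn.integrableOn_compact hbdd.isCompact_closure).mono_set subset_closure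
  have hhalf : MeasurableSet {p : ℝ × ℝ | p.1 < a} :=
    (isOpen_lt continuous_fst continuous_const).measurableSet
  filter_upwards [Ioo_mem_nhdsGT (by positivity : 0 < a ^ n * b ^ m)] with h hh
  have hbottom : {p : ℝ × ℝ | (0 < p.1 ∧ p.1 < X p.2) ∧ 0 < p.2 ∧ p.2 < b} ⊆ V :=
    fun p hp => hnearX p hp.2.1 (hp.2.2.trans_le hbc) hp.1.1 hp.1.2
  rw [← integral_inter_add_sdiff hhalf (hint.mono_set inter_subset_left), hleft a hac,
    ← integral_inter_add_sdiff (s := {p : ℝ × ℝ | (0 < p.1 ∧ p.1 < X p.2) ∧ 0 < p.2 ∧ p.2 < b} ∩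
      monomialSublevel n m h) hhalf (hint.mono_set (inter_subset_left.trans hbottom))]
  have hcorner : {p : ℝ × ℝ | (0 < p.1 ∧ p.1 < X p.2) ∧ 0 < p.2 ∧ p.2 < b} ∩
      monomialSublevel n m h ∩ {p | p.1 < a} = Ioo 0 a ×ˢ Ioo 0 b ∩ monomialSublevel n m h := by
    ext p
    simp only [mem_inter_iff, mem_ofPred_eq, mem_prod, mem_Ioo]
    constructor
    · rintro ⟨⟨⟨⟨h1, -⟩, h3⟩, h4⟩, h5⟩
      exact ⟨⟨⟨h1, h5⟩, h3⟩, h4⟩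
    · rintro ⟨⟨⟨h1, h5⟩, h3⟩, h4⟩
      refine ⟨⟨⟨⟨h1, (h5.trans_le hac).trans_le (hcX _ ⟨by linarith, ?_⟩)⟩, h3⟩, h4⟩, h5⟩
      linarith
  have hrest : (V ∩ monomialSublevel n m h) \ {p | p.1 < a} =
      ({p : ℝ × ℝ | (0 < p.1 ∧ p.1 < X p.2) ∧ 0 < p.2 ∧ p.2 < b} ∩
        monomialSublevel n m h) \ {p | p.1 < a} := by
    ext p
    constructor
    · rintro ⟨⟨hp, hph⟩, hpa⟩
      obtain ⟨h1, h2, h3, h4⟩ := (hmemV p).1 hp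
      refine ⟨⟨⟨⟨h1, h2⟩, h3, ?_⟩, hph⟩, hpa⟩
      by_contra! hlt
      have hpa' : a ≤ p.1 := not_lt.1 hpa
      have : a ^ n * b ^ m ≤ p.1 ^ n * p.2 ^ m := by gcongr
      exact absurd (hh.2.trans_le this) (not_lt.2 (le_of_lt hph))
    · rintro ⟨⟨hp, hph⟩, hpa⟩
      exact ⟨⟨hbottom hp, hph⟩, hpa⟩
  rw [hcorner, hrest]
  ring
end

section
/- Let H : ℝ² → ℝ be real-analytic in a neighborhood of the origin, with H(0,0) = 0, ∇H(0,0) = 0, the origin an isolated critical point of H, and H not attaining a local maximum or minimum at the origin. Then for all sufficiently small ρ > 0 the zero level set {p ∈ B_ρ : H(p) = 0} (where B_ρ is the closed ball of radius ρ centered at the origin) is the union of the images of finitely many injective real-analytic curves γ_1, …, γ_N : [0,1] → ℝ², each with γ_i(0) = (0,0) and ‖γ_i(1)‖ = ρ and ‖γ_i(t)‖ < ρ for t < 1, with images pairwise disjoint except at the origin, and each γ_i meets the boundary circle ∂B_ρ transversally at γ_i(1) (i.e. ⟨γ_i′(1), γ_i(1)⟩ ≠ 0). -/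
/-- The closed Euclidean ball of radius `ρ` centered at the origin of `ℝ²`. -/
def euclBall (ρ : ℝ) : Set (ℝ × ℝ) := {p | p.1 ^ 2 + p.2 ^ 2 ≤ ρ ^ 2}

open Filter Topology

theorem ContinuousMultilinearMap.sum_update_eq_sub {n : ℕ}
    (M : ContinuousMultilinearMap ℝ (fun _ : Fin (n + 1) => ℝ × ℝ) ℝ) (y : ℝ × ℝ) :
    ∑ k : Fin (n + 1), y.2 * M (Function.update
        (fun j => if j < k then ((y.1, 0) : ℝ × ℝ) else y) k (0, 1)) =
      M (fun _ => y) - M (fun _ => (y.1, 0)) := by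
  set A : ℕ → ℝ := fun k => M (fun j => if (j : ℕ) < k then ((y.1, 0) : ℝ × ℝ) else y) with hA
  have h0 : M (fun _ => y) = A 0 := by simp [hA]
  have h1 : M (fun _ => (y.1, 0)) = A (n + 1) := by
    simp only [hA]
    congr 1
    funext j
    simp [j.2]
  rw [h0, h1, ← Finset.sum_range_sub', ← Fin.sum_univ_eq_sum_range]
  refine Finset.sum_congr rfl fun k _ => ?_
  set v : Fin (n + 1) → ℝ × ℝ := fun j => if j < k then ((y.1, 0) : ℝ × ℝ) else y with hv
  have e1 : A k = M (Function.update v k y) := by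
    simp only [hA]
    congr 1
    funext j
    by_cases hj : j = k
    · subst hj; simp
    · simp [hj, hv]
  have e2 : A (k + 1) = M (Function.update v k (y.1, 0)) := by
    simp only [hA]
    congr 1
    funext j
    by_cases hj : j = k
    · subst hj; simp
    · have : (j : ℕ) < k + 1 ↔ j < k := by
        rw [Fin.lt_def]
        have : (j : ℕ) ≠ k := fun h => hj (Fin.ext h)
        omega
      simp only [this]
      simp [hj, hv]
  rw [e1, e2, ← M.map_update_sub, ← smul_eq_mul, ← M.map_update_smul]
  congr 2
  ext <;> simp

/-- Division by the second variable: an analytic function `f` of two variables satisfies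
`f (x, y) = f (x, 0) + y * U (x, y)` near the origin for some analytic `U`. -/
theorem AnalyticAt.exists_eventually_eq_add_snd_mul {f : ℝ × ℝ → ℝ} (hf : AnalyticAt ℝ f 0) :
    ∃ U : ℝ × ℝ → ℝ, AnalyticAt ℝ U 0 ∧ ∀ᶠ v in 𝓝 (0 : ℝ × ℝ), f v = f (v.1, 0) + v.2 * U v := by
  obtain ⟨p, r, hp⟩ := hf
  set T : ℝ × ℝ →L[ℝ] ℝ × ℝ := (ContinuousLinearMap.fst ℝ ℝ ℝ).prod 0 with hT
  have hTn : ‖T‖ ≤ 1 := by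
    refine ContinuousLinearMap.opNorm_le_bound _ zero_le_one fun v => ?_
    simp [hT, Prod.norm_def]
  set q : FormalMultilinearSeries ℝ (ℝ × ℝ) ℝ := fun n =>
    ∑ k : Fin (n + 1), ((p (n + 1)).compContinuousLinearMap
      (fun j => if j < k then T else ContinuousLinearMap.id ℝ (ℝ × ℝ))).curryMid k (0, 1) with hq
  have hqn : ∀ n, ‖q n‖ ≤ (n + 1) * ‖p (n + 1)‖ := by
    intro n
    have : ∀ k ∈ (Finset.univ : Finset (Fin (n + 1))), ‖((p (n + 1)).compContinuousLinearMap
      (fun j => if j < k then T else ContinuousLinearMap.id ℝ (ℝ × ℝ))).curryMid k (0, 1)‖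
        ≤ ‖p (n + 1)‖ := by
      intro k _
      refine (ContinuousLinearMap.le_opNorm _ _).trans ?_
      rw [ContinuousMultilinearMap.norm_curryMid]
      have h1 : ‖((0, 1) : ℝ × ℝ)‖ = 1 := by simp [Prod.norm_def]
      rw [h1, mul_one]
      refine (ContinuousMultilinearMap.norm_compContinuousLinearMap_le _ _).trans ?_
      refine mul_le_of_le_one_right (norm_nonneg _)
        (Finset.prod_le_one (fun _ _ => norm_nonneg _) ?_)
      intro j _
      split_ifs
      · exact hTn
      · exact ContinuousLinearMap.norm_id_le
    refine (norm_sum_le_of_le _ this).trans ?_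
    simp
  have hqs : ∀ n (y : ℝ × ℝ), y.2 * q n (fun _ => y) =
      p (n + 1) (fun _ => y) - p (n + 1) (fun _ => T y) := by
    intro n y
    have := (p (n + 1)).sum_update_eq_sub y
    have hTy : T y = (y.1, 0) := rfl
    rw [hTy, ← this, ← Finset.mul_sum]
    congr 1
    simp only [hq, sum_apply, ContinuousMultilinearMap.curryMid_apply,
      ContinuousMultilinearMap.compContinuousLinearMap_apply]
    refine Finset.sum_congr rfl fun k _ => ?_
    congr 1
    funext j
    by_cases hj : j = k
    · subst hj; simp
    · obtain ⟨i, rfl⟩ := Fin.exists_succAbove_eq hj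
      simp only [Fin.insertNth_apply_succAbove, Function.update_of_ne hj]
      split_ifs <;> simp [hT]
  have hrad : 0 < q.radius := by
    obtain ⟨s, hs0, hs⟩ := ENNReal.lt_iff_exists_nnreal_btwn.1 (hp.r_pos.trans_le hp.r_le)
    have hs0' : 0 < s := by exact_mod_cast hs0
    obtain ⟨C, hC, hpC⟩ := p.norm_mul_pow_le_of_lt_radius hs
    refine lt_of_lt_of_le (b := ((s / 2 : NNReal) : ENNReal)) ?_
      (q.le_radius_of_bound (C / s) fun n => ?_)
    · exact_mod_cast (by positivity : 0 < s / 2)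
    · have h2 : ((n : ℝ) + 1) ≤ 2 ^ n := by exact_mod_cast Nat.lt_two_pow_self (n := n)
      have hsR : (0 : ℝ) < s := hs0'
      have h3 := hpC (n + 1)
      have h4 : ‖p (n + 1)‖ * (s : ℝ) ^ n ≤ C / s := by
        rw [le_div_iff₀ hsR, mul_assoc, ← pow_succ]; exact h3
      push_cast
      calc ‖q n‖ * ((s : ℝ) / 2) ^ n ≤ (n + 1) * ‖p (n + 1)‖ * ((s : ℝ) / 2) ^ n := by
            gcongr; exact hqn n
        _ = ((n + 1) / 2 ^ n) * (‖p (n + 1)‖ * (s : ℝ) ^ n) := by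
            rw [div_pow]; ring
        _ ≤ 1 * (‖p (n + 1)‖ * (s : ℝ) ^ n) := by
            gcongr
            rw [div_le_one (by positivity)]; exact h2
        _ ≤ C / s := by rw [one_mul]; exact h4
  have hU := q.hasFPowerSeriesOnBall hrad
  refine ⟨q.sum, hU.analyticAt, ?_⟩
  have hb1 := Metric.eball_mem_nhds (0 : ℝ × ℝ) hp.r_pos
  have hb2 := Metric.eball_mem_nhds (0 : ℝ × ℝ) hrad
  have hb3 : ∀ᶠ v in 𝓝 (0 : ℝ × ℝ), T v ∈ Metric.eball (0 : ℝ × ℝ) r := by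
    have : Tendsto T (𝓝 0) (𝓝 0) := by simpa using T.continuous.tendsto 0
    exact this hb1
  filter_upwards [hb1, hb2, hb3] with v h1 h2 h3
  have s1 := hp.hasSum h1
  have s3 := hp.hasSum h3
  have s2 := (hU.hasSum h2).mul_left v.2
  simp only [zero_add] at s1 s2 s3
  have s4 := (hasSum_nat_add_iff' 1).2 (s1.sub s3)
  simp only [hqs] at s2
  have := s2.unique s4
  have hz : p 0 (fun _ => v) = p 0 (fun _ => T v) := by
    congr 1; funext j; exact j.elim0
  simp only [Finset.range_one, Finset.sum_singleton, hz, sub_self, sub_zero] at this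
  have hTy : T v = (v.1, 0) := rfl
  rw [this, hTy]; ring

open scoped ContDiff in
/-- The analytic implicit function theorem for a real function of two real variables. -/
theorem AnalyticAt.exists_implicit_function {f : ℝ × ℝ → ℝ} (hf : AnalyticAt ℝ f 0)
    (h0 : f 0 = 0) (hd : deriv (fun y => f (0, y)) 0 ≠ 0) :
    ∃ τ : ℝ → ℝ, AnalyticAt ℝ τ 0 ∧ τ 0 = 0 ∧ ∀ᶠ x in 𝓝 (0 : ℝ), f (x, τ x) = 0 := by
  have cdf : ContDiffAt ℝ ω f (0, 0) := hf.contDiffAt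
  have pn : (ω : ℕ∞ω) ≠ 0 := by simp
  have hfd : HasDerivAt (fun y => f (0, y)) (fderiv ℝ f (0, 0) (0, 1)) 0 := by
    have h1 : HasFDerivAt f (fderiv ℝ f (0, 0)) (0, 0) := hf.differentiableAt.hasFDerivAt
    have h2 : HasDerivAt (fun y : ℝ => ((0 : ℝ), y)) (0, 1) 0 :=
      (hasDerivAt_const _ _).prodMk (hasDerivAt_id _)
    exact h1.comp_hasDerivAt (0 : ℝ) h2
  rw [hfd.deriv] at hd
  have if₂ : (fderiv ℝ f (0, 0) ∘L .inr ℝ ℝ ℝ).IsInvertible := by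
    refine ⟨ContinuousLinearEquiv.unitsEquivAut ℝ (Units.mk0 _ hd), ?_⟩
    ext
    simp
  refine ⟨cdf.implicitFunction pn if₂, ?_, cdf.implicitFunction_apply_self pn if₂, ?_⟩
  · exact (cdf.contDiffAt_implicitFunction pn if₂).analyticAt
  · have := cdf.eventually_apply_implicitFunction pn if₂
    simpa [h0, show f (0, 0) = 0 from h0] using this

theorem AnalyticAt.iteratedDeriv_snd {f : ℝ × ℝ → ℝ} (hf : AnalyticAt ℝ f 0) (k : ℕ) :
    AnalyticAt ℝ (fun p : ℝ × ℝ => iteratedDeriv k (fun y => f (p.1, y)) p.2) 0 := by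
  induction k with
  | zero => simpa using hf
  | succ k ih =>
    set g : ℝ × ℝ → ℝ := fun p => iteratedDeriv k (fun y => f (p.1, y)) p.2 with hg
    have h1 : AnalyticAt ℝ (fun p => fderiv ℝ g p (0, 1)) 0 :=
      (ContinuousLinearMap.apply ℝ ℝ ((0, 1) : ℝ × ℝ)).analyticAt _ |>.comp ih.fderiv
    refine h1.congr ?_
    filter_upwards [ih.eventually_analyticAt] with p hp
    have h2 : HasDerivAt (fun y : ℝ => (p.1, y)) (0, 1) p.2 :=
      (hasDerivAt_const _ _).prodMk (hasDerivAt_id _)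
    have h3 := (hp.differentiableAt.hasFDerivAt (x := (p.1, p.2))).comp_hasDerivAt p.2 h2
    rw [iteratedDeriv_succ]
    exact h3.deriv.symm

theorem AnalyticAt.exists_eventually_eq_sum_add_snd_pow_mul (d : ℕ) {f : ℝ × ℝ → ℝ}
    (hf : AnalyticAt ℝ f 0) :
    ∃ (a : ℕ → ℝ → ℝ) (U : ℝ × ℝ → ℝ), (∀ i, AnalyticAt ℝ (a i) 0) ∧ AnalyticAt ℝ U 0 ∧
      ∀ᶠ v in 𝓝 (0 : ℝ × ℝ),
        f v = ∑ i ∈ Finset.range d, a i v.1 * v.2 ^ i + v.2 ^ d * U v := by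
  induction d generalizing f with
  | zero => exact ⟨fun _ _ => 0, f, fun _ => analyticAt_const, hf, by simp⟩
  | succ d ih =>
    obtain ⟨V, hV, hfV⟩ := hf.exists_eventually_eq_add_snd_mul
    obtain ⟨a, U, ha, hU, hVU⟩ := ih hV
    refine ⟨fun i => Nat.casesOn i (fun x => f (x, 0)) a, U, fun i => ?_, hU, ?_⟩
    · cases i with
      | zero =>
        exact AnalyticAt.fun_comp (f := fun x : ℝ => (x, (0 : ℝ))) hf
          (analyticAt_id.prod analyticAt_const)
      | succ i => exact ha i
    · filter_upwards [hfV, hVU] with v h1 h2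
      rw [h1, h2, Finset.sum_range_succ']
      simp only [pow_zero, mul_one, mul_add, Finset.mul_sum, pow_succ]
      have : ∀ i, v.2 * (a i v.1 * v.2 ^ i) = a i v.1 * (v.2 ^ i * v.2) := fun i => by ring
      simp only [this]
      change _ = _ + f (v.1, 0) + _
      ring

theorem iteratedDeriv_eq_of_eventually_eq_sum {h u : ℝ → ℝ} {d : ℕ} {a : ℕ → ℝ}
    (hu : AnalyticAt ℝ u 0)
    (hh : ∀ᶠ y in 𝓝 (0 : ℝ), h y = ∑ i ∈ Finset.range d, a i * y ^ i + y ^ d * u y) :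
    (∀ k < d, iteratedDeriv k h 0 = k.factorial * a k) ∧
      iteratedDeriv d h 0 = d.factorial * u 0 := by
  have key : ∀ k, iteratedDeriv k h 0 =
      ∑ i ∈ Finset.range d, a i * (if k = i then (i.factorial : ℝ) else 0) +
      ∑ i ∈ Finset.range (k + 1), k.choose i * (if i = d then (d.factorial : ℝ) else 0) *
        iteratedDeriv (k - i) u 0 := by
    intro k
    have hh' : h =ᶠ[𝓝 0] (fun y => ∑ i ∈ Finset.range d, a i * y ^ i) + fun y => y ^ d * u y := hh
    rw [hh'.iteratedDeriv_eq, iteratedDeriv_add (by fun_prop)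
      (by have := hu.contDiffAt (n := (k : ℕ∞)); fun_prop),
      iteratedDeriv_fun_sum (fun i _ => by fun_prop),
      iteratedDeriv_fun_mul (by fun_prop) hu.contDiffAt]
    congr 1
    · refine Finset.sum_congr rfl fun i _ => ?_
      rw [iteratedDeriv_const_mul_field, iteratedDeriv_fun_pow_zero]
      split_ifs <;> simp
    · refine Finset.sum_congr rfl fun i _ => ?_
      rw [iteratedDeriv_fun_pow_zero]
      split_ifs <;> simp
  constructor
  · intro k hk
    rw [key k, Finset.sum_eq_single k, Finset.sum_eq_zero]
    · simp [mul_comm]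
    · intro i hi
      rw [if_neg (by have := Finset.mem_range.1 hi; omega)]; simp
    · intro i _ hi; rw [if_neg (Ne.symm hi)]; simp
    · intro h; exact absurd (Finset.mem_range.2 hk) h
  · rw [key d, Finset.sum_eq_zero, Finset.sum_eq_single d]
    · simp
    · intro i _ hi; rw [if_neg hi]; simp
    · simp
    · intro i hi
      rw [if_neg (by have := Finset.mem_range.1 hi; omega)]; simp

/-- The Tschirnhaus transformation: after an analytic shift of the second variable, the
coefficient of `y ^ (d - 1)` of a function of order `d` in `y` vanishes. -/
theorem AnalyticAt.exists_tschirnhaus {f : ℝ × ℝ → ℝ} (hf : AnalyticAt ℝ f 0) {d : ℕ}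
    {u : ℝ → ℝ} (hu : AnalyticAt ℝ u 0) (hu0 : u 0 ≠ 0)
    (hfu : ∀ᶠ y in 𝓝 (0 : ℝ), f (0, y) = y ^ (d + 1) * u y) :
    ∃ (τ : ℝ → ℝ) (a : ℕ → ℝ → ℝ) (U : ℝ × ℝ → ℝ), AnalyticAt ℝ τ 0 ∧ τ 0 = 0 ∧
      (∀ i, AnalyticAt ℝ (a i) 0) ∧ AnalyticAt ℝ U 0 ∧ U 0 ≠ 0 ∧ (∀ i ≤ d, a i 0 = 0) ∧
      (∀ᶠ x in 𝓝 (0 : ℝ), a d x = 0) ∧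
      ∀ᶠ v in 𝓝 (0 : ℝ × ℝ),
        f (v.1, τ v.1 + v.2) =
          ∑ i ∈ Finset.range (d + 1), a i v.1 * v.2 ^ i + v.2 ^ (d + 1) * U v := by
  have hord := iteratedDeriv_eq_of_eventually_eq_sum (h := fun y => f (0, y)) (d := d + 1)
    (a := fun _ => 0) hu (by simpa using hfu)
  obtain ⟨τ, hτ, hτ0, hτf⟩ := (hf.iteratedDeriv_snd d).exists_implicit_function
    (by simpa using hord.1 d (Nat.lt_succ_self d))
    (by
      have := hord.2
      rw [iteratedDeriv_succ] at this
      simp only [this]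
      exact mul_ne_zero (by positivity) hu0)
  have hshift : AnalyticAt ℝ (fun v : ℝ × ℝ => (v.1, τ v.1 + v.2)) 0 := by
    have h1 : AnalyticAt ℝ (fun v : ℝ × ℝ => τ v.1) 0 :=
      AnalyticAt.fun_comp (g := τ) (f := Prod.fst) hτ analyticAt_fst
    exact analyticAt_fst.prod (h1.add analyticAt_snd)
  have hg : AnalyticAt ℝ (fun v : ℝ × ℝ => f (v.1, τ v.1 + v.2)) 0 :=
    AnalyticAt.fun_comp (g := f) (by simpa [hτ0, ← Prod.zero_eq_mk] using hf) hshift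
  obtain ⟨a, U, ha, hU, haU⟩ := hg.exists_eventually_eq_sum_add_snd_pow_mul (d + 1)
  have hline : ∀ᶠ x in 𝓝 (0 : ℝ),
      (∀ k < d + 1, iteratedDeriv k (fun y => f (x, τ x + y)) 0 = k.factorial * a k x) ∧
      iteratedDeriv (d + 1) (fun y => f (x, τ x + y)) 0 = (d + 1).factorial * U (x, 0) := by
    have e1 : ∀ᶠ x in 𝓝 (0 : ℝ), AnalyticAt ℝ U (x, 0) :=
      (Continuous.tendsto' (by fun_prop) (0 : ℝ) (0 : ℝ × ℝ) rfl :
        Tendsto (fun x : ℝ => (x, (0 : ℝ))) _ _).eventually hU.eventually_analyticAt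
    filter_upwards [Filter.Eventually.curry_nhds (x := (0 : ℝ)) (y := (0 : ℝ)) haU, e1] with x h1 h2
    have hUx : AnalyticAt ℝ (fun y => U (x, y)) 0 :=
      AnalyticAt.fun_comp (f := fun y : ℝ => (x, y)) h2 (analyticAt_const.prod analyticAt_id)
    exact iteratedDeriv_eq_of_eventually_eq_sum (a := fun i => a i x) hUx h1
  have hline0 := hline.self_of_nhds
  simp only [hτ0, zero_add] at hline0
  refine ⟨τ, a, U, hτ, hτ0, ha, hU, ?_, ?_, ?_, haU⟩
  · intro h
    have h1 := hline0.2
    rw [hord.2, show U (0, 0) = 0 from h, mul_zero] at h1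
    exact mul_ne_zero (by positivity) hu0 h1
  · intro i hi
    have h1 := hline0.1 i (Nat.lt_succ_of_le hi)
    rw [hord.1 i (Nat.lt_succ_of_le hi), mul_zero] at h1
    exact (mul_eq_zero.1 h1.symm).resolve_left (by positivity)
  · filter_upwards [hline, hτf] with x h1 h2
    have h3 := h1.1 d (Nat.lt_succ_self d)
    rw [iteratedDeriv_comp_const_add d (fun y => f (x, y))] at h3
    simp only [add_zero] at h3
    rw [h2] at h3
    exact (mul_eq_zero.1 h3.symm).resolve_left (by positivity)

/-- The zeros of `F` in the strip `0 < x`, `y ∈ s` are, for small `x`, given by finitely many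
Puiseux parametrizations `x = t ^ q`, `y = φ t`. -/
def HasPuiseuxZeros (F : ℝ × ℝ → ℝ) (s : Set ℝ) : Prop :=
  ∃ (q : ℕ) (S : Set (ℝ → ℝ)), 0 < q ∧ S.Finite ∧
    (∀ φ ∈ S, AnalyticAt ℝ φ 0 ∧ ∀ᶠ t in 𝓝[>] (0 : ℝ), F (t ^ q, φ t) = 0) ∧
    ∀ᶠ t in 𝓝[>] (0 : ℝ), ∀ y ∈ s, F (t ^ q, y) = 0 → ∃ φ ∈ S, y = φ t

theorem tendsto_pow_nhdsGT_zero {q : ℕ} (hq : 0 < q) :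
    Tendsto (fun t : ℝ => t ^ q) (𝓝[>] 0) (𝓝[>] 0) := by
  refine tendsto_nhdsWithin_iff.2 ⟨?_, ?_⟩
  · refine tendsto_nhdsWithin_of_tendsto_nhds ?_
    exact Continuous.tendsto' (by fun_prop) _ _ (by simp [hq.ne'])
  · filter_upwards [self_mem_nhdsWithin] with t ht
    exact pow_pos (Set.mem_Ioi.1 ht) q

theorem AnalyticAt.comp_pow_zero {φ : ℝ → ℝ} (hφ : AnalyticAt ℝ φ 0) {q : ℕ} (hq : 0 < q) :
    AnalyticAt ℝ (fun t => φ (t ^ q)) 0 :=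
  AnalyticAt.fun_comp (g := φ) (f := fun t : ℝ => t ^ q) (by simpa [hq.ne'] using hφ)
    (analyticAt_id.pow q)

namespace HasPuiseuxZeros

variable {F G : ℝ × ℝ → ℝ} {s s' : Set ℝ}

theorem mono (h : HasPuiseuxZeros F s) (hs : s' ⊆ s) : HasPuiseuxZeros F s' := by
  obtain ⟨q, S, hq, hS, h1, h2⟩ := h
  exact ⟨q, S, hq, hS, h1, h2.mono fun t ht y hy => ht y (hs hy)⟩

theorem exists_pow_mul (h : HasPuiseuxZeros F s) :
    ∃ q : ℕ, 0 < q ∧ ∀ m : ℕ, 0 < m → ∃ S : Set (ℝ → ℝ), S.Finite ∧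
      (∀ φ ∈ S, AnalyticAt ℝ φ 0 ∧ ∀ᶠ t in 𝓝[>] (0 : ℝ), F (t ^ (m * q), φ t) = 0) ∧
      ∀ᶠ t in 𝓝[>] (0 : ℝ), ∀ y ∈ s, F (t ^ (m * q), y) = 0 → ∃ φ ∈ S, y = φ t := by
  obtain ⟨q, S, hq, hS, h1, h2⟩ := h
  refine ⟨q, hq, fun m hm => ⟨(fun φ t => φ (t ^ m)) '' S, hS.image _, ?_, ?_⟩⟩
  · rintro _ ⟨φ, hφ, rfl⟩
    refine ⟨(h1 φ hφ).1.comp_pow_zero hm, ?_⟩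
    filter_upwards [(tendsto_pow_nhdsGT_zero hm).eventually (h1 φ hφ).2] with t ht
    rwa [pow_mul]
  · filter_upwards [(tendsto_pow_nhdsGT_zero hm).eventually h2] with t ht y hy hFy
    rw [pow_mul] at hFy
    obtain ⟨φ, hφ, h⟩ := ht y hy hFy
    exact ⟨_, ⟨φ, hφ, rfl⟩, h⟩

theorem union (h : HasPuiseuxZeros F s) (h' : HasPuiseuxZeros F s') :
    HasPuiseuxZeros F (s ∪ s') := by
  obtain ⟨q, hq, h⟩ := h.exists_pow_mul
  obtain ⟨q', hq', h'⟩ := h'.exists_pow_mul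
  obtain ⟨S, hS, h1, h2⟩ := h q' hq'
  obtain ⟨S', hS', h1', h2'⟩ := h' q hq
  rw [mul_comm] at h1' h2'
  refine ⟨q' * q, S ∪ S', by positivity, hS.union hS', ?_, ?_⟩
  · rintro φ (hφ | hφ)
    · exact h1 φ hφ
    · exact h1' φ hφ
  · filter_upwards [h2, h2'] with t ht ht'
    rintro y (hy | hy) hF
    · obtain ⟨φ, hφ, h⟩ := ht y hy hF
      exact ⟨φ, Or.inl hφ, h⟩
    · obtain ⟨φ, hφ, h⟩ := ht' y hy hF
      exact ⟨φ, Or.inr hφ, h⟩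

theorem of_isCompact {K : Set ℝ} (hK : IsCompact K)
    (h : ∀ z ∈ K, ∃ s ∈ 𝓝 z, HasPuiseuxZeros F s) : HasPuiseuxZeros F K := by
  refine hK.induction_on (p := HasPuiseuxZeros F) ?_ (fun _ _ hs ht => ht.mono hs)
    (fun _ _ hs ht => hs.union ht) fun z hz => ?_
  · exact ⟨1, ∅, one_pos, Set.finite_empty, by simp, by simp⟩
  · obtain ⟨s, hs, hF⟩ := h z hz
    exact ⟨s, mem_nhdsWithin_of_mem_nhds hs, hF⟩

theorem of_ne_zero (hF : ContinuousAt F 0) (h0 : F 0 ≠ 0) :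
    ∃ s ∈ 𝓝 (0 : ℝ), HasPuiseuxZeros F s := by
  have h := hF.eventually_ne h0
  rw [Prod.zero_eq_mk, nhds_prod_eq] at h
  obtain ⟨u, hu, s, hs, h⟩ := mem_prod_iff.1 h
  refine ⟨s, hs, 1, ∅, one_pos, Set.finite_empty, by simp, ?_⟩
  filter_upwards [mem_nhdsWithin_of_mem_nhds hu] with t ht y hy h0
  rw [pow_one] at h0
  exact absurd h0 (h (Set.mk_mem_prod ht hy))

theorem of_shift {τ : ℝ → ℝ} (hτ : AnalyticAt ℝ τ 0)
    (h : HasPuiseuxZeros (fun v => F (v.1, τ v.1 + v.2)) s)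
    (hs : ∀ᶠ x in 𝓝 (0 : ℝ), ∀ y ∈ s', y - τ x ∈ s) : HasPuiseuxZeros F s' := by
  obtain ⟨q, S, hq, hS, h1, h2⟩ := h
  refine ⟨q, (fun φ t => τ (t ^ q) + φ t) '' S, hq, hS.image _, ?_, ?_⟩
  · rintro _ ⟨φ, hφ, rfl⟩
    exact ⟨(hτ.comp_pow_zero hq).add (h1 φ hφ).1, (h1 φ hφ).2⟩
  · have hs' := (tendsto_nhdsWithin_iff.1 (tendsto_pow_nhdsGT_zero hq)).1.eventually hs
    filter_upwards [h2, hs'] with t ht hts y hy hF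
    obtain ⟨φ, hφ, h⟩ := ht (y - τ (t ^ q)) (hts y hy) (by simpa using hF)
    exact ⟨_, ⟨φ, hφ, rfl⟩, by simp [← h]⟩

theorem of_scale {p q N : ℕ} (hp : 0 < p) (hq : 0 < q) {ε C : ℝ} (hε : 0 < ε)
    (hFG : ∀ᶠ t in 𝓝 (0 : ℝ), ∀ z, |t ^ p * z| < ε → F (t ^ q, t ^ p * z) = t ^ N * G (t, z))
    (hC : ∀ᶠ t in 𝓝 (0 : ℝ), ∀ z, |t ^ p * z| < ε → G (t, z) = 0 → |z| ≤ C)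
    (h : HasPuiseuxZeros G (Set.Icc (-C) C)) : HasPuiseuxZeros F (Metric.ball 0 ε) := by
  obtain ⟨r, S, hr, hS, h1, h2⟩ := h
  have hr' := (tendsto_nhdsWithin_iff.1 (tendsto_pow_nhdsGT_zero hr)).1
  refine ⟨r * q, (fun φ t => (t ^ r) ^ p * φ t) '' S, by positivity, hS.image _, ?_, ?_⟩
  · rintro _ ⟨φ, hφ, rfl⟩
    have han : AnalyticAt ℝ (fun t => (t ^ r) ^ p * φ t) 0 :=
      ((analyticAt_id.pow r).pow p).mul (h1 φ hφ).1
    refine ⟨han, ?_⟩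
    have hlt : ∀ᶠ t in 𝓝 (0 : ℝ), |(t ^ r) ^ p * φ t| < ε := by
      refine han.continuousAt.abs.eventually_lt continuousAt_const ?_
      simpa [hp.ne', hr.ne'] using hε
    filter_upwards [hr'.eventually hFG, (h1 φ hφ).2, mem_nhdsWithin_of_mem_nhds hlt] with t h3 h4 h5
    rw [pow_mul, h3 _ h5, h4, mul_zero]
  · filter_upwards [hr'.eventually hFG, hr'.eventually hC, h2, self_mem_nhdsWithin]
      with t h3 h4 h5 ht y hy hF
    have ht' : (0 : ℝ) < (t ^ r) ^ p := pow_pos (pow_pos ht _) _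
    obtain ⟨z, rfl⟩ : ∃ z, y = (t ^ r) ^ p * z := ⟨y / (t ^ r) ^ p, by field_simp⟩
    have hz : |(t ^ r) ^ p * z| < ε := by simpa using hy
    rw [pow_mul, h3 z hz] at hF
    have hG : G (t ^ r, z) = 0 :=
      (mul_eq_zero.1 hF).resolve_left (pow_pos (pow_pos ht _) _).ne'
    obtain ⟨φ, hφ, h⟩ := h5 z (abs_le.1 (h4 z hz hG)) hG
    exact ⟨_, ⟨φ, hφ, rfl⟩, by simp [h]⟩

end HasPuiseuxZeros

/-- The weights of an edge of the Newton polygon, together with the rescaled coefficients. -/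
theorem exists_newton_edge {d : ℕ} {a : ℕ → ℝ → ℝ} (ha : ∀ i, AnalyticAt ℝ (a i) 0)
    (ha0 : ∀ i < d, a i 0 = 0) (hne : ∃ i < d, ¬ ∀ᶠ x in 𝓝 (0 : ℝ), a i x = 0) :
    ∃ (p q : ℕ) (B : ℕ → ℝ → ℝ), 0 < p ∧ 0 < q ∧ (∀ i, AnalyticAt ℝ (B i) 0) ∧
      (∀ i < d, ∀ᶠ t in 𝓝 (0 : ℝ), a i (t ^ q) * t ^ (p * i) = t ^ (p * d) * B i t) ∧
      (∃ i < d, B i 0 ≠ 0) ∧ ∀ i, (∀ᶠ x in 𝓝 (0 : ℝ), a i x = 0) → B i 0 = 0 := by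
  classical
  have hfac : ∀ i, ∃ (n : ℕ) (b : ℝ → ℝ), AnalyticAt ℝ b 0 ∧
      (∀ᶠ x in 𝓝 (0 : ℝ), a i x = x ^ n * b x) ∧
      (b 0 = 0 ↔ ∀ᶠ x in 𝓝 (0 : ℝ), a i x = 0) := by
    intro i
    by_cases h : ∀ᶠ x in 𝓝 (0 : ℝ), a i x = 0
    · exact ⟨0, fun _ => 0, analyticAt_const, by simpa using h, by simpa using h⟩
    · obtain ⟨n, b, hb, hb0, hab⟩ := (ha i).exists_eventuallyEq_pow_smul_nonzero_iff.2 h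
      exact ⟨n, b, hb, by simpa using hab, by simp [hb0, h]⟩
  choose n b hb hab hb0 using hfac
  obtain ⟨i₁, hi₁, hne₁⟩ := hne
  obtain ⟨i₀, hi₀, hmin⟩ := Finset.exists_min_image
    ((Finset.range d).filter fun i => b i 0 ≠ 0) (fun i => (n i : ℚ) / (d - i : ℕ))
    ⟨i₁, by simp [hi₁, (hb0 i₁).not.2 hne₁]⟩
  obtain ⟨hi₀d, hbi₀⟩ := Finset.mem_filter.1 hi₀
  rw [Finset.mem_range] at hi₀d
  have hle : ∀ i < d, b i 0 ≠ 0 → n i₀ * (d - i) ≤ (d - i₀) * n i := by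
    intro i hi hbi
    have := hmin i (Finset.mem_filter.2 ⟨Finset.mem_range.2 hi, hbi⟩)
    have h1 : (0 : ℚ) < (d - i₀ : ℕ) := by exact_mod_cast Nat.sub_pos_of_lt hi₀d
    have h2 : (0 : ℚ) < (d - i : ℕ) := by exact_mod_cast Nat.sub_pos_of_lt hi
    rw [div_le_div_iff₀ h1 h2] at this
    rw [mul_comm (d - i₀)]
    exact_mod_cast this
  have hn0 : 0 < n i₀ := by
    rw [Nat.pos_iff_ne_zero]
    intro h
    have h1 := (hab i₀).self_of_nhds
    rw [ha0 i₀ hi₀d, h, pow_zero, one_mul] at h1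
    exact hbi₀ h1.symm
  have hq : 0 < d - i₀ := Nat.sub_pos_of_lt hi₀d
  refine ⟨n i₀, d - i₀, fun i t => if b i 0 = 0 then 0 else
    t ^ ((d - i₀) * n i - n i₀ * (d - i)) * b i (t ^ (d - i₀)), hn0, hq, ?_, ?_, ?_, ?_⟩
  · intro i
    by_cases h : b i 0 = 0
    · simp only [h, if_true]
      exact analyticAt_const
    · simp only [h, if_false]
      exact (analyticAt_id.pow _).mul ((hb i).comp_pow_zero hq)
  · intro i hi
    have ht : Tendsto (fun t : ℝ => t ^ (d - i₀)) (𝓝 0) (𝓝 0) :=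
      Continuous.tendsto' (by fun_prop) _ _ (by simp [hq.ne'])
    by_cases h : b i 0 = 0
    · filter_upwards [ht.eventually ((hb0 i).1 h)] with t h1
      simp [h, h1]
    · filter_upwards [ht.eventually (hab i)] with t h1
      rw [if_neg h, h1, ← pow_mul]
      have h2 : n i₀ * d + ((d - i₀) * n i - n i₀ * (d - i)) = (d - i₀) * n i + n i₀ * i := by
        have h3 := hle i hi h
        have h4 : n i₀ * d = n i₀ * (d - i) + n i₀ * i := by
          rw [← mul_add, Nat.sub_add_cancel hi.le]
        omega
      rw [← mul_assoc (t ^ (n i₀ * d)), ← pow_add, h2, pow_add]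
      ring
  · refine ⟨i₀, hi₀d, ?_⟩
    simp [hbi₀, mul_comm (n i₀), hq.ne']
  · intro i h
    simp [(hb0 i).2 h]

open Polynomial in
/-- A polynomial of degree `d + 1` without term of degree `d` which is not a monomial has
no root of multiplicity `d + 1`. -/
theorem exists_rootMultiplicity_factor_of_tschirnhaus {d : ℕ} {b : ℕ → ℝ} {c : ℝ} (hc : c ≠ 0)
    (hbd : b d = 0) (hb : ∃ i < d + 1, b i ≠ 0) (z : ℝ) :
    ∃ m < d + 1, ∃ Q : ℝ[X], Q.eval z ≠ 0 ∧ ∀ y,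
      ∑ i ∈ Finset.range (d + 1), b i * (z + y) ^ i + (z + y) ^ (d + 1) * c =
        y ^ m * Q.eval (z + y) := by
  set P : ℝ[X] := ∑ i ∈ Finset.range (d + 1), C (b i) * X ^ i + C c * X ^ (d + 1) with hP
  have hcoeff : ∀ k < d + 1, P.coeff k = b k := by
    intro k hk
    simp [hP, coeff_X_pow, hk.ne, Finset.sum_ite_eq, hk]
  have hlead : P.coeff (d + 1) = c := by
    simp only [hP, coeff_add, finsetSum_coeff, coeff_C_mul, coeff_X_pow]
    rw [Finset.sum_eq_zero]
    · simp
    · intro i hi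
      rw [if_neg (by have := Finset.mem_range.1 hi; omega), mul_zero]
  have hP0 : P ≠ 0 := fun h => hc (by rw [← hlead, h, coeff_zero])
  have hdeg : P.natDegree ≤ d + 1 := by
    refine natDegree_add_le_of_degree_le ?_ (natDegree_C_mul_X_pow_le _ _)
    refine natDegree_sum_le_of_forall_le _ _ fun i hi => ?_
    exact (natDegree_C_mul_X_pow_le _ _).trans (Finset.mem_range.1 hi).le
  obtain ⟨Q, hPQ, hQ⟩ := P.exists_eq_pow_rootMultiplicity_mul_and_not_dvd hP0 z
  set m := P.rootMultiplicity z with hm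
  refine ⟨m, ?_, Q, fun h => hQ (dvd_iff_isRoot.2 h), fun y => ?_⟩
  · by_contra hlt
    have hQ0 : Q ≠ 0 := by rintro rfl; simp at hQ
    have h1 : P.natDegree = m + Q.natDegree := by
      conv_lhs => rw [hPQ]
      rw [natDegree_mul (pow_ne_zero _ (X_sub_C_ne_zero z)) hQ0, natDegree_pow, natDegree_X_sub_C,
        mul_one]
    have hmd : m = d + 1 := by omega
    obtain ⟨k, rfl⟩ := natDegree_eq_zero.1 (show Q.natDegree = 0 by omega)
    have hk : k ≠ 0 := by rintro rfl; simp at hQ0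
    rw [hmd] at hPQ
    have h2 := hcoeff d (Nat.lt_succ_self d)
    rw [hPQ, coeff_mul_C, sub_eq_add_neg, ← C_neg, coeff_X_add_C_pow, hbd] at h2
    have hz : z = 0 := by
      simpa [hk, Nat.cast_add_one_ne_zero] using h2
    obtain ⟨i, hi, hbi⟩ := hb
    refine hbi ?_
    rw [← hcoeff i hi, hPQ, hz, coeff_mul_C, sub_eq_add_neg, ← C_neg, coeff_X_add_C_pow, neg_zero,
      zero_pow (by omega), zero_mul, zero_mul]
  · have h1 : P.eval (z + y) = ∑ i ∈ Finset.range (d + 1), b i * (z + y) ^ i +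
        (z + y) ^ (d + 1) * c := by
      simp [hP, eval_finsetSum, mul_comm c]
    rw [← h1]
    conv_lhs => rw [hPQ]
    simp

theorem exists_bound_of_leading_coeff {p q d : ℕ} (hq : 0 < q) {B : ℕ → ℝ → ℝ}
    {U : ℝ × ℝ → ℝ} (hB : ∀ i, ContinuousAt (B i) 0) (hU : ContinuousAt U 0) (hU0 : U 0 ≠ 0) :
    ∃ C : ℝ, ∃ ε > 0, ∀ᶠ t in 𝓝 (0 : ℝ), ∀ z, |t ^ p * z| < ε →
      ∑ i ∈ Finset.range (d + 1), B i t * z ^ i + z ^ (d + 1) * U (t ^ q, t ^ p * z) = 0 →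
        |z| ≤ C := by
  set m := |U 0| / 2 with hm
  have hm0 : 0 < m := by positivity
  have h1 : ∀ᶠ v in 𝓝 (0 : ℝ × ℝ), m < |U v| :=
    continuousAt_const.eventually_lt hU.abs (by simp only [hm]; linarith [abs_pos.2 hU0])
  obtain ⟨ε, hε, hεU⟩ := Metric.eventually_nhds_iff.1 h1
  set M := ∑ i ∈ Finset.range (d + 1), (|B i 0| + 1) with hM
  have hM0 : 0 ≤ M := Finset.sum_nonneg fun i _ => by positivity
  have h2 : ∀ᶠ t in 𝓝 (0 : ℝ), ∀ i ∈ Finset.range (d + 1), |B i t| < |B i 0| + 1 :=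
    (Filter.eventually_all_finset _).2 fun i _ =>
      (hB i).abs.eventually_lt continuousAt_const (by linarith)
  have h3 : ∀ᶠ t in 𝓝 (0 : ℝ), |t ^ q| < ε :=
    ContinuousAt.eventually_lt (by fun_prop) continuousAt_const (by simpa [hq.ne'] using hε)
  refine ⟨1 + M / m, ε, hε, ?_⟩
  filter_upwards [h2, h3] with t ht2 ht3 z hz hG
  by_contra hlt
  push Not at hlt
  have hz1 : 1 < |z| := lt_of_le_of_lt (by simp; positivity) hlt
  have hUv : m < |U (t ^ q, t ^ p * z)| := hεU (by
    rw [dist_zero_right, Prod.norm_def]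
    exact max_lt ht3 hz)
  have hsum : |z| ^ (d + 1) * |U (t ^ q, t ^ p * z)| ≤ M * |z| ^ d := by
    have : z ^ (d + 1) * U (t ^ q, t ^ p * z) = -∑ i ∈ Finset.range (d + 1), B i t * z ^ i := by
      linarith
    rw [← abs_pow, ← abs_mul, this, abs_neg, hM, Finset.sum_mul]
    refine (Finset.abs_sum_le_sum_abs _ _).trans (Finset.sum_le_sum fun i hi => ?_)
    rw [abs_mul, abs_pow]
    exact mul_le_mul (ht2 i hi).le (pow_le_pow_right₀ hz1.le
      (Nat.lt_succ_iff.1 (Finset.mem_range.1 hi))) (by positivity) (by positivity)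
  have hzd : 0 < |z| ^ d := by positivity
  have h5 : |z| * m ≤ M := by
    have : |z| ^ d * (|z| * m) ≤ |z| ^ d * M := by
      calc |z| ^ d * (|z| * m) = |z| ^ (d + 1) * m := by ring
        _ ≤ |z| ^ (d + 1) * |U (t ^ q, t ^ p * z)| := by gcongr
        _ ≤ M * |z| ^ d := hsum
        _ = |z| ^ d * M := mul_comm _ _
    exact le_of_mul_le_mul_left this hzd
  have h6 : |z| ≤ M / m := (le_div_iff₀ hm0).2 h5
  linarith

/-- The real Newton–Puiseux theorem for analytic functions of finite order in `y`. -/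
theorem AnalyticAt.hasPuiseuxZeros {d : ℕ} {F : ℝ × ℝ → ℝ} (hF : AnalyticAt ℝ F 0) {u : ℝ → ℝ}
    (hu : AnalyticAt ℝ u 0) (hu0 : u 0 ≠ 0) (hFu : ∀ᶠ y in 𝓝 (0 : ℝ), F (0, y) = y ^ d * u y) :
    ∃ s ∈ 𝓝 (0 : ℝ), HasPuiseuxZeros F s := by
  induction d using Nat.strong_induction_on generalizing F u with
  | _ d ih =>
  cases d with
  | zero =>
    refine HasPuiseuxZeros.of_ne_zero hF.continuousAt ?_
    have := hFu.self_of_nhds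
    rw [← Prod.zero_eq_mk] at this
    simpa [this] using hu0
  | succ d =>
  obtain ⟨τ, a, U, hτ, hτ0, ha, hU, hU0, ha0, had, haU⟩ := hF.exists_tschirnhaus hu hu0 hFu
  set g : ℝ × ℝ → ℝ := fun v => F (v.1, τ v.1 + v.2) with hg
  suffices h : ∃ ε > 0, HasPuiseuxZeros g (Metric.ball 0 ε) by
    obtain ⟨ε, hε, h⟩ := h
    refine ⟨Metric.ball 0 (ε / 2), Metric.ball_mem_nhds _ (by positivity), h.of_shift hτ ?_⟩
    have h1 : ∀ᶠ x in 𝓝 (0 : ℝ), |τ x| < ε / 2 :=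
      hτ.continuousAt.abs.eventually_lt continuousAt_const (by simpa [hτ0] using hε)
    filter_upwards [h1] with x hx y hy
    rw [mem_ball_zero_iff, Real.norm_eq_abs] at hy ⊢
    exact (abs_sub _ _).trans_lt (by linarith)
  by_cases hall : ∀ i < d + 1, ∀ᶠ x in 𝓝 (0 : ℝ), a i x = 0
  · have h1 : ∀ᶠ v in 𝓝 (0 : ℝ × ℝ), ∀ i ∈ Finset.range (d + 1), a i v.1 = 0 :=
      (Filter.eventually_all_finset _).2 fun i hi =>
        (continuous_fst.tendsto' (0 : ℝ × ℝ) (0 : ℝ) rfl).eventually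
          (hall i (Finset.mem_range.1 hi))
    have h2 : ∀ᶠ v in 𝓝 (0 : ℝ × ℝ), g v = 0 ↔ v.2 = 0 := by
      filter_upwards [haU, h1, hU.continuousAt.eventually_ne hU0] with v h3 h4 h5
      have : g v = v.2 ^ (d + 1) * U v := by
        simp only [hg]
        rw [h3, Finset.sum_eq_zero fun i hi => by rw [h4 i hi, zero_mul], zero_add]
      simp [this, h5]
    obtain ⟨ε, hε, hεg⟩ := Metric.eventually_nhds_iff.1 h2
    have h3 : ∀ᶠ t in 𝓝[>] (0 : ℝ), |t| < ε :=
      mem_nhdsWithin_of_mem_nhds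
        (ContinuousAt.eventually_lt (by fun_prop) continuousAt_const (by simpa using hε))
    refine ⟨ε, hε, 1, {fun _ => 0}, one_pos, Set.finite_singleton _, ?_, ?_⟩
    · rintro φ rfl
      refine ⟨analyticAt_const, ?_⟩
      filter_upwards [h3] with t ht
      exact (hεg (by simpa [Prod.norm_def, hε] using ht)).2 rfl
    · filter_upwards [h3] with t ht y hy h0
      refine ⟨_, rfl, (hεg (y := (t ^ 1, y)) ?_).1 h0⟩
      rw [dist_zero_right, Prod.norm_def]
      exact max_lt (by simpa using ht) (by simpa using hy)
  · push Not at hall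
    obtain ⟨p, q, B, hp, hq, hB, haB, hBne, hB0⟩ := exists_newton_edge ha
      (fun i hi => ha0 i (Nat.lt_succ_iff.1 hi)) (by simpa using hall)
    set G : ℝ × ℝ → ℝ := fun v => ∑ i ∈ Finset.range (d + 1), B i v.1 * v.2 ^ i +
      v.2 ^ (d + 1) * U (v.1 ^ q, v.1 ^ p * v.2) with hG
    obtain ⟨C, ε₁, hε₁, hC⟩ := exists_bound_of_leading_coeff (p := p) (d := d) hq
      (fun i => (hB i).continuousAt) hU.continuousAt hU0
    obtain ⟨ε₂, hε₂, haU'⟩ := Metric.eventually_nhds_iff.1 haU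
    refine ⟨min ε₁ ε₂, lt_min hε₁ hε₂, HasPuiseuxZeros.of_scale (G := G) (C := C) hp hq
      (N := p * (d + 1)) (lt_min hε₁ hε₂) ?_
      (hC.mono fun t ht z hz => ht z (lt_of_lt_of_le hz (min_le_left _ _))) ?_⟩
    · have h1 : ∀ᶠ t in 𝓝 (0 : ℝ), ∀ i ∈ Finset.range (d + 1),
          a i (t ^ q) * t ^ (p * i) = t ^ (p * (d + 1)) * B i t :=
        (Filter.eventually_all_finset _).2 fun i hi => haB i (Finset.mem_range.1 hi)
      have h2 : ∀ᶠ t in 𝓝 (0 : ℝ), |t ^ q| < ε₂ :=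
        ContinuousAt.eventually_lt (by fun_prop) continuousAt_const (by simpa [hq.ne'] using hε₂)
      filter_upwards [h1, h2] with t ht1 ht2 z hz
      have h3 := @haU' (t ^ q, t ^ p * z) (by
        rw [dist_zero_right, Prod.norm_def]
        exact max_lt ht2 (hz.trans_le (min_le_right _ _)))
      simp only [hg, hG]
      rw [h3, mul_add, Finset.mul_sum]
      congr 1
      · refine Finset.sum_congr rfl fun i hi => ?_
        rw [← mul_assoc, ← ht1 i hi, mul_pow, ← pow_mul]
        ring
      · rw [mul_pow, ← pow_mul]
        ring
    · refine HasPuiseuxZeros.of_isCompact isCompact_Icc fun z _ => ?_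
      obtain ⟨m, hm, Q, hQ, hfac⟩ := exists_rootMultiplicity_factor_of_tschirnhaus
        (b := fun i => B i 0) hU0 (hB0 d had) hBne z
      have hGz : AnalyticAt ℝ (fun v : ℝ × ℝ => G (v.1, z + v.2)) 0 := by
        have hz : AnalyticAt ℝ (fun v : ℝ × ℝ => z + v.2) 0 := analyticAt_const.add analyticAt_snd
        refine AnalyticAt.add ?_ ((hz.pow _).mul ?_)
        · refine Finset.analyticAt_fun_sum _ fun i _ => AnalyticAt.mul ?_ (hz.pow i)
          exact AnalyticAt.fun_comp (g := B i) (f := Prod.fst) (hB i) analyticAt_fst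
        · refine AnalyticAt.fun_comp (g := U) (f := fun v : ℝ × ℝ => (v.1 ^ q, v.1 ^ p * (z + v.2)))
            ?_ ((analyticAt_fst.pow q).prod ((analyticAt_fst.pow p).mul hz))
          simpa [hp.ne', hq.ne', ← Prod.zero_eq_mk] using hU
      obtain ⟨s, hs, h⟩ := ih m hm hGz (u := fun y => Q.eval (z + y))
        (by
          have : AnalyticAt ℝ (fun x => Q.eval x) (z + 0) := by
            exact AnalyticOnNhd.eval_polynomial Q _ (Set.mem_univ _)
          exact AnalyticAt.fun_comp (f := fun y => z + y) this (analyticAt_const.add analyticAt_id))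
        (by simpa using hQ)
        (Eventually.of_forall fun y => by
          simpa [hG, hp.ne', hq.ne', ← Prod.zero_eq_mk] using hfac y)
      refine ⟨(fun y => y - z) ⁻¹' s, ?_, h.of_shift (τ := fun _ => z) analyticAt_const ?_⟩
      · exact Continuous.tendsto' (f := fun y => y - z) (by fun_prop) z 0 (sub_self z) hs
      · exact Eventually.of_forall fun x y hy => hy

theorem eventually_forall_Ioo_of_eventually_nhdsGT {P : ℝ → Prop}
    (h : ∀ᶠ t in 𝓝[>] (0 : ℝ), P t) : ∀ᶠ ε in 𝓝[>] (0 : ℝ), ∀ t ∈ Set.Ioo 0 ε, P t := by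
  obtain ⟨δ, hδ, hδP⟩ := mem_nhdsGT_iff_exists_Ioo_subset.1 h
  filter_upwards [Ioo_mem_nhdsGT (Set.mem_Ioi.1 hδ)] with ε hε t ht
  exact hδP ⟨ht.1, ht.2.trans hε.2⟩

/-- `Γ` is a finite family of pairwise disjoint analytic arcs issued from the origin which
together make up the germ at the origin of the zero set of `H` in the region `D`. -/
structure IsBranchFamily (H : ℝ × ℝ → ℝ) (D : Set (ℝ × ℝ)) (Γ : Set (ℝ → ℝ × ℝ)) : Prop where
  finite : Γ.Finite
  analyticAt : ∀ γ ∈ Γ, AnalyticAt ℝ γ 0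
  map_zero : ∀ γ ∈ Γ, γ 0 = 0
  mem_region : ∀ γ ∈ Γ, ∀ᶠ t in 𝓝[>] (0 : ℝ), γ t ∈ D
  apply_eq_zero : ∀ γ ∈ Γ, ∀ᶠ t in 𝓝[>] (0 : ℝ), H (γ t) = 0
  disjoint : ∀ γ ∈ Γ, ∀ γ' ∈ Γ, γ ≠ γ' →
    ∀ᶠ ε in 𝓝[>] (0 : ℝ), ∀ t ∈ Set.Ioo 0 ε, ∀ t' ∈ Set.Ioo 0 ε, γ t ≠ γ' t'
  cover : ∀ ε > 0, ∀ᶠ p in 𝓝 (0 : ℝ × ℝ), H p = 0 → p ∈ D → ∃ γ ∈ Γ, ∃ t ∈ Set.Ioo 0 ε, γ t = p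

namespace IsBranchFamily

variable {H : ℝ × ℝ → ℝ} {D D' : Set (ℝ × ℝ)} {Γ Γ' : Set (ℝ → ℝ × ℝ)}

theorem union (h : IsBranchFamily H D Γ) (h' : IsBranchFamily H D' Γ') (hD : Disjoint D D') :
    IsBranchFamily H (D ∪ D') (Γ ∪ Γ') where
  finite := h.finite.union h'.finite
  analyticAt γ hγ := hγ.elim (h.analyticAt γ) (h'.analyticAt γ)
  map_zero γ hγ := hγ.elim (h.map_zero γ) (h'.map_zero γ)
  mem_region γ hγ := hγ.elim (fun hγ => (h.mem_region γ hγ).mono fun _ => Or.inl)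
    (fun hγ => (h'.mem_region γ hγ).mono fun _ => Or.inr)
  apply_eq_zero γ hγ := hγ.elim (h.apply_eq_zero γ) (h'.apply_eq_zero γ)
  disjoint := by
    rintro γ (hγ | hγ) γ' (hγ' | hγ') hne
    · exact h.disjoint γ hγ γ' hγ' hne
    · filter_upwards [eventually_forall_Ioo_of_eventually_nhdsGT (h.mem_region γ hγ),
        eventually_forall_Ioo_of_eventually_nhdsGT (h'.mem_region γ' hγ')]
        with ε h1 h2 t ht t' ht' he
      exact Set.disjoint_left.1 hD (h1 t ht) (he ▸ h2 t' ht')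
    · filter_upwards [eventually_forall_Ioo_of_eventually_nhdsGT (h'.mem_region γ hγ),
        eventually_forall_Ioo_of_eventually_nhdsGT (h.mem_region γ' hγ')]
        with ε h1 h2 t ht t' ht' he
      exact Set.disjoint_left.1 hD (h2 t' ht') (he ▸ h1 t ht)
    · exact h'.disjoint γ hγ γ' hγ' hne
  cover ε hε := by
    filter_upwards [h.cover ε hε, h'.cover ε hε] with p h1 h2 hp hpD
    rcases hpD with hpD | hpD
    · obtain ⟨γ, hγ, h⟩ := h1 hp hpD
      exact ⟨γ, Or.inl hγ, h⟩
    · obtain ⟨γ, hγ, h⟩ := h2 hp hpD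
      exact ⟨γ, Or.inr hγ, h⟩

theorem extend_region (h : IsBranchFamily H D Γ) (hD : D ⊆ D')
    (hcover : ∀ᶠ p in 𝓝 (0 : ℝ × ℝ), H p = 0 → p ∈ D' → p ∈ D) : IsBranchFamily H D' Γ where
  finite := h.finite
  analyticAt := h.analyticAt
  map_zero := h.map_zero
  mem_region γ hγ := (h.mem_region γ hγ).mono fun _ ht => hD ht
  apply_eq_zero := h.apply_eq_zero
  disjoint := h.disjoint
  cover ε hε := by
    filter_upwards [h.cover ε hε, hcover] with p h1 h2 hp hpD
    exact h1 hp (h2 hp hpD)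

theorem map (A : (ℝ × ℝ) ≃L[ℝ] ℝ × ℝ) (h : IsBranchFamily (fun v => H (A v)) (A ⁻¹' D) Γ) :
    IsBranchFamily H D ((fun γ t => A (γ t)) '' Γ) where
  finite := h.finite.image _
  analyticAt := by
    rintro _ ⟨γ, hγ, rfl⟩
    exact AnalyticAt.fun_comp (g := A) (A.analyticAt _) (h.analyticAt γ hγ)
  map_zero := by
    rintro _ ⟨γ, hγ, rfl⟩
    simp [h.map_zero γ hγ]
  mem_region := by
    rintro _ ⟨γ, hγ, rfl⟩
    exact h.mem_region γ hγ
  apply_eq_zero := by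
    rintro _ ⟨γ, hγ, rfl⟩
    exact h.apply_eq_zero γ hγ
  disjoint := by
    rintro _ ⟨γ, hγ, rfl⟩ _ ⟨γ', hγ', rfl⟩ hne
    have : γ ≠ γ' := by rintro rfl; exact hne rfl
    filter_upwards [h.disjoint γ hγ γ' hγ' this] with ε h1 t ht t' ht' he
    exact h1 t ht t' ht' (A.injective he)
  cover ε hε := by
    have hA : Tendsto A.symm (𝓝 0) (𝓝 0) := by simpa using A.symm.continuous.tendsto 0
    filter_upwards [hA.eventually (h.cover ε hε)] with p h1 hp hpD
    obtain ⟨γ, hγ, t, ht, h⟩ := h1 (by simpa using hp) (by simpa using hpD)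
    exact ⟨_, ⟨γ, hγ, rfl⟩, t, ht, by simp [h]⟩

end IsBranchFamily

/-- Among finitely many analytic germs, equal ones may be identified. -/
theorem exists_germ_representatives {S : Set (ℝ → ℝ)} (hS : S.Finite)
    (ha : ∀ φ ∈ S, AnalyticAt ℝ φ 0) :
    ∃ S' : Set (ℝ → ℝ), S'.Finite ∧ (∀ φ ∈ S, ∃ ψ ∈ S', ψ =ᶠ[𝓝 0] φ) ∧
      (∀ ψ ∈ S', ∃ φ ∈ S, ψ =ᶠ[𝓝 0] φ) ∧
      ∀ φ ∈ S', ∀ ψ ∈ S', φ ≠ ψ → ∀ᶠ t in 𝓝[>] (0 : ℝ), φ t ≠ ψ t := by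
  set rep : (ℝ → ℝ) → ℝ → ℝ := fun φ => Quotient.out (φ : Germ (𝓝 (0 : ℝ)) ℝ) with hrep
  have h1 : ∀ φ, rep φ =ᶠ[𝓝 0] φ := fun φ => Germ.coe_eq.1 (Quotient.out_eq _)
  refine ⟨rep '' S, hS.image _, fun φ hφ => ⟨_, ⟨φ, hφ, rfl⟩, h1 φ⟩, ?_, ?_⟩
  · rintro _ ⟨φ, hφ, rfl⟩
    exact ⟨φ, hφ, h1 φ⟩
  · rintro _ ⟨φ, hφ, rfl⟩ _ ⟨ψ, hψ, rfl⟩ hne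
    rcases (ha φ hφ).eventually_eq_or_eventually_ne (ha ψ hψ) with h | h
    · refine absurd ?_ hne
      have : (φ : Germ (𝓝 (0 : ℝ)) ℝ) = ψ := Germ.coe_eq.2 h
      simp only [hrep, this]
    · have h2 : ∀ᶠ t in 𝓝[>] (0 : ℝ), φ t ≠ ψ t :=
        h.filter_mono (nhdsWithin_mono _ fun t (ht : 0 < t) => ht.ne')
      filter_upwards [h2, mem_nhdsWithin_of_mem_nhds (h1 φ), mem_nhdsWithin_of_mem_nhds (h1 ψ)]
        with t h3 h4 h5
      rwa [h4, h5]

theorem HasPuiseuxZeros.exists_isBranchFamily {F : ℝ × ℝ → ℝ} {s : Set ℝ} (hs : s ∈ 𝓝 (0 : ℝ))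
    (h : HasPuiseuxZeros F s) : ∃ Γ, IsBranchFamily F {p | 0 < p.1} Γ := by
  obtain ⟨q, S, hq, hS, h1, h2⟩ := h
  obtain ⟨S', hS', hSS', hS'S, hne⟩ :=
    exists_germ_representatives (S := {φ ∈ S | φ 0 = 0}) (hS.subset fun _ h => h.1)
      fun φ hφ => (h1 φ hφ.1).1
  refine ⟨(fun φ t => (t ^ q, φ t)) '' S', hS'.image _, ?_, ?_, ?_, ?_, ?_, ?_⟩
  · rintro _ ⟨ψ, hψ, rfl⟩
    obtain ⟨φ, hφ, he⟩ := hS'S ψ hψ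
    exact (analyticAt_id.pow q).prod ((h1 φ hφ.1).1.congr he.symm)
  · rintro _ ⟨ψ, hψ, rfl⟩
    obtain ⟨φ, hφ, he⟩ := hS'S ψ hψ
    simp [he.eq_of_nhds, hφ.2, hq.ne']
  · rintro _ ⟨ψ, hψ, rfl⟩
    filter_upwards [self_mem_nhdsWithin] with t ht
    exact pow_pos (Set.mem_Ioi.1 ht) q
  · rintro _ ⟨ψ, hψ, rfl⟩
    obtain ⟨φ, hφ, he⟩ := hS'S ψ hψ
    filter_upwards [(h1 φ hφ.1).2, he.filter_mono nhdsWithin_le_nhds] with t h3 h4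
    rw [h4, h3]
  · rintro _ ⟨φ, hφ, rfl⟩ _ ⟨ψ, hψ, rfl⟩ hn
    have hφψ : φ ≠ ψ := by rintro rfl; exact hn rfl
    filter_upwards [eventually_forall_Ioo_of_eventually_nhdsGT (hne φ hφ ψ hψ hφψ)]
      with ε hε t ht t' ht' he
    obtain ⟨e1, e2⟩ := Prod.ext_iff.1 he
    have : t = t' := (pow_left_inj₀ ht.1.le ht'.1.le hq.ne').1 e1
    subst this
    exact hε t ht e2
  · intro ε hε
    have h3 : ∀ᶠ r in 𝓝[>] (0 : ℝ) ×ˢ 𝓝 (0 : ℝ), F (r.1 ^ q, r.2) = 0 → ∃ φ ∈ S', r.2 = φ r.1 := by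
      have h4 : ∀ φ ∈ S, ∀ᶠ r in 𝓝[>] (0 : ℝ) ×ˢ 𝓝 (0 : ℝ), r.2 = φ r.1 →
          ∃ ψ ∈ S', r.2 = ψ r.1 := by
        intro φ hφ
        by_cases h0 : φ 0 = 0
        · obtain ⟨ψ, hψ, he⟩ := hSS' φ ⟨hφ, h0⟩
          filter_upwards [tendsto_fst.eventually (he.filter_mono nhdsWithin_le_nhds)] with r hr h5
          exact ⟨ψ, hψ, h5.trans hr.symm⟩
        · have t1 : Tendsto (fun r : ℝ × ℝ => r.2 - φ r.1) (𝓝[>] (0 : ℝ) ×ˢ 𝓝 (0 : ℝ))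
              (𝓝 (0 - φ 0)) :=
            tendsto_snd.sub (((h1 φ hφ).1.continuousAt.tendsto.mono_left
              nhdsWithin_le_nhds).comp tendsto_fst)
          filter_upwards [t1.eventually_ne (show (0 - φ 0 : ℝ) ≠ 0 by simpa using h0)] with r hr h5
          exact absurd (sub_eq_zero.2 h5) hr
      filter_upwards [tendsto_fst.eventually h2, tendsto_snd.eventually hs,
        (Filter.eventually_all_finite hS).2 h4] with r h5 h6 h7 h8
      obtain ⟨φ, hφ, h9⟩ := h5 r.2 h6 h8
      exact h7 φ hφ h9
    obtain ⟨u, hu, v, hv, huv⟩ := mem_prod_iff.1 h3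
    obtain ⟨δ, hδ, hδu⟩ := mem_nhdsGT_iff_exists_Ioo_subset.1 hu
    set η := min δ ε with hη
    have hη0 : 0 < η := lt_min hδ hε
    have e1 : ∀ᶠ p in 𝓝 (0 : ℝ × ℝ), p.1 < η ^ q :=
      continuousAt_fst.eventually_lt continuousAt_const (by simpa using pow_pos hη0 q)
    have e2 : ∀ᶠ p in 𝓝 (0 : ℝ × ℝ), p.2 ∈ v :=
      (continuous_snd.tendsto' (0 : ℝ × ℝ) (0 : ℝ) rfl) hv
    filter_upwards [e1, e2] with p hp1 hp2 hp hpD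
    have hp0 : 0 < p.1 := hpD
    set t := p.1 ^ ((q : ℝ)⁻¹) with ht
    have htq : t ^ q = p.1 := Real.rpow_inv_natCast_pow hp0.le hq.ne'
    have ht0 : 0 < t := Real.rpow_pos_of_pos hp0 _
    have htη : t < η := lt_of_pow_lt_pow_left₀ q hη0.le (by rwa [htq])
    obtain ⟨φ, hφ, h⟩ := huv (a := (t, p.2))
      ⟨hδu ⟨ht0, htη.trans_le (min_le_left _ _)⟩, hp2⟩ (by simpa [htq] using hp)
    exact ⟨_, ⟨φ, hφ, rfl⟩, t, ⟨ht0, htη.trans_le (min_le_right _ _)⟩, Prod.ext htq h.symm⟩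

theorem AnalyticAt.exists_direction_not_eventually_zero {H : ℝ × ℝ → ℝ} (hH : AnalyticAt ℝ H 0)
    (hne : ¬ ∀ᶠ p in 𝓝 0, H p = 0) :
    ∃ p : ℝ × ℝ, p ≠ 0 ∧ ¬ ∀ᶠ s in 𝓝 (0 : ℝ), H (s • p) = 0 := by
  by_contra! hall
  obtain ⟨r, hr, ha⟩ := hH.exists_ball_analyticOnNhd
  refine hne ?_
  have hz : ∀ p ∈ Metric.ball (0 : ℝ × ℝ) r, p ≠ 0 → H p = 0 := by
    intro p hp hp0
    have hmaps : ∀ s ∈ Set.Icc (0 : ℝ) 1, s • p ∈ Metric.ball (0 : ℝ × ℝ) r := by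
      intro s hs
      rw [mem_ball_zero_iff] at hp ⊢
      rw [norm_smul, Real.norm_of_nonneg hs.1]
      nlinarith [norm_nonneg p, hs.2]
    have hf : AnalyticOnNhd ℝ (fun s : ℝ => H (s • p)) (Set.Icc 0 1) := fun s hs =>
      (ha _ (hmaps s hs)).fun_comp (f := fun s : ℝ => s • p) (by fun_prop)
    simpa using hf.eqOn_zero_of_preconnected_of_eventuallyEq_zero isPreconnected_Icc
      (Set.left_mem_Icc.2 zero_le_one) (hall p hp0) (Set.right_mem_Icc.2 zero_le_one)
  have h0 : H 0 = 0 := by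
    have := (hall (1, 0) (by simp)).self_of_nhds
    simpa using this
  filter_upwards [Metric.ball_mem_nhds 0 hr] with p hp
  by_cases hp0 : p = 0
  · rw [hp0, h0]
  · exact hz p hp hp0

theorem exists_continuousLinearEquiv_snd_eq_smul {p : ℝ × ℝ} (hp : p ≠ 0) :
    ∃ A : (ℝ × ℝ) ≃L[ℝ] ℝ × ℝ, ∀ s : ℝ, A (0, s) = s • p := by
  have hpos : p.1 ^ 2 + p.2 ^ 2 ≠ 0 := by
    intro h
    refine hp (Prod.ext ?_ ?_) <;> simp only [Prod.fst_zero, Prod.snd_zero] <;>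
      nlinarith [sq_nonneg p.1, sq_nonneg p.2]
  let f : (ℝ × ℝ) →ₗ[ℝ] ℝ × ℝ :=
    { toFun := fun v => (-p.2 * v.1 + p.1 * v.2, p.1 * v.1 + p.2 * v.2)
      map_add' := fun v w => by ext <;> simp <;> ring
      map_smul' := fun c v => by ext <;> simp <;> ring }
  have hf : Function.Injective f := by
    rw [← LinearMap.ker_eq_bot, LinearMap.ker_eq_bot']
    intro v hv
    obtain ⟨h1, h2⟩ := Prod.ext_iff.1 hv
    simp only [f, LinearMap.coe_mk, AddHom.coe_mk, Prod.fst_zero, Prod.snd_zero] at h1 h2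
    refine Prod.ext ?_ ?_
    · refine (mul_eq_zero.1 (?_ : (p.1 ^ 2 + p.2 ^ 2) * v.1 = 0)).resolve_left hpos
      linear_combination p.1 * h2 - p.2 * h1
    · refine (mul_eq_zero.1 (?_ : (p.1 ^ 2 + p.2 ^ 2) * v.2 = 0)).resolve_left hpos
      linear_combination p.2 * h2 + p.1 * h1
  refine ⟨(LinearEquiv.ofInjectiveEndo f hf).toContinuousLinearEquiv, fun s => ?_⟩
  ext <;> simp [f, mul_comm]

/-- The zero set of a nonzero analytic germ in the punctured plane is a finite disjoint union
of analytic arcs. -/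
theorem AnalyticAt.exists_isBranchFamily {H : ℝ × ℝ → ℝ} (hH : AnalyticAt ℝ H 0)
    (hne : ¬ ∀ᶠ p in 𝓝 0, H p = 0) : ∃ Γ, IsBranchFamily H {0}ᶜ Γ := by
  obtain ⟨p, hp0, hp⟩ := hH.exists_direction_not_eventually_zero hne
  obtain ⟨A, hA⟩ := exists_continuousLinearEquiv_snd_eq_smul hp0
  let R : (ℝ × ℝ) ≃L[ℝ] ℝ × ℝ :=
    (ContinuousLinearEquiv.neg ℝ).prodCongr (ContinuousLinearEquiv.refl ℝ ℝ)
  have hR : ∀ v, R v = (-v.1, v.2) := fun v => rfl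
  set F : ℝ × ℝ → ℝ := fun v => H (A v) with hFdef
  have hF : AnalyticAt ℝ F 0 :=
    AnalyticAt.fun_comp (g := H) (f := A) (by rwa [map_zero]) (A.analyticAt _)
  have hFR : AnalyticAt ℝ (fun v => F (R v)) 0 :=
    AnalyticAt.fun_comp (g := F) (f := R) (by rwa [map_zero]) (R.analyticAt _)
  have hF0 : AnalyticAt ℝ (fun y : ℝ => F (0, y)) 0 :=
    AnalyticAt.fun_comp (g := F) (f := fun y : ℝ => ((0 : ℝ), y)) hF
      (analyticAt_const.prod analyticAt_id)
  obtain ⟨d, u, hu, hu0, hFu⟩ := hF0.exists_eventuallyEq_pow_smul_nonzero_iff.2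
    (by simpa only [hFdef, hA] using hp)
  simp only [sub_zero, smul_eq_mul] at hFu
  obtain ⟨s, hs, h1⟩ := hF.hasPuiseuxZeros hu hu0 hFu
  obtain ⟨s', hs', h2⟩ := hFR.hasPuiseuxZeros hu hu0 (by simpa [hR] using hFu)
  obtain ⟨Γ₁, hΓ₁⟩ := h1.exists_isBranchFamily hs
  obtain ⟨Γ₂, hΓ₂⟩ := h2.exists_isBranchFamily hs'
  have hΓ₂' := IsBranchFamily.map (H := F) (D := {p | p.1 < 0}) R (Γ := Γ₂)
    (by simpa [hR] using hΓ₂)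
  have hdisj : Disjoint {p : ℝ × ℝ | 0 < p.1} {p | p.1 < 0} :=
    Set.disjoint_left.2 fun p (h : 0 < p.1) (h' : p.1 < 0) => lt_asymm h h'
  have hΓ := (hΓ₁.union hΓ₂' hdisj).extend_region (D' := {0}ᶜ) (by
    rintro p (h | h) rfl
    · exact lt_irrefl (0 : ℝ) h
    · exact lt_irrefl (0 : ℝ) h) (by
    have e1 : ∀ᶠ p in 𝓝 (0 : ℝ × ℝ), F (0, p.2) = p.2 ^ d * u p.2 :=
      (continuous_snd.tendsto' (0 : ℝ × ℝ) (0 : ℝ) rfl).eventually hFu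
    have e2 : ∀ᶠ p in 𝓝 (0 : ℝ × ℝ), u p.2 ≠ 0 :=
      (continuous_snd.tendsto' (0 : ℝ × ℝ) (0 : ℝ) rfl).eventually
        (hu.continuousAt.eventually_ne hu0)
    filter_upwards [e1, e2] with p h1 h2 hp hp0
    rcases lt_trichotomy p.1 0 with h | h | h
    · exact Or.inr h
    · exfalso
      have hp' : p = (0, p.2) := Prod.ext h rfl
      rw [hp', h1] at hp
      have hp2 : p.2 ≠ 0 := fun h2 => hp0 (Prod.ext h h2)
      exact mul_ne_zero (pow_ne_zero _ hp2) h2 hp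
    · exact Or.inl h)
  refine ⟨_, IsBranchFamily.map A (D := {0}ᶜ) (Γ := Γ₁ ∪ (fun γ t => R (γ t)) '' Γ₂) ?_⟩
  have : A ⁻¹' {0}ᶜ = {0}ᶜ := by ext v; simp
  rw [this]
  exact hΓ

theorem isPreconnected_ball_diff_zero {r : ℝ} :
    IsPreconnected (Metric.ball (0 : ℝ × ℝ) r \ {0}) := by
  have hrank : 1 < Module.rank ℝ (ℝ × ℝ) := by
    rw [rank_prod', Module.rank_self]
    norm_num
  have h := (isPreconnected_Ioo (a := (0 : ℝ)) (b := r)).prod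
    (isPreconnected_sphere hrank (0 : ℝ × ℝ) 1)
  have h' := h.image (fun q : ℝ × (ℝ × ℝ) => q.1 • q.2) (by fun_prop)
  convert h' using 1
  ext p
  simp only [Set.mem_sdiff, mem_ball_zero_iff, Set.mem_singleton_iff, Set.mem_image, Set.mem_prod,
    Set.mem_Ioo, mem_sphere_zero_iff_norm, Prod.exists (α := ℝ) (β := ℝ × ℝ)]
  constructor
  · rintro ⟨h1, h2⟩
    have h3 := norm_pos_iff.2 h2
    refine ⟨‖p‖, ‖p‖⁻¹ • p, ⟨⟨h3, h1⟩, ?_⟩, ?_⟩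
    · rw [norm_smul, norm_inv, norm_norm, inv_mul_cancel₀ h3.ne']
    · rw [smul_smul, mul_inv_cancel₀ h3.ne', one_smul]
  · rintro ⟨s, v, ⟨⟨h1, h2⟩, h3⟩, rfl⟩
    have h4 : ‖s • v‖ = s := by rw [norm_smul, h3, mul_one, Real.norm_of_nonneg h1.le]
    exact ⟨h4.trans_lt h2, norm_pos_iff.1 (h4.symm ▸ h1)⟩

theorem frequently_eq_zero_of_not_isLocalExtr {H : ℝ × ℝ → ℝ}
    (hH : ∀ᶠ p in 𝓝 0, ContinuousAt H p) (h0 : H 0 = 0)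
    (hmax : ¬ IsLocalMax H 0) (hmin : ¬ IsLocalMin H 0) :
    ∃ᶠ p in 𝓝 (0 : ℝ × ℝ), H p = 0 ∧ p ≠ 0 := by
  intro h
  obtain ⟨r, hr, hball⟩ := Metric.eventually_nhds_iff_ball.1 (h.and hH)
  obtain ⟨a, ha, haH⟩ : ∃ a ∈ Metric.ball (0 : ℝ × ℝ) r, 0 < H a := by
    by_contra! hall
    exact hmax (by filter_upwards [Metric.ball_mem_nhds 0 hr] with p hp using h0 ▸ hall p hp)
  obtain ⟨b, hb, hbH⟩ : ∃ b ∈ Metric.ball (0 : ℝ × ℝ) r, H b < 0 := by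
    by_contra! hall
    exact hmin (by filter_upwards [Metric.ball_mem_nhds 0 hr] with p hp using h0 ▸ hall p hp)
  have hcont : ContinuousOn H (Metric.ball (0 : ℝ × ℝ) r \ {0}) := fun p hp =>
    (hball p hp.1).2.continuousWithinAt
  obtain ⟨p, hp, hpH⟩ := isPreconnected_ball_diff_zero.intermediate_value
    (⟨hb, by rintro rfl; exact hbH.ne h0⟩ : b ∈ Metric.ball (0 : ℝ × ℝ) r \ {0})
    (⟨ha, by rintro rfl; exact haH.ne' h0⟩ : a ∈ Metric.ball (0 : ℝ × ℝ) r \ {0}) hcont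
    (show (0 : ℝ) ∈ Set.Icc (H b) (H a) from ⟨hbH.le, haH.le⟩)
  exact (hball p hp.1).1 ⟨hpH, hp.2⟩

theorem AnalyticAt.eventually_deriv_pos {g : ℝ → ℝ} (hg : AnalyticAt ℝ g 0) (h0 : g 0 = 0)
    (hpos : ∀ᶠ t in 𝓝[>] (0 : ℝ), 0 < g t) : ∀ᶠ t in 𝓝[>] (0 : ℝ), 0 < deriv g t := by
  have hne : ¬ ∀ᶠ t in 𝓝 (0 : ℝ), g t = 0 := fun h => by
    obtain ⟨t, h1, h2⟩ := (hpos.and (h.filter_mono nhdsWithin_le_nhds)).exists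
    exact h1.ne' h2
  obtain ⟨n, w, hw, hw0, hgw⟩ := hg.exists_eventuallyEq_pow_smul_nonzero_iff.2 hne
  simp only [sub_zero, smul_eq_mul] at hgw
  obtain ⟨m, rfl⟩ : ∃ m, n = m + 1 := by
    refine Nat.exists_eq_succ_of_ne_zero ?_
    rintro rfl
    have := hgw.self_of_nhds
    simp [h0] at this
    exact hw0 this.symm
  have hw0' : 0 < w 0 := by
    refine lt_of_le_of_ne ?_ hw0.symm
    have hw' : Tendsto w (𝓝[>] 0) (𝓝 (w 0)) :=
      hw.continuousAt.tendsto.mono_left nhdsWithin_le_nhds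
    refine ge_of_tendsto hw' ?_
    filter_upwards [hpos, hgw.filter_mono nhdsWithin_le_nhds, self_mem_nhdsWithin] with t h1 h2 h3
    rw [h2] at h1
    exact (pos_of_mul_pos_right h1 (pow_nonneg (le_of_lt h3) _)).le
  have e1 : ∀ᶠ t in 𝓝 (0 : ℝ), deriv g t = t ^ m * ((m + 1) * w t + t * deriv w t) := by
    filter_upwards [hgw.eventually_nhds, hw.eventually_analyticAt] with t h1 h2
    rw [Filter.EventuallyEq.deriv_eq h1]
    have := ((hasDerivAt_pow (m + 1) t).mul h2.differentiableAt.hasDerivAt).deriv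
    refine Eq.trans this ?_
    rw [Nat.add_sub_cancel]
    push_cast
    ring
  have e2 : ∀ᶠ t in 𝓝 (0 : ℝ), 0 < (m + 1) * w t + t * deriv w t := by
    have hc : ContinuousAt (fun t : ℝ => (m + 1) * w t + t * deriv w t) 0 :=
      (continuousAt_const.mul hw.continuousAt).add (continuousAt_id.mul hw.deriv.continuousAt)
    refine hc.eventually_const_lt (u := 0) ?_
    simp only [zero_mul, add_zero]
    positivity
  filter_upwards [e1.filter_mono nhdsWithin_le_nhds, e2.filter_mono nhdsWithin_le_nhds,
    self_mem_nhdsWithin] with t h1 h2 h3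
  rw [h1]
  exact mul_pos (pow_pos h3 m) h2

theorem sq_add_sq_pos_of_ne_zero {p : ℝ × ℝ} (hp : p ≠ 0) : 0 < p.1 ^ 2 + p.2 ^ 2 := by
  by_contra! h
  refine hp (Prod.ext ?_ ?_) <;> simp only [Prod.fst_zero, Prod.snd_zero] <;>
    nlinarith [sq_nonneg p.1, sq_nonneg p.2]

theorem DifferentiableAt.hasDerivAt_sq_add_sq {γ : ℝ → ℝ × ℝ} {t : ℝ}
    (h : DifferentiableAt ℝ γ t) : HasDerivAt (fun t => (γ t).1 ^ 2 + (γ t).2 ^ 2)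
      (2 * ((deriv γ t).1 * (γ t).1 + (deriv γ t).2 * (γ t).2)) t := by
  have h1 : HasDerivAt (fun t => (γ t).1) (deriv γ t).1 t :=
    (ContinuousLinearMap.fst ℝ ℝ ℝ).hasFDerivAt.comp_hasDerivAt t h.hasDerivAt
  have h2 : HasDerivAt (fun t => (γ t).2) (deriv γ t).2 t :=
    (ContinuousLinearMap.snd ℝ ℝ ℝ).hasFDerivAt.comp_hasDerivAt t h.hasDerivAt
  refine ((h1.fun_pow 2).fun_add (h2.fun_pow 2)).congr_deriv ?_
  norm_num
  ring

theorem IsBranchFamily.eventually_isRadial {H : ℝ × ℝ → ℝ} {Γ : Set (ℝ → ℝ × ℝ)}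
    (h : IsBranchFamily H {0}ᶜ Γ) : ∀ᶠ ε in 𝓝[>] (0 : ℝ),
      (∀ γ ∈ Γ, ∀ t ∈ Set.Ioo 0 ε, AnalyticAt ℝ γ t ∧ H (γ t) = 0 ∧
        0 < (deriv γ t).1 * (γ t).1 + (deriv γ t).2 * (γ t).2) ∧
      ∀ γ ∈ Γ, ∀ γ' ∈ Γ, γ ≠ γ' → ∀ t ∈ Set.Ioo 0 ε, ∀ t' ∈ Set.Ioo 0 ε, γ t ≠ γ' t' := by
  refine Eventually.and ?_ ?_
  · refine (Filter.eventually_all_finite h.finite).2 fun γ hγ =>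
      eventually_forall_Ioo_of_eventually_nhdsGT ?_
    have ha := h.analyticAt γ hγ
    have hg : AnalyticAt ℝ (fun t => (γ t).1 ^ 2 + (γ t).2 ^ 2) 0 :=
      (((ContinuousLinearMap.fst ℝ ℝ ℝ).analyticAt _).fun_comp ha |>.fun_pow 2).fun_add
        (((ContinuousLinearMap.snd ℝ ℝ ℝ).analyticAt _).fun_comp ha |>.fun_pow 2)
    have hd := hg.eventually_deriv_pos (by simp [h.map_zero γ hγ])
      ((h.mem_region γ hγ).mono fun t ht => sq_add_sq_pos_of_ne_zero ht)
    filter_upwards [hd, h.apply_eq_zero γ hγ,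
      ha.eventually_analyticAt.filter_mono nhdsWithin_le_nhds] with t h1 h2 h3
    refine ⟨h3, h2, ?_⟩
    rw [h3.differentiableAt.hasDerivAt_sq_add_sq.deriv] at h1
    linarith
  · refine (Filter.eventually_all_finite h.finite).2 fun γ hγ =>
      (Filter.eventually_all_finite h.finite).2 fun γ' hγ' => ?_
    by_cases hne : γ = γ'
    · simp [hne]
    · filter_upwards [h.disjoint γ hγ γ' hγ' hne] with ε hε _ using hε

theorem strictMonoOn_sq_add_sq {γ : ℝ → ℝ × ℝ} {ε : ℝ} (h0 : AnalyticAt ℝ γ 0)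
    (h : ∀ t ∈ Set.Ioo 0 ε, AnalyticAt ℝ γ t ∧
      0 < (deriv γ t).1 * (γ t).1 + (deriv γ t).2 * (γ t).2) :
    StrictMonoOn (fun t => (γ t).1 ^ 2 + (γ t).2 ^ 2) (Set.Ico 0 ε) := by
  refine strictMonoOn_of_deriv_pos (convex_Ico 0 ε) ?_ ?_
  · intro t ht
    have : ContinuousAt γ t := by
      rcases ht.1.eq_or_lt with rfl | h1
      · exact h0.continuousAt
      · exact (h t ⟨h1, ht.2⟩).1.continuousAt
    exact ContinuousAt.continuousWithinAt (by fun_prop)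
  · intro t ht
    rw [interior_Ico] at ht
    obtain ⟨h1, h2⟩ := h t ht
    rw [h1.differentiableAt.hasDerivAt_sq_add_sq.deriv]
    linarith

theorem eventually_nhdsGT_forall_mem_euclBall {P : ℝ × ℝ → Prop} (h : ∀ᶠ p in 𝓝 0, P p) :
    ∀ᶠ ρ in 𝓝[>] (0 : ℝ), ∀ p ∈ euclBall ρ, P p := by
  obtain ⟨r, hr, hball⟩ := Metric.eventually_nhds_iff_ball.1 h
  filter_upwards [Ioo_mem_nhdsGT hr] with ρ hρ p hp
  refine hball p ?_
  have hp' : p.1 ^ 2 + p.2 ^ 2 ≤ ρ ^ 2 := hp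
  rw [mem_ball_zero_iff, Prod.norm_def, max_lt_iff, Real.norm_eq_abs, Real.norm_eq_abs]
  constructor <;> refine lt_of_le_of_lt (abs_le_of_sq_le_sq ?_ hρ.1.le) hρ.2 <;>
    nlinarith [sq_nonneg p.1, sq_nonneg p.2]

/-- Local separatrix structure of the zero level set of an analytic function at an
isolated critical point which is not a local extremum: for every sufficiently small
`ρ > 0`, the zero level set of `H` in the closed Euclidean ball `B_ρ` is a finite
union of injective analytic curves from the origin to the boundary circle, pairwise
disjoint except at the origin, staying in the open ball except at their endpoint, and
meeting the boundary circle transversally. -/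
theorem separatrices_of_analytic_critical_point (H : ℝ × ℝ → ℝ)
    (hH : AnalyticAt ℝ H 0) (h0 : H 0 = 0) (hcrit : fderiv ℝ H 0 = 0)
    (hiso : ∀ᶠ p in nhds (0 : ℝ × ℝ), fderiv ℝ H p = 0 → p = 0)
    (hmax : ¬ IsLocalMax H 0) (hmin : ¬ IsLocalMin H 0) :
    ∃ ρ₀ > (0 : ℝ), ∀ ρ : ℝ, 0 < ρ → ρ < ρ₀ →
      ∃ (N : ℕ) (γ : Fin N → ℝ → ℝ × ℝ),
        (∀ i, AnalyticOnNhd ℝ (γ i) (Set.Icc (0 : ℝ) 1)) ∧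
        (∀ i, Set.InjOn (γ i) (Set.Icc (0 : ℝ) 1)) ∧
        (∀ i, γ i 0 = 0) ∧
        (∀ i, (γ i 1).1 ^ 2 + (γ i 1).2 ^ 2 = ρ ^ 2) ∧
        (∀ i, ∀ t ∈ Set.Ico (0 : ℝ) 1, (γ i t).1 ^ 2 + (γ i t).2 ^ 2 < ρ ^ 2) ∧
        ({p ∈ euclBall ρ | H p = 0} = ⋃ i, γ i '' Set.Icc (0 : ℝ) 1) ∧
        (∀ i j, i ≠ j →
          (γ i '' Set.Icc (0 : ℝ) 1) ∩ (γ j '' Set.Icc (0 : ℝ) 1) ⊆ {0}) ∧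
        (∀ i, (deriv (γ i) 1).1 * (γ i 1).1 + (deriv (γ i) 1).2 * (γ i 1).2 ≠ 0) := by
  have hfreq := frequently_eq_zero_of_not_isLocalExtr
    (hH.eventually_analyticAt.mono fun p hp => hp.continuousAt) h0 hmax hmin
  obtain ⟨Γ, hΓ⟩ := hH.exists_isBranchFamily fun h => hmax (h.mono fun p hp => by rw [hp, h0])
  obtain ⟨ε, ⟨hrad, hdisj⟩, hε⟩ := (hΓ.eventually_isRadial.and self_mem_nhdsWithin).exists
  replace hε : 0 < ε := hε
  set δ := ε / 2 with hδ
  have hδ0 : 0 < δ := half_pos hε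
  have hδε : δ < ε := half_lt_self hε
  have hmono : ∀ γ ∈ Γ, StrictMonoOn (fun t => (γ t).1 ^ 2 + (γ t).2 ^ 2) (Set.Ico 0 ε) :=
    fun γ hγ => strictMonoOn_sq_add_sq (hΓ.analyticAt γ hγ)
      fun t ht => ⟨(hrad γ hγ t ht).1, (hrad γ hγ t ht).2.2⟩
  have hcover := hΓ.cover δ hδ0
  have hNe : Γ.Nonempty := by
    obtain ⟨p, ⟨h1, h2⟩, h3⟩ := (hfreq.and_eventually hcover).exists
    obtain ⟨γ, hγ, _⟩ := h3 h1 h2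
    exact ⟨γ, hγ⟩
  have hsmall : ∀ᶠ ρ in 𝓝[>] (0 : ℝ), ∀ γ ∈ Γ, ρ ^ 2 < (γ δ).1 ^ 2 + (γ δ).2 ^ 2 := by
    refine (Filter.eventually_all_finite hΓ.finite).2 fun γ hγ => ?_
    have h1 := hmono γ hγ ⟨le_rfl, hε⟩ ⟨hδ0.le, hδε⟩ hδ0
    have hc : ContinuousAt (fun ρ : ℝ => ρ ^ 2) 0 := by fun_prop
    refine (hc.eventually_lt_const ?_).filter_mono nhdsWithin_le_nhds
    simpa [hΓ.map_zero γ hγ] using h1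
  obtain ⟨ρ₀, hρ₀, hall⟩ := mem_nhdsGT_iff_exists_Ioo_subset.1
    (hsmall.and (eventually_nhdsGT_forall_mem_euclBall hcover))
  refine ⟨ρ₀, hρ₀, fun ρ hρ hρρ₀ => ?_⟩
  obtain ⟨hρδ, hρcover⟩ := hall ⟨hρ, hρρ₀⟩
  have hτ : ∀ γ ∈ Γ, ∃ τ ∈ Set.Ioo 0 δ, (γ τ).1 ^ 2 + (γ τ).2 ^ 2 = ρ ^ 2 := by
    intro γ hγ
    have hc : ContinuousOn (fun t => (γ t).1 ^ 2 + (γ t).2 ^ 2) (Set.Icc 0 δ) := by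
      intro t ht
      have : ContinuousAt γ t := by
        rcases ht.1.eq_or_lt with rfl | h1
        · exact (hΓ.analyticAt γ hγ).continuousAt
        · exact (hrad γ hγ t ⟨h1, ht.2.trans_lt hδε⟩).1.continuousAt
      exact ContinuousAt.continuousWithinAt (by fun_prop)
    refine intermediate_value_Ioo hδ0.le hc ⟨?_, hρδ γ hγ⟩
    simpa [hΓ.map_zero γ hγ] using pow_pos hρ 2
  choose! τ hτ hτρ using hτ
  have : Finite Γ := hΓ.finite
  obtain ⟨N, ⟨e⟩⟩ := Finite.exists_equiv_fin Γ
  set c : Fin N → ℝ → ℝ × ℝ := fun i => e.symm i with hc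
  have hcΓ : ∀ i, c i ∈ Γ := fun i => (e.symm i).2
  have hτε : ∀ i, ∀ t ∈ Set.Icc (0 : ℝ) 1, τ (c i) * t ∈ Set.Ico 0 ε := by
    intro i t ht
    obtain ⟨h1, h2⟩ := hτ _ (hcΓ i)
    exact ⟨mul_nonneg h1.le ht.1, by nlinarith [ht.2]⟩
  have hτpos : ∀ i, ∀ t ∈ Set.Icc (0 : ℝ) 1, t ≠ 0 → τ (c i) * t ∈ Set.Ioo 0 ε :=
    fun i t ht h => ⟨mul_pos (hτ _ (hcΓ i)).1 (lt_of_le_of_ne ht.1 h.symm), (hτε i t ht).2⟩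
  have han : ∀ i, ∀ t ∈ Set.Icc (0 : ℝ) 1, AnalyticAt ℝ (c i) (τ (c i) * t) := by
    intro i t ht
    by_cases h : t = 0
    · rw [h, mul_zero]
      exact hΓ.analyticAt _ (hcΓ i)
    · exact (hrad _ (hcΓ i) _ (hτpos i t ht h)).1
  have hzero : ∀ i, ∀ t ∈ Set.Icc (0 : ℝ) 1, H (c i (τ (c i) * t)) = 0 := by
    intro i t ht
    by_cases h : t = 0
    · rw [h, mul_zero, hΓ.map_zero _ (hcΓ i), h0]
    · exact (hrad _ (hcΓ i) _ (hτpos i t ht h)).2.1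
  have h1mem : (1 : ℝ) ∈ Set.Icc (0 : ℝ) 1 := Set.right_mem_Icc.2 zero_le_one
  have hlt : ∀ i, ∀ t ∈ Set.Ico (0 : ℝ) 1,
      (c i (τ (c i) * t)).1 ^ 2 + (c i (τ (c i) * t)).2 ^ 2 < ρ ^ 2 := by
    intro i t ht
    rw [← hτρ _ (hcΓ i)]
    have h1 := hτε i 1 h1mem
    rw [mul_one] at h1
    refine hmono _ (hcΓ i) (hτε i t ⟨ht.1, ht.2.le⟩) h1 ?_
    nlinarith [(hτ _ (hcΓ i)).1, ht.2]
  refine ⟨N, fun i t => c i (τ (c i) * t), ?_, ?_, ?_, ?_, hlt, ?_, ?_, ?_⟩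
  · intro i t ht
    exact (han i t ht).fun_comp (f := fun t => τ (c i) * t) (by fun_prop)
  · intro i t ht t' ht' h
    have h1 := (hmono _ (hcΓ i)).injOn (hτε i t ht) (hτε i t' ht') (by simp only [h])
    exact mul_left_cancel₀ (hτ _ (hcΓ i)).1.ne' h1
  · intro i
    simp only [mul_zero, hΓ.map_zero _ (hcΓ i)]
  · intro i
    simp only [mul_one, hτρ _ (hcΓ i)]
  · ext p
    simp only [Set.mem_iUnion, Set.mem_image]
    constructor
    · rintro ⟨hp, hp0⟩
      by_cases h : p = 0
      · obtain ⟨γ, hγ⟩ := hNe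
        refine ⟨e ⟨γ, hγ⟩, 0, Set.left_mem_Icc.2 zero_le_one, ?_⟩
        rw [mul_zero, hΓ.map_zero _ (hcΓ _), h]
      · obtain ⟨γ, hγ, t, ht, hpt⟩ := hρcover p hp hp0 h
        have hcγ : c (e ⟨γ, hγ⟩) = γ := by simp [hc]
        have h1 := hτ γ hγ
        have h2 : t ≤ τ γ := by
          by_contra! h3
          have h4 := hmono γ hγ ⟨h1.1.le, h1.2.trans hδε⟩ ⟨ht.1.le, ht.2.trans hδε⟩ h3
          simp only [hτρ γ hγ, hpt] at h4
          exact absurd hp (not_le.2 h4)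
        refine ⟨e ⟨γ, hγ⟩, t / τ γ, ⟨div_nonneg ht.1.le h1.1.le, (div_le_one h1.1).2 h2⟩, ?_⟩
        rw [hcγ, mul_div_cancel₀ _ h1.1.ne', hpt]
    · rintro ⟨i, t, ht, rfl⟩
      refine ⟨?_, hzero i t ht⟩
      rcases ht.2.eq_or_lt with rfl | h
      · rw [mul_one]
        exact (hτρ _ (hcΓ i)).le
      · exact (hlt i t ⟨ht.1, h⟩).le
  · rintro i j hij _ ⟨⟨t, ht, rfl⟩, ⟨t', ht', h⟩⟩
    have hne : c j ≠ c i := fun h => hij (e.symm.injective (Subtype.ext h)).symm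
    by_cases ht0 : t = 0
    · simp [ht0, hΓ.map_zero _ (hcΓ i)]
    by_cases ht0' : t' = 0
    · rw [Set.mem_singleton_iff, ← h]
      simp [ht0', hΓ.map_zero _ (hcΓ j)]
    exact absurd h (hdisj _ (hcΓ j) _ (hcΓ i) hne _ (hτpos j t' ht' ht0') _ (hτpos i t ht ht0))
  · intro i
    have h1 := hrad _ (hcΓ i) _ (hτpos i 1 h1mem one_ne_zero)
    have h2 : deriv (fun t => c i (τ (c i) * t)) 1 = τ (c i) • deriv (c i) (τ (c i) * 1) :=
      deriv_comp_mul_left _ _ _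
    rw [h2]
    simp only [Prod.smul_fst, Prod.smul_snd, smul_eq_mul]
    have h3 := mul_pos (hτ _ (hcΓ i)).1 h1.2.2
    refine ne_of_gt (h3.trans_eq ?_)
    ring
end
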